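/- Let (n, θ) be a closed cycle and let d ∈ {interior, exterior}. Then there exist a finite type W with card W ≤ n, and a finite family of at most n clauses, each clause being a pair (S, c) with S a finite subset of (ZMod n) ⊕ W and c ∈ ℕ, such that every element of (ZMod n) ⊕ W belongs to at most two of the sets S, and such that for every MV assignment μ : ZMod n → {mountain, valley}: μ is flat foldable as a face with designation d if and only if there exists b : W → Bool such that for every clause (S, c), the number of elements of S that are true equals c, where an element i ∈ ZMod n counts as true iff μ i = mountain and an element w ∈ W counts as true iff b w = true. -/

import Mathlib

/-- Mountain or valley fold type. -/
inductive MV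
  | mountain
  | valley
deriving DecidableEq

/-- Designation of a face as interior or exterior. -/
inductive Des
  | interior
  | exterior
deriving DecidableEq

/-- The sign `ε` used at the top layer: `-1` for an interior face, `+1` for an
exterior face. -/
def epsOf : Des → ℝ
  | Des.interior => -1
  | Des.exterior => 1

/-- The folded coordinates of a closed cycle: `x 0 = 0` and
`x (i+1) = x i + (-1)^i * θ i`. -/
noncomputable def foldedX (n : ℕ) (θ : ZMod n → ℝ) : ZMod n → ℝ :=
  fun i => ∑ j ∈ Finset.range i.val, (-1 : ℝ) ^ j * θ (j : ZMod n)

/-- `(n, θ)` is a closed cycle: `n` is even, `n ≥ 2`, all edge lengths are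
positive, and the alternating sum of the edge lengths is zero. -/
noncomputable def IsClosedCycle (n : ℕ) (θ : ZMod n → ℝ) : Prop :=
  Even n ∧ 2 ≤ n ∧ (∀ i, 0 < θ i) ∧
    ∑ j ∈ Finset.range n, (-1 : ℝ) ^ j * θ (j : ZMod n) = 0

/-- The open interval whose endpoint set is `{a, b}`. -/
def betw (a b : ℝ) : Set ℝ := Set.Ioo (min a b) (max a b)

/-- `L` is a valid layering of the edges of a cycle folded to coordinates `x`:
`L` is injective; (i) no edge passes strictly between the two edges joined at a
crease at the crease's coordinate; (ii) creases at the same coordinate opening in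
the same direction are disjoint or nested. -/
def ValidLayering (n : ℕ) (x L : ZMod n → ℝ) : Prop :=
  Function.Injective L ∧
  (∀ i e : ZMod n, x i ∈ betw (x e) (x (e + 1)) →
      L e ∉ betw (L (i - 1)) (L i)) ∧
  (∀ i j : ZMod n, i ≠ j → x i = x j →
      Real.sign (x (i + 1) - x i) = Real.sign (x (j + 1) - x j) →
      Disjoint (betw (L (i - 1)) (L i)) (betw (L (j - 1)) (L j)) ∨
        betw (L (i - 1)) (L i) ⊆ betw (L (j - 1)) (L j) ∨
        betw (L (j - 1)) (L j) ⊆ betw (L (i - 1)) (L i))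

/-- The layering `L` realizes the MV assignment `μ` with top-layer sign `ε`:
taking `t` to be the index maximizing `L` and `s` the alternating `±1` map with
`s t = ε`, each crease `i` is a valley iff `s (i-1)` equals the sign of
`L i - L (i-1)`. -/
def Realizes (n : ℕ) (L : ZMod n → ℝ) (μ : ZMod n → MV) (ε : ℝ) : Prop :=
  ∃ t : ZMod n, (∀ j, L j ≤ L t) ∧
    ∃ s : ZMod n → ℝ, (∀ i, s i = 1 ∨ s i = -1) ∧ (∀ i, s (i + 1) = -s i) ∧
      s t = ε ∧
      ∀ i, μ i = MV.valley ↔ s (i - 1) = Real.sign (L i - L (i - 1))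

/-- The MV assignment `μ` on the closed cycle `(n, θ)` is flat foldable as a
face with designation `d`: some valid layering of the folded cycle realizes it. -/
noncomputable def FlatFoldable (n : ℕ) (θ : ZMod n → ℝ) (μ : ZMod n → MV)
    (d : Des) : Prop :=
  ∃ L : ZMod n → ℝ, ValidLayering n (foldedX n θ) L ∧ Realizes n L μ (epsOf d)

/-- The folded diameter of a closed cycle: `max x - min x` over the folded
coordinates. -/
noncomputable def foldedDiameter (n : ℕ) [NeZero n] (θ : ZMod n → ℝ) : ℝ :=
  Finset.univ.sup' ⟨0, Finset.mem_univ 0⟩ (foldedX n θ) -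
    Finset.univ.inf' ⟨0, Finset.mem_univ 0⟩ (foldedX n θ)



namespace FC

def btw (u v w : ℝ) : Prop := (u < w ∧ w < v) ∨ (v < w ∧ w < u)

structure Geo {E : Type} (F : E → Prop) (CL CR : E → E → Prop) (lo hi L : E → ℝ) : Prop where
  pos : ∀ e, F e → lo e < hi e
  inj : ∀ e f, F e → F f → L e = L f → e = f
  cls : ∀ p q, CL p q → CL q p
  crs : ∀ p q, CR p q → CR q p
  cl : ∀ p q, CL p q → F p ∧ F q ∧ hi p = hi q
  cr : ∀ p q, CR p q → F p ∧ F q ∧ lo p = lo q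
  l1 : ∀ p q g, CL p q → F g → lo g < hi p → hi p < hi g → ¬ btw (L p) (L q) (L g)
  r1 : ∀ p q g, CR p q → F g → lo g < lo p → lo p < hi g → ¬ btw (L p) (L q) (L g)
  l2 : ∀ p q p' q', CL p q → CL p' q' → hi p = hi p' →
    (btw (L p') (L q') (L p) ↔ btw (L p') (L q') (L q))
  r2 : ∀ p q p' q', CR p q → CR p' q' → lo p = lo p' →
    (btw (L p') (L q') (L p) ↔ btw (L p') (L q') (L q))

theorem btw_neg (u v w : ℝ) : btw (-u) (-v) (-w) ↔ btw u v w := by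
  unfold btw; constructor <;> rintro (h | h) <;> [right; left; right; left] <;>
    constructor <;> linarith [h.1, h.2]

theorem Geo.reflect {E : Type} {F : E → Prop} {CL CR : E → E → Prop} {lo hi L : E → ℝ}
    (h : Geo F CL CR lo hi L) : Geo F CR CL (fun e => - hi e) (fun e => - lo e) L where
  pos e he := neg_lt_neg (h.pos e he)
  inj := h.inj
  cls := h.crs
  crs := h.cls
  cl p q c := by have := h.cr p q c; exact ⟨this.1, this.2.1, by rw [this.2.2]⟩
  cr p q c := by have := h.cl p q c; exact ⟨this.1, this.2.1, by rw [this.2.2]⟩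
  l1 p q g c hg h1 h2 := h.r1 p q g c hg (by linarith) (by linarith)
  r1 p q g c hg h1 h2 := h.l1 p q g c hg (by linarith) (by linarith)
  l2 p q p' q' c c' e := h.r2 p q p' q' c c' (by linarith)
  r2 p q p' q' c c' e := h.l2 p q p' q' c c' (by linarith)

theorem Geo.flip {E : Type} {F : E → Prop} {CL CR : E → E → Prop} {lo hi L : E → ℝ}
    (h : Geo F CL CR lo hi L) : Geo F CL CR lo hi (fun e => - L e) where
  pos := h.pos
  inj e f he hf hh := h.inj e f he hf (by linarith)
  cls := h.cls
  crs := h.crs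
  cl := h.cl
  cr := h.cr
  l1 p q g c hg h1 h2 := by rw [btw_neg]; exact h.l1 p q g c hg h1 h2
  r1 p q g c hg h1 h2 := by rw [btw_neg]; exact h.r1 p q g c hg h1 h2
  l2 p q p' q' c c' e := by rw [btw_neg, btw_neg]; exact h.l2 p q p' q' c c' e
  r2 p q p' q' c c' e := by rw [btw_neg, btw_neg]; exact h.r2 p q p' q' c c' e

/-- pure order facts about up/down classification. -/
def UpSpec {E : Type} (R : E → Prop) (lo hi L : E → ℝ) (P Z Q : E) (up : E → Prop) : Prop :=
  (∀ g, R g → up g → L Q < L g ∨ (L P < L g ∧ L g < L Z ∧ hi g ≤ hi Z) ∨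
      (L Z < L g ∧ L g < L Q ∧ hi g ≤ lo Z)) ∧
  (∀ g, R g → ¬ up g → L g < L P ∨ (L P < L g ∧ L g < L Z ∧ hi Z ≤ lo g) ∨
      (L Z < L g ∧ L g < L Q ∧ lo Z ≤ lo g))

theorem UpSpec.rot {E : Type} {R : E → Prop} {lo hi L : E → ℝ} {P Z Q : E} {up : E → Prop}
    (h : UpSpec R lo hi L P Z Q up) :
    UpSpec R (fun e => -hi e) (fun e => -lo e) (fun e => - L e) Q Z P (fun e => ¬ up e) := by
  refine ⟨fun g hg hu => ?_, fun g hg hu => ?_⟩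
  · rcases h.2 g hg hu with h | ⟨h1, h2, h3⟩ | ⟨h1, h2, h3⟩
    · left; linarith
    · right; right; exact ⟨by linarith, by linarith, by linarith⟩
    · right; left; exact ⟨by linarith, by linarith, by linarith⟩
  · rcases h.1 g hg (not_not.1 hu) with h | ⟨h1, h2, h3⟩ | ⟨h1, h2, h3⟩
    · left; linarith
    · right; right; exact ⟨by linarith, by linarith, by linarith⟩
    · right; left; exact ⟨by linarith, by linarith, by linarith⟩

section core
variable {E : Type} {F : E → Prop} {CL CR : E → E → Prop} {lo hi L : E → ℝ}
  {R : E → Prop} {P Z Q : E} {up : E → Prop}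

structure CoreH (F : E → Prop) (CL CR : E → E → Prop) (lo hi L : E → ℝ)
    (R : E → Prop) (P Z Q : E) (up : E → Prop) : Prop where
  G : Geo F CL CR lo hi L
  hu : UpSpec R lo hi L P Z Q up
  hRF : ∀ g, R g → F g
  hP : F P
  hZ : F Z
  hQ : F Q
  hPZ : CL P Z
  hZQ : CR Z Q
  h1 : L P < L Z
  h2 : L Z < L Q
  h3 : lo P ≤ lo Z
  h4 : hi Z ≤ hi Q
  hn : ¬ R P ∧ ¬ R Z ∧ ¬ R Q

theorem CoreH.rot (H : CoreH F CL CR lo hi L R P Z Q up) :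
    CoreH F CR CL (fun e => -hi e) (fun e => -lo e) (fun e => - L e) R Q Z P (fun e => ¬ up e) where
  G := H.G.reflect.flip
  hu := H.hu.rot
  hRF := H.hRF
  hP := H.hQ
  hZ := H.hZ
  hQ := H.hP
  hPZ := H.G.crs _ _ H.hZQ
  hZQ := H.G.cls _ _ H.hPZ
  h1 := neg_lt_neg H.h2
  h2 := neg_lt_neg H.h1
  h3 := neg_le_neg H.h4
  h4 := neg_le_neg H.h3
  hn := ⟨H.hn.2.2, H.hn.2.1, H.hn.1⟩

/-- adjacent edges are never inverted (left-opening creases) -/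
theorem core_adjL (H : CoreH F CL CR lo hi L R P Z Q up)
    (p q : E) (hp : R p) (hq : R q) (hc : CL p q) (hup : up p) (hdn : ¬ up q) : L q < L p := by
  obtain ⟨G, hu, hRF, hP, hZ, hQ, hPZ, hZQ, h1, h2, h3, h4, hn⟩ := H
  have a1 := hu.1 p hp hup
  have a2 := hu.2 q hq hdn
  obtain ⟨-, -, e1⟩ := G.cl p q hc
  obtain ⟨-, -, e2⟩ := G.cl P Z hPZ
  obtain ⟨-, -, e3⟩ := G.cr Z Q hZQ
  have pp := G.pos p (hRF p hp)
  have pq := G.pos q (hRF q hq)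
  have pZ := G.pos Z hZ
  by_contra hlt
  have b1 := G.l1 p q Z hc hZ
  have b2 := G.l2 p q P Z hc hPZ
  have b3 := G.l2 P Z p q hPZ hc
  have b4 := G.l1 p q P hc hP
  have b5 := G.l1 p q Q hc hQ
  unfold btw at *
  grind

/-- a mixed crease is outside the merged edge -/
theorem core_mixL (H : CoreH F CL CR lo hi L R P Z Q up)
    (p q : E) (hp : R p) (hq : R q) (hc : CL p q) (hup : up p) (hdn : ¬ up q) :
    hi p ≤ lo P ∨ hi Q ≤ hi p := by
  have hlt := core_adjL H p q hp hq hc hup hdn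
  obtain ⟨G, hu, hRF, hP, hZ, hQ, hPZ, hZQ, h1, h2, h3, h4, hn⟩ := H
  have a1 := hu.1 p hp hup
  have a2 := hu.2 q hq hdn
  obtain ⟨-, -, e1⟩ := G.cl p q hc
  obtain ⟨-, -, e2⟩ := G.cl P Z hPZ
  obtain ⟨-, -, e3⟩ := G.cr Z Q hZQ
  have pp := G.pos p (hRF p hp)
  have pq := G.pos q (hRF q hq)
  have pZ := G.pos Z hZ
  by_contra hcon
  have b1 := G.l1 p q Z hc hZ
  have b2 := G.l2 p q P Z hc hPZ
  have b3 := G.l2 P Z p q hPZ hc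
  have b4 := G.l1 p q P hc hP
  have b5 := G.l1 p q Q hc hQ
  unfold btw at *
  grind

/-- a mixed crease and a passing edge -/
theorem core_passL (H : CoreH F CL CR lo hi L R P Z Q up)
    (p q g : E) (hp : R p) (hq : R q) (hg : R g) (hc : CL p q) (hup : up p) (hdn : ¬ up q)
    (y1 : lo g < hi p) (y2 : hi p < hi g) :
    (up g → L p < L g) ∧ (¬ up g → L g < L q) := by
  have hlt := core_adjL H p q hp hq hc hup hdn
  have hm := core_mixL H p q hp hq hc hup hdn
  obtain ⟨G, hu, hRF, hP, hZ, hQ, hPZ, hZQ, h1, h2, h3, h4, hn⟩ := H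
  have a1 := hu.1 p hp hup
  have a2 := hu.2 q hq hdn
  have a3 := hu.1 g hg
  have a4 := hu.2 g hg
  obtain ⟨-, -, e1⟩ := G.cl p q hc
  obtain ⟨-, -, e2⟩ := G.cl P Z hPZ
  obtain ⟨-, -, e3⟩ := G.cr Z Q hZQ
  have pp := G.pos p (hRF p hp)
  have pq := G.pos q (hRF q hq)
  have pZ := G.pos Z hZ
  have ne1 := G.inj g p (hRF g hg) (hRF p hp)
  have ne2 := G.inj g q (hRF g hg) (hRF q hq)
  have b0 := G.l1 p q g hc (hRF g hg) y1 y2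
  have b1 := G.l1 p q Z hc hZ
  have b2 := G.l2 p q P Z hc hPZ
  have b3 := G.l2 P Z p q hPZ hc
  have b4 := G.l1 p q P hc hP
  have b5 := G.l1 p q Q hc hQ
  unfold btw at *
  grind

/-- a mixed crease and another crease -/
theorem core_pairL (H : CoreH F CL CR lo hi L R P Z Q up)
    (p q p' q' : E) (hp : R p) (hq : R q) (hp' : R p') (hq' : R q')
    (hc : CL p q) (hc' : CL p' q') (hup : up p) (hdn : ¬ up q) (hpp : hi p = hi p') :
    (up p' → up q' → (L p' < L p ↔ L q' < L p)) ∧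
    (¬ up p' → ¬ up q' → (L q < L p' ↔ L q < L q')) ∧
    (up p' → ¬ up q' → (L p' < L p ↔ L q < L q')) := by
  have hlt := core_adjL H p q hp hq hc hup hdn
  have hm := core_mixL H p q hp hq hc hup hdn
  obtain ⟨G, hu, hRF, hP, hZ, hQ, hPZ, hZQ, h1, h2, h3, h4, hn⟩ := H
  have a1 := hu.1 p hp hup
  have a2 := hu.2 q hq hdn
  have a3 := hu.1 p' hp'
  have a4 := hu.2 p' hp'
  have a5 := hu.1 q' hq'
  have a6 := hu.2 q' hq'
  obtain ⟨-, -, e1⟩ := G.cl p q hc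
  obtain ⟨-, -, e2⟩ := G.cl P Z hPZ
  obtain ⟨-, -, e3⟩ := G.cr Z Q hZQ
  obtain ⟨-, -, e4⟩ := G.cl p' q' hc'
  have pp := G.pos p (hRF p hp)
  have pq := G.pos q (hRF q hq)
  have pZ := G.pos Z hZ
  have pp' := G.pos p' (hRF p' hp')
  have pq' := G.pos q' (hRF q' hq')
  have ne1 := G.inj p' p (hRF p' hp') (hRF p hp)
  have ne2 := G.inj p' q (hRF p' hp') (hRF q hq)
  have ne3 := G.inj q' p (hRF q' hq') (hRF p hp)
  have ne4 := G.inj q' q (hRF q' hq') (hRF q hq)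
  have b0 := G.l2 p q p' q' hc hc' hpp
  have b0' := G.l2 p' q' p q hc' hc hpp.symm
  have b2 := G.l2 p q P Z hc hPZ
  have b2' := G.l2 p' q' P Z hc' hPZ
  unfold btw at *
  refine ⟨?_, ?_, ?_⟩
  · grind
  · grind
  · grind

/-- the merged edge's right crease -/
theorem core_adjM (H : CoreH F CL CR lo hi L R P Z Q up)
    (q : E) (hq : R q) (hc : CL Q q) : (up q ↔ L Q < L q) := by
  obtain ⟨G, hu, hRF, hP, hZ, hQ, hPZ, hZQ, h1, h2, h3, h4, hn⟩ := H
  have a1 := hu.1 q hq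
  have a2 := hu.2 q hq
  obtain ⟨-, -, e1⟩ := G.cl Q q hc
  obtain ⟨-, -, e2⟩ := G.cl P Z hPZ
  obtain ⟨-, -, e3⟩ := G.cr Z Q hZQ
  have pq := G.pos q (hRF q hq)
  have pZ := G.pos Z hZ
  have pQ := G.pos Q hQ
  have b2 := G.l2 Q q P Z hc hPZ
  have b3 := G.l2 P Z Q q hPZ hc
  have b4 := G.l1 P Z q hPZ (hRF q hq)
  have b5 := G.r1 Z Q q hZQ (hRF q hq)
  unfold btw at *
  grind

theorem core_passM (H : CoreH F CL CR lo hi L R P Z Q up)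
    (q g : E) (hq : R q) (hg : R g) (hc : CL Q q)
    (y1 : lo g < hi Q) (y2 : hi Q < hi g) :
    (up q → up g → L q < L g) ∧ (¬ up q → ¬ up g → L g < L q) := by
  have hm := core_adjM H q hq hc
  obtain ⟨G, hu, hRF, hP, hZ, hQ, hPZ, hZQ, h1, h2, h3, h4, hn⟩ := H
  have a1 := hu.1 g hg
  have a2 := hu.2 g hg
  obtain ⟨-, -, e1⟩ := G.cl Q q hc
  obtain ⟨-, -, e2⟩ := G.cl P Z hPZ
  obtain ⟨-, -, e3⟩ := G.cr Z Q hZQ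
  have pg := G.pos g (hRF g hg)
  have pZ := G.pos Z hZ
  have ne1 := G.inj g q (hRF g hg) (hRF q hq)
  have b2 := G.l1 Q q g hc (hRF g hg) y1 y2
  have b4 := G.l1 P Z g hPZ (hRF g hg)
  have b5 := G.r1 Z Q g hZQ (hRF g hg)
  unfold btw at *
  grind

theorem core_pairM (H : CoreH F CL CR lo hi L R P Z Q up)
    (q p' q' : E) (hq : R q) (hp' : R p') (hq' : R q')
    (hc : CL Q q) (hc' : CL p' q') (hpp : hi Q = hi p') :
    (up q → up p' → up q' → (L p' < L q ↔ L q' < L q)) ∧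
    (¬ up q → ¬ up p' → ¬ up q' → (L q < L p' ↔ L q < L q')) ∧
    (up q → up p' → ¬ up q' → L q < L p') ∧
    (¬ up q → up p' → ¬ up q' → L q' < L q) ∧
    (up p' → up q' → ¬ btw (L p') (L q') (L q) ∨ ¬ up q) ∧
    (¬ up p' → ¬ up q' → ¬ btw (L p') (L q') (L q) ∨ up q) := by
  have hm := core_adjM H q hq hc
  have hlt := core_adjL H p' q' hp' hq' hc'
  obtain ⟨G, hu, hRF, hP, hZ, hQ, hPZ, hZQ, h1, h2, h3, h4, hn⟩ := H
  have a3 := hu.1 p' hp'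
  have a4 := hu.2 p' hp'
  have a5 := hu.1 q' hq'
  have a6 := hu.2 q' hq'
  obtain ⟨-, -, e1⟩ := G.cl Q q hc
  obtain ⟨-, -, e2⟩ := G.cl P Z hPZ
  obtain ⟨-, -, e3⟩ := G.cr Z Q hZQ
  obtain ⟨-, -, e4⟩ := G.cl p' q' hc'
  have pZ := G.pos Z hZ
  have pp' := G.pos p' (hRF p' hp')
  have pq' := G.pos q' (hRF q' hq')
  have ne1 := G.inj p' q (hRF p' hp') (hRF q hq)
  have ne3 := G.inj q' q (hRF q' hq') (hRF q hq)
  have b0 := G.l2 Q q p' q' hc hc' hpp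
  have b0' := G.l2 p' q' Q q hc' hc hpp.symm
  have b2' := G.l2 p' q' P Z hc' hPZ
  unfold btw at *
  refine ⟨?_, ?_, ?_, ?_, ?_, ?_⟩
  · grind
  · grind
  · grind
  · grind
  · grind
  · grind
end core
end FC

set_option linter.unusedVariables false
set_option linter.unusedSimpArgs false
namespace FC
section core
variable {E : Type} {F : E → Prop} {CL CR : E → E → Prop} {lo hi L : E → ℝ}
  {R : E → Prop} {P Z Q : E} {up : E → Prop}

def FO (R : E → Prop) : Option E → Prop
  | none => True
  | some g => R g

def rep (X : E) : Option E → E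
  | none => X
  | some g => g

def CO (R : E → Prop) (C : E → E → Prop) (X : E) (x y : Option E) : Prop :=
  FO R x ∧ FO R y ∧ C (rep X x) (rep X y)

def LSpec (R : E → Prop) (L : E → ℝ) (up : E → Prop) (L' : Option E → ℝ) : Prop :=
  (∀ p q, R p → R q → (L' (some p) < L' (some q) ↔
    (up p ∧ up q ∧ L p < L q) ∨ (¬ up p ∧ ¬ up q ∧ L p < L q) ∨ (¬ up p ∧ up q))) ∧
  (∀ p, R p → (L' none < L' (some p) ↔ up p)) ∧
  (∀ p, R p → (L' (some p) < L' none ↔ ¬ up p))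

theorem LSpec.rot {L' : Option E → ℝ} (h : LSpec R L up L') :
    LSpec R (fun e => - L e) (fun e => ¬ up e) (fun e => - L' e) := by
  refine ⟨fun p q hp hq => ?_, fun p hp => ?_, fun p hp => ?_⟩
  · simp only [neg_lt_neg_iff, h.1 q p hq hp]; tauto
  · simp only [neg_lt_neg_iff, h.2.2 p hp]
  · simp only [neg_lt_neg_iff, h.2.1 p hp]; tauto

theorem btw_symm {u v w : ℝ} : btw u v w ↔ btw v u w := by unfold btw; tauto

theorem coreL1 (H : CoreH F CL CR lo hi L R P Z Q up) {L' : Option E → ℝ} (hL : LSpec R L up L')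
    (x y g : Option E) (hc : CO R CL Q x y) (hg : FO R g)
    (y1 : lo (rep P g) < hi (rep Q x)) (y2 : hi (rep Q x) < hi (rep Q g)) :
    ¬ btw (L' x) (L' y) (L' g) := by
  obtain ⟨hx, hy, hc⟩ := hc
  wlog hxs : (∃ p, x = some p) with W
  · have hxn : x = none := by
      cases x with
      | none => rfl
      | some p => exact absurd ⟨p, rfl⟩ hxs
    cases y with
    | none => subst hxn; intro hb; unfold btw at hb; rcases hb with hb | hb <;> linarith [hb.1, hb.2]
    | some q =>
      rw [btw_symm]
      have e := (H.G.cl _ _ hc).2.2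
      exact W H hL (some q) x g hg (by rw [← e]; exact y1) (by rw [← e]; exact y2) hy hx
        (H.G.cls _ _ hc) ⟨q, rfl⟩
  obtain ⟨p, rfl⟩ := hxs
  simp only [rep, FO] at *
  cases y with
  | none =>
    cases g with
    | none =>
      have e := (H.G.cl _ _ hc).2.2
      simp only [rep, FO] at *
      linarith
    | some g =>
      simp only [rep, FO] at *
      have e := (H.G.cl _ _ hc).2.2
      have t1 := core_passM H p g hx hg (H.G.cls _ _ hc) (by rw [← e]; exact y1)
        (by rw [← e]; exact y2)
      have := hL.1 p g hx hg
      have := hL.1 g p hg hx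
      have := hL.2.1 p hx
      have := hL.2.2 p hx
      have := hL.2.1 g hg
      have := hL.2.2 g hg
      clear hL H
      unfold btw
      grind
  | some q =>
    simp only [rep, FO] at *
    have e := (H.G.cl _ _ hc).2.2
    cases g with
    | none =>
      have t1 := core_mixL H p q hx hy hc
      have t2 := core_mixL H q p hy hx (H.G.cls _ _ hc)
      have := hL.2.1 p hx
      have := hL.2.2 p hx
      have := hL.2.1 q hy
      have := hL.2.2 q hy
      simp only [rep] at *
      clear hL H
      unfold btw
      grind
    | some g =>
      simp only [rep, FO] at *
      have t1 := core_passL H p q g hx hy hg hc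
      have t2 := core_passL H q p g hy hx hg (H.G.cls _ _ hc)
      have t3 := H.G.l1 p q g hc (H.hRF g hg) y1 y2
      have := hL.1 p g hx hg
      have := hL.1 g p hg hx
      have := hL.1 q g hy hg
      have := hL.1 g q hg hy
      clear hL H
      unfold btw at *
      grind

theorem coreL2 (H : CoreH F CL CR lo hi L R P Z Q up) {L' : Option E → ℝ} (hL : LSpec R L up L')
    (x y x' y' : Option E) (hc : CO R CL Q x y) (hc' : CO R CL Q x' y')
    (hxx : hi (rep Q x) = hi (rep Q x')) :
    btw (L' x') (L' y') (L' x) ↔ btw (L' x') (L' y') (L' y) := by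
  obtain ⟨hx, hy, hc⟩ := hc
  obtain ⟨hx', hy', hc'⟩ := hc'
  wlog hxs : (∃ p, x' = some p) with W
  · have hxn : x' = none := by
      cases x' with
      | none => rfl
      | some p => exact absurd ⟨p, rfl⟩ hxs
    cases y' with
    | none => subst hxn; unfold btw; grind
    | some q =>
      rw [btw_symm, btw_symm (u := L' x')]
      have e := (H.G.cl _ _ hc').2.2
      exact W H hL x y (some q) x' (by rw [← e]; exact hxx) hx hy hc hy' hx'
        (H.G.cls _ _ hc') ⟨q, rfl⟩
  wlog hxs' : (∃ p, y = some p) generalizing x y with W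
  · have hxn : y = none := by
      cases y with
      | none => rfl
      | some p => exact absurd ⟨p, rfl⟩ hxs'
    cases x with
    | none => subst hxn; rfl
    | some q =>
      rw [Iff.comm]
      have e := (H.G.cl _ _ hc).2.2
      exact W y (some q) (by rw [← e]; exact hxx) hy hx (H.G.cls _ _ hc) ⟨q, rfl⟩
  obtain ⟨p', rfl⟩ := hxs
  obtain ⟨q, rfl⟩ := hxs'
  have e := (H.G.cl _ _ hc).2.2
  have e' := (H.G.cl _ _ hc').2.2
  cases x with
  | none =>
    simp only [rep, FO] at *
    have hcs := H.G.cls _ _ hc'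
    cases y' with
    | none =>
      have hn := H.hn.2.2
      have t0 := H.G.l2 _ _ _ _ hc hc' hxx
      have t1 := H.G.l2 _ _ _ _ hc' hc hxx.symm
      have t2 := core_adjM H q hy hc
      have t3 := core_adjM H p' hx' hcs
      have ne1 := H.G.inj p' q (H.hRF p' hx') (H.hRF q hy)
      have ne2 := H.G.inj p' Q (H.hRF p' hx') H.hQ
      have ne3 := H.G.inj q Q (H.hRF q hy) H.hQ
      have := hL.1 q p' hy hx'
      have := hL.1 p' q hx' hy
      have := hL.2.1 q hy
      have := hL.2.2 q hy
      have := hL.2.1 p' hx'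
      have := hL.2.2 p' hx'
      simp only [rep, FO] at *
      clear hL H
      unfold btw at *
      grind
    | some q' =>
      simp only [rep, FO] at *
      have t0 := core_pairM H q p' q' hy hx' hy' hc hc' hxx
      have t1 := core_pairM H q q' p' hy hy' hx' hc hcs (hxx.trans e')
      have := hL.1 q p' hy hx'
      have := hL.1 p' q hx' hy
      have := hL.1 q q' hy hy'
      have := hL.1 q' q hy' hy
      have := hL.2.1 p' hx'
      have := hL.2.2 p' hx'
      have := hL.2.1 q' hy'
      have := hL.2.2 q' hy'
      clear hL H
      unfold btw at *
      grind
  | some p =>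
    simp only [rep, FO] at *
    have hcs := H.G.cls _ _ hc'
    have hds := H.G.cls _ _ hc
    cases y' with
    | none =>
      simp only [rep, FO] at *
      have t0 := core_pairM H p' p q hx' hx hy hcs hc (e'.symm.trans hxx.symm)
      have t1 := core_pairM H p' q p hx' hy hx hcs hds (e'.symm.trans (hxx.symm.trans e))
      have := hL.1 q p' hy hx'
      have := hL.1 p' q hx' hy
      have := hL.1 p p' hx hx'
      have := hL.1 p' p hx' hx
      have := hL.2.1 p hx
      have := hL.2.2 p hx
      have := hL.2.1 q hy
      have := hL.2.2 q hy
      have := hL.2.1 p' hx'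
      have := hL.2.2 p' hx'
      clear hL H
      unfold btw at *
      grind
    | some q' =>
      simp only [rep, FO] at *
      have t0 := core_pairL H p q p' q' hx hy hx' hy' hc hc'
      have t1 := core_pairL H p q q' p' hx hy hy' hx' hc hcs
      have t2 := core_pairL H q p p' q' hy hx hx' hy' hds hc'
      have t3 := core_pairL H q p q' p' hy hx hy' hx' hds hcs
      have s0 := core_pairL H p' q' p q hx' hy' hx hy hc' hc
      have s1 := core_pairL H q' p' p q hy' hx' hx hy hcs hc
      have s2 := core_pairL H p' q' q p hx' hy' hy hx hc' hds
      have s3 := core_pairL H q' p' q p hy' hx' hy hx hcs hds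
      have r0 := H.G.l2 _ _ _ _ hc hc' hxx
      have := hL.1 q p' hy hx'
      have := hL.1 p' q hx' hy
      have := hL.1 p p' hx hx'
      have := hL.1 p' p hx' hx
      have := hL.1 q q' hy hy'
      have := hL.1 q' q hy' hy
      have := hL.1 p q' hx hy'
      have := hL.1 q' p hy' hx
      clear hL H
      unfold btw at *
      by_cases u1 : up p <;> by_cases u2 : up q <;> by_cases u3 : up p' <;> by_cases u4 : up q' <;>
        simp only [u1, u2, u3, u4, true_and, false_and, not_true_eq_false, not_false_eq_true,
          or_false, false_or, true_implies, false_implies, or_true, forall_const, and_true, and_self, IsEmpty.forall_iff] at * <;> grind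

theorem core_geo (H : CoreH F CL CR lo hi L R P Z Q up) {L' : Option E → ℝ}
    (hL : LSpec R L up L') :
    Geo (FO R) (CO R CL Q) (CO R CR P) (fun x => lo (rep P x)) (fun x => hi (rep Q x)) L' where
  pos := by
    have pZ := H.G.pos Z H.hZ
    have := H.h3
    have := H.h4
    rintro (_ | e) he
    · simp only [rep]; linarith
    · exact H.G.pos e (H.hRF e he)
  inj := by
    have key : ∀ e f, R e → R f → L' (some e) = L' (some f) → e = f := by
      intro e f he hf h
      apply H.G.inj e f (H.hRF e he) (H.hRF f hf)
      have := hL.1 e f he hf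
      have := hL.1 f e hf he
      grind
    rintro (_ | e) (_ | f) he hf h
    · rfl
    · have := hL.2.1 f hf
      have := hL.2.2 f hf
      grind
    · have := hL.2.1 e he
      have := hL.2.2 e he
      grind
    · rw [key e f he hf h]
  cls p q h := ⟨h.2.1, h.1, H.G.cls _ _ h.2.2⟩
  crs p q h := ⟨h.2.1, h.1, H.G.crs _ _ h.2.2⟩
  cl p q h := ⟨h.1, h.2.1, (H.G.cl _ _ h.2.2).2.2⟩
  cr p q h := ⟨h.1, h.2.1, (H.G.cr _ _ h.2.2).2.2⟩
  l1 p q g h hg h1 h2 := coreL1 H hL p q g h hg h1 h2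
  l2 p q p' q' h h' e := coreL2 H hL p q p' q' h h' e
  r1 p q g h hg h1 h2 := by
    have := coreL1 H.rot hL.rot p q g h hg (neg_lt_neg h2) (neg_lt_neg h1)
    rwa [btw_neg] at this
  r2 p q p' q' h h' e := by
    have := coreL2 H.rot hL.rot p q p' q' h h' (neg_inj.2 e)
    rwa [btw_neg, btw_neg] at this

/-- order is preserved along creases -/
theorem core_ordL (H : CoreH F CL CR lo hi L R P Z Q up) {L' : Option E → ℝ}
    (hL : LSpec R L up L') (x y : Option E) (h : CO R CL Q x y) :
    L' x < L' y ↔ L (rep Q x) < L (rep Q y) := by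
  obtain ⟨hx, hy, hc⟩ := h
  have hn := H.hn.2.2
  rcases x with _ | p <;> rcases y with _ | q <;> simp only [rep, FO] at *
  · simp
  · rw [hL.2.1 q hy, core_adjM H q hy hc]
  · rw [hL.2.2 p hx, core_adjM H p hx (H.G.cls _ _ hc)]
    have := H.G.inj p Q (H.hRF p hx) H.hQ
    grind
  · have := hL.1 p q hx hy
    have := core_adjL H p q hx hy hc
    have := core_adjL H q p hy hx (H.G.cls _ _ hc)
    grind

theorem core_ordR (H : CoreH F CL CR lo hi L R P Z Q up) {L' : Option E → ℝ}
    (hL : LSpec R L up L') (x y : Option E) (h : CO R CR P x y) :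
    L' x < L' y ↔ L (rep P x) < L (rep P y) := by
  have h' : CO R CR P y x := ⟨h.2.1, h.1, H.G.crs _ _ h.2.2⟩
  have := core_ordL H.rot hL.rot y x h'
  simpa using this

theorem core_exists (G : Geo F CL CR lo hi L) (hRF : ∀ g, R g → F g) (hfin : Set.Finite {g | R g})
    (hP : F P) (hZ : F Z) (hQ : F Q) (hPZ : CL P Z) (hZQ : CR Z Q) (h1 : L P < L Z)
    (h2 : L Z < L Q) (h3 : lo P ≤ lo Z) (h4 : hi Z ≤ hi Q) (hn : ¬ R P ∧ ¬ R Z ∧ ¬ R Q) :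
    ∃ up : E → Prop, CoreH F CL CR lo hi L R P Z Q up ∧ ∃ L' : Option E → ℝ, LSpec R L up L' := by
  classical
  let up : E → Prop := fun g => L Q < L g ∨ (L P < L g ∧ L g < L Z ∧ hi g ≤ hi Z) ∨
      (L Z < L g ∧ L g < L Q ∧ hi g ≤ lo Z)
  refine ⟨up, ⟨G, ⟨fun g _ h => h, fun g hg hu => ?_⟩, hRF, hP, hZ, hQ, hPZ, hZQ, h1, h2, h3, h4,
    hn⟩, ?_⟩
  · have b4 := G.l1 P Z g hPZ (hRF g hg)
    have b5 := G.r1 Z Q g hZQ (hRF g hg)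
    have n1 := G.inj g P (hRF g hg) hP
    have n2 := G.inj g Z (hRF g hg) hZ
    have n3 := G.inj g Q (hRF g hg) hQ
    have e := (G.cl _ _ hPZ).2.2
    simp only [up] at hu
    unfold btw at *
    have m1 : L g ≠ L P := fun h => hn.1 (n1 h ▸ hg)
    have m2 : L g ≠ L Z := fun h => hn.2.1 (n2 h ▸ hg)
    have m3 : L g ≠ L Q := fun h => hn.2.2 (n3 h ▸ hg)
    push Not at hu
    rcases lt_or_gt_of_ne m1 with k1 | k1
    · exact Or.inl k1
    · right
      rcases lt_or_gt_of_ne m2 with k2 | k2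
      · left
        have := hu.2.1 k1 k2
        refine ⟨k1, k2, ?_⟩
        by_contra hlt
        exact b4 (by linarith) (by linarith) (Or.inl ⟨k1, k2⟩)
      · right
        have k3 : L g < L Q := lt_of_le_of_ne hu.1 m3
        have := hu.2.2 k2 k3
        refine ⟨k2, k3, ?_⟩
        by_contra hlt
        exact b5 (by linarith) (by linarith) (Or.inl ⟨k2, k3⟩)
  · obtain ⟨K, hK⟩ : ∃ K, ∀ g, R g → |L g - L Z| < K := by
      obtain ⟨K, hK⟩ := (hfin.image (fun g => |L g - L Z|)).bddAbove
      exact ⟨K + 1, fun g hg => by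
        have := hK (Set.mem_image_of_mem (fun g => |L g - L Z|) hg)
        linarith⟩
    clear_value up
    refine ⟨fun x => match x with
      | none => L Z
      | some g => if up g then L g + K else L g - K, ?_, ?_, ?_⟩
    · intro p q hp hq
      have := abs_lt.1 (hK p hp)
      have := abs_lt.1 (hK q hq)
      simp only
      grind
    · intro p hp
      have := abs_lt.1 (hK p hp)
      simp only
      grind
    · intro p hp
      have := abs_lt.1 (hK p hp)
      simp only
      grind
end core
end FC

set_option linter.unusedVariables false
set_option linter.unusedSimpArgs false
namespace FC

structure Edge where
  a : ℝ
  b : ℝ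
  L : ℝ
  m : Bool

noncomputable def Edge.lo (e : Edge) : ℝ := min e.a e.b
noncomputable def Edge.hi (e : Edge) : ℝ := max e.a e.b

def cyc {α : Type} (l : List α) : List (α × α) := l.zip (l.rotate 1)

def CLof (l : List Edge) (p q : Edge) : Prop :=
  ((p, q) ∈ cyc l ∧ p.a < p.b) ∨ ((q, p) ∈ cyc l ∧ q.a < q.b)
def CRof (l : List Edge) (p q : Edge) : Prop :=
  ((p, q) ∈ cyc l ∧ p.b < p.a) ∨ ((q, p) ∈ cyc l ∧ q.b < q.a)

def Chn (l : List Edge) : Prop :=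
  ∀ c ∈ cyc l, c.1.b = c.2.a ∧
    ((c.1.a < c.1.b ∧ c.2.b < c.2.a) ∨ (c.1.b < c.1.a ∧ c.2.a < c.2.b))

abbrev GeoL (l : List Edge) : Prop :=
  Geo (fun e => e ∈ l) (CLof l) (CRof l) Edge.lo Edge.hi Edge.L

open Classical in
/-- indicator mod 2 -/
noncomputable def ind (p : Prop) : ZMod 2 := if p then 1 else 0

/-- number (mod 2) of edges above `f` just left of its right end -/
noncomputable def NH (l : List Edge) (f : Edge) : ZMod 2 :=
  (l.map fun g => ind (f.L < g.L ∧ g.lo < f.hi ∧ f.hi ≤ g.hi)).sum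

noncomputable def NL (l : List Edge) (f : Edge) : ZMod 2 :=
  (l.map fun g => ind (f.L < g.L ∧ g.lo ≤ f.lo ∧ f.lo < g.hi)).sum

noncomputable def Jv (l : List Edge) (f : Edge) : ZMod 2 := NH l f + ind (f.a < f.b)

def MVok (l : List Edge) : Prop :=
  ∀ c ∈ cyc l, (c.2.m = true ↔ ¬ (c.1.a < c.1.b ↔ c.1.L < c.2.L))

def Good (ε : ZMod 2) (l : List Edge) : Prop :=
  l.Nodup ∧ Chn l ∧ GeoL l ∧ MVok l ∧ ∃ p ∈ l, Jv l p = ε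

theorem cyc_rotate {α : Type} (l : List α) (k : ℕ) : cyc (l.rotate k) = (cyc l).rotate k := by
  unfold cyc
  rw [List.rotate_rotate, Nat.add_comm k 1, ← List.rotate_rotate]
  exact (List.zipWith_rotate_distrib Prod.mk l (l.rotate 1) k (by simp)).symm

theorem mem_cyc_rotate {α : Type} (l : List α) (k : ℕ) (c : α × α) :
    c ∈ cyc (l.rotate k) ↔ c ∈ cyc l := by
  rw [cyc_rotate, List.mem_rotate]

theorem cyc_map {α β : Type} (l : List α) (f : α → β) :
    cyc (l.map f) = (cyc l).map (Prod.map f f) := by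
  unfold cyc
  rw [← List.map_rotate, List.zip_map]

theorem cyc_fst {α : Type} (l : List α) : (cyc l).map Prod.fst = l := by
  unfold cyc; rw [List.map_fst_zip]; simp

theorem cyc_snd {α : Type} (l : List α) : (cyc l).map Prod.snd = l.rotate 1 := by
  unfold cyc; rw [List.map_snd_zip]; simp

theorem cyc_mem {α : Type} {l : List α} {c : α × α} (h : c ∈ cyc l) : c.1 ∈ l ∧ c.2 ∈ l := by
  constructor
  · rw [← cyc_fst l]; exact List.mem_map_of_mem h
  · rw [← List.mem_rotate (n := 1), ← cyc_snd l]; exact List.mem_map_of_mem h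

theorem exists_succ {α : Type} {l : List α} {f : α} (h : f ∈ l) : ∃ g, (f, g) ∈ cyc l := by
  rw [← cyc_fst l] at h
  obtain ⟨c, hc, rfl⟩ := List.mem_map.1 h
  exact ⟨c.2, hc⟩

theorem exists_pred {α : Type} {l : List α} {f : α} (h : f ∈ l) : ∃ g, (g, f) ∈ cyc l := by
  rw [← List.mem_rotate (n := 1), ← cyc_snd l] at h
  obtain ⟨c, hc, rfl⟩ := List.mem_map.1 h
  exact ⟨c.1, hc⟩

theorem succ_unique {α : Type} {l : List α} (hn : l.Nodup) {f g g' : α} (h : (f, g) ∈ cyc l)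
    (h' : (f, g') ∈ cyc l) : g = g' := by
  have := List.inj_on_of_nodup_map (f := Prod.fst) (l := cyc l) (by rwa [cyc_fst]) h h' rfl
  exact congrArg Prod.snd this

theorem pred_unique {α : Type} {l : List α} (hn : l.Nodup) {f g g' : α} (h : (g, f) ∈ cyc l)
    (h' : (g', f) ∈ cyc l) : g = g' := by
  have := List.inj_on_of_nodup_map (f := Prod.snd) (l := cyc l)
    (by rw [cyc_snd]; exact List.nodup_rotate.2 hn) h h' rfl
  exact congrArg Prod.fst this

theorem Chn.pos {l : List Edge} (h : Chn l) {f : Edge} (hf : f ∈ l) : f.a < f.b ∨ f.b < f.a := by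
  obtain ⟨g, hg⟩ := exists_succ hf
  rcases (h _ hg).2 with h | h
  · exact Or.inl h.1
  · exact Or.inr h.1

theorem match_sum {α : Type} {l : List α} (hn : l.Nodup) (C : α → α → Prop)
    (hex : ∀ p ∈ l, ∃ q ∈ l, C p q ∧ C q p ∧ p ≠ q)
    (hun : ∀ p q q', C p q → C p q' → q = q') (u : α → Prop)
    (hu : ∀ p ∈ l, ∀ q ∈ l, C p q → (u p ↔ u q)) :
    (l.map fun g => ind (u g)).sum = 0 := by
  classical
  rw [← List.sum_toFinset _ hn]
  choose! π h1 h2 h3 h4 using hex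
  refine Finset.sum_involution (fun g _ => π g) ?_ ?_ ?_ ?_
  · intro p hp
    rw [List.mem_toFinset] at hp
    have := hu p hp _ (h1 p hp) (h2 p hp)
    simp only [ind, this]
    exact CharTwo.add_self_eq_zero _
  · intro p hp _ h
    rw [List.mem_toFinset] at hp
    exact h4 p hp h.symm
  · intro p hp
    rw [List.mem_toFinset] at hp ⊢
    exact h1 p hp
  · intro p hp
    rw [List.mem_toFinset] at hp
    exact hun _ _ _ (h2 _ (h1 p hp)) (h3 p hp)

theorem CL_match {l : List Edge} (hn : l.Nodup) (hC : Chn l) (u : Edge → Prop)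
    (hu : ∀ p ∈ l, ∀ q ∈ l, CLof l p q → (u p ↔ u q)) :
    (l.map fun g => ind (u g)).sum = 0 := by
  refine match_sum hn (CLof l) ?_ ?_ u hu
  · intro p hp
    rcases hC.pos hp with h | h
    · obtain ⟨q, hq⟩ := exists_succ hp
      refine ⟨q, (cyc_mem hq).2, Or.inl ⟨hq, h⟩, Or.inr ⟨hq, h⟩, ?_⟩
      rintro rfl
      have := (hC _ hq).2
      simp only at this; grind
    · obtain ⟨q, hq⟩ := exists_pred hp
      have := (hC _ hq).2
      simp only at this
      have h' : q.a < q.b := by grind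
      refine ⟨q, (cyc_mem hq).1, Or.inr ⟨hq, h'⟩, Or.inl ⟨hq, h'⟩, ?_⟩
      rintro rfl
      grind
  · rintro p q q' (⟨h1, h2⟩ | ⟨h1, h2⟩) (⟨h3, h4⟩ | ⟨h3, h4⟩)
    · exact succ_unique hn h1 h3
    · have := (hC _ h3).2; simp only at this; grind
    · have := (hC _ h1).2; simp only at this; grind
    · exact pred_unique hn h1 h3

theorem CR_match {l : List Edge} (hn : l.Nodup) (hC : Chn l) (u : Edge → Prop)
    (hu : ∀ p ∈ l, ∀ q ∈ l, CRof l p q → (u p ↔ u q)) :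
    (l.map fun g => ind (u g)).sum = 0 := by
  refine match_sum hn (CRof l) ?_ ?_ u hu
  · intro p hp
    rcases hC.pos hp with h | h
    · obtain ⟨q, hq⟩ := exists_pred hp
      have := (hC _ hq).2
      simp only at this
      have h' : q.b < q.a := by grind
      refine ⟨q, (cyc_mem hq).1, Or.inr ⟨hq, h'⟩, Or.inl ⟨hq, h'⟩, ?_⟩
      rintro rfl
      grind
    · obtain ⟨q, hq⟩ := exists_succ hp
      refine ⟨q, (cyc_mem hq).2, Or.inl ⟨hq, h⟩, Or.inr ⟨hq, h⟩, ?_⟩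
      rintro rfl
      have := (hC _ hq).2
      simp only at this; grind
  · rintro p q q' (⟨h1, h2⟩ | ⟨h1, h2⟩) (⟨h3, h4⟩ | ⟨h3, h4⟩)
    · exact succ_unique hn h1 h3
    · have := (hC _ h3).2; simp only at this; grind
    · have := (hC _ h1).2; simp only at this; grind
    · exact pred_unique hn h1 h3

theorem ind_add (p q : Prop) : ind p + ind q = ind (¬ (p ↔ q)) := by
  unfold ind
  by_cases p <;> by_cases q <;> simp [*]
  exact CharTwo.add_self_eq_zero _

theorem z2_eq_of_add {x y : ZMod 2} (h : x + y = 0) : x = y := by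
  revert x y; decide

/-- number of edges between the two edges of a crease, covering it, is even -/
theorem between_evenL {l : List Edge} (hn : l.Nodup) (hC : Chn l) (G : GeoL l) {f f' : Edge}
    (hc : CLof l f f') :
    (l.map fun g => ind (btw f.L f'.L g.L ∧ g.lo < f.hi ∧ f.hi ≤ g.hi)).sum = 0 := by
  have := CL_match hn hC (fun g => btw f.L f'.L g.L ∧ g.hi = f.hi) ?_
  · rw [← this]
    congr 1
    apply List.map_congr_left
    intro g hg
    have := G.l1 f f' g hc hg
    have := G.pos g hg
    congr 1
    simp only [eq_iff_iff]
    grind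
  · intro p hp q hq h
    have := G.l2 p q f f' h hc
    have := (G.cl p q h).2.2
    grind

theorem between_evenR {l : List Edge} (hn : l.Nodup) (hC : Chn l) (G : GeoL l) {f f' : Edge}
    (hc : CRof l f f') :
    (l.map fun g => ind (btw f.L f'.L g.L ∧ g.lo ≤ f.lo ∧ f.lo < g.hi)).sum = 0 := by
  have := CR_match hn hC (fun g => btw f.L f'.L g.L ∧ g.lo = f.lo) ?_
  · rw [← this]
    congr 1
    apply List.map_congr_left
    intro g hg
    have := G.r1 f f' g hc hg
    have := G.pos g hg
    congr 1
    simp only [eq_iff_iff]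
    grind
  · intro p hp q hq h
    have := G.r2 p q f f' h hc
    have := (G.cr p q h).2.2
    grind

theorem NH_eq_NL {l : List Edge} (hn : l.Nodup) (hC : Chn l) (G : GeoL l) {f : Edge}
    (hf : f ∈ l) : NH l f = NL l f := by
  apply z2_eq_of_add
  have h1 := CL_match hn hC (fun g => f.L < g.L ∧ f.lo < g.hi ∧ g.hi < f.hi) (by
    intro p hp q hq h
    have := G.l1 p q f h hf
    have := (G.cl p q h).2.2
    have := G.inj p f hp hf
    have := G.inj q f hq hf
    unfold btw at *
    grind)
  have h2 := CR_match hn hC (fun g => f.L < g.L ∧ f.lo < g.lo ∧ g.lo < f.hi) (by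
    intro p hp q hq h
    have := G.r1 p q f h hf
    have := (G.cr p q h).2.2
    have := G.inj p f hp hf
    have := G.inj q f hq hf
    unfold btw at *
    grind)
  have h3 : (0 : ZMod 2) = 0 + 0 := by simp
  rw [h3]
  nth_rewrite 1 [← h1]
  rw [← h2]
  unfold NH NL
  rw [← List.sum_map_add, ← List.sum_map_add]
  congr 1
  apply List.map_congr_left
  intro g hg
  have := G.pos g hg
  have := G.pos f hf
  rw [ind_add, ind_add]
  congr 1
  simp only [eq_iff_iff]
  grind

/-- total cover is even -/
theorem cover_even {l : List Edge} (hn : l.Nodup) (hC : Chn l) (G : GeoL l) (c : ℝ) :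
    (l.map fun g => ind (g.lo < c ∧ c ≤ g.hi)).sum = 0 := by
  have h1 := CL_match hn hC (fun g => g.hi < c) (by
    intro p hp q hq h
    rw [(G.cl p q h).2.2])
  have h2 := CR_match hn hC (fun g => g.lo < c) (by
    intro p hp q hq h
    rw [(G.cr p q h).2.2])
  have h3 : (0 : ZMod 2) = 0 + 0 := by simp
  rw [h3]
  nth_rewrite 1 [← h1]
  rw [← h2, ← List.sum_map_add]
  congr 1
  apply List.map_congr_left
  intro g hg
  have := G.pos g hg
  rw [ind_add]
  congr 1
  simp only [eq_iff_iff]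
  grind

theorem ind_single {l : List Edge} (hn : l.Nodup) {f : Edge} (hf : f ∈ l) :
    (l.map fun g => ind (g = f)).sum = 1 := by
  classical
  rw [← List.sum_toFinset _ hn, Finset.sum_eq_single f]
  · simp [ind]
  · intro b _ h; simp [ind, h]
  · intro h; simp [hf] at h

theorem NH_step {l : List Edge} (hn : l.Nodup) (hC : Chn l) (G : GeoL l) {p q : Edge}
    (hc : CLof l p q) (hne : p ≠ q) : NH l p = NH l q + 1 := by
  wlog hlt : p.L < q.L with W
  · have hcl := G.cl p q hc
    have := G.inj p q hcl.1 hcl.2.1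
    rw [W hn hC G (G.cls _ _ hc) (Ne.symm hne) (by grind)]
    rw [add_assoc]
    have : (1 + 1 : ZMod 2) = 0 := by decide
    rw [this, add_zero]
  have hcl := G.cl p q hc
  have hb := between_evenL hn hC G hc
  rw [← ind_single hn hcl.2.1]
  unfold NH
  rw [← add_zero (_ + _), ← hb, ← List.sum_map_add, ← List.sum_map_add]
  congr 1
  apply List.map_congr_left
  intro g hg
  rw [ind_add, ind_add]
  have := G.inj g q hg hcl.2.1
  have := G.pos q hcl.2.1
  congr 1
  simp only [eq_iff_iff]
  unfold btw
  grind

theorem NL_step {l : List Edge} (hn : l.Nodup) (hC : Chn l) (G : GeoL l) {p q : Edge}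
    (hc : CRof l p q) (hne : p ≠ q) : NL l p = NL l q + 1 := by
  wlog hlt : p.L < q.L with W
  · have hcl := G.cr p q hc
    have := G.inj p q hcl.1 hcl.2.1
    rw [W hn hC G (G.crs _ _ hc) (Ne.symm hne) (by grind)]
    rw [add_assoc]
    have : (1 + 1 : ZMod 2) = 0 := by decide
    rw [this, add_zero]
  have hcl := G.cr p q hc
  have hb := between_evenR hn hC G hc
  rw [← ind_single hn hcl.2.1]
  unfold NL
  rw [← add_zero (_ + _), ← hb, ← List.sum_map_add, ← List.sum_map_add]
  congr 1
  apply List.map_congr_left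
  intro g hg
  rw [ind_add, ind_add]
  have := G.inj g q hg hcl.2.1
  have := G.pos q hcl.2.1
  congr 1
  simp only [eq_iff_iff]
  unfold btw
  grind

theorem Jv_step {l : List Edge} (hn : l.Nodup) (hC : Chn l) (G : GeoL l) {p q : Edge}
    (hc : (p, q) ∈ cyc l) : Jv l p = Jv l q := by
  have h := hC _ hc
  simp only at h
  have hne : p ≠ q := by rintro rfl; grind
  unfold Jv
  rcases h.2 with ⟨h1, h2⟩ | ⟨h1, h2⟩
  · rw [NH_step hn hC G (Or.inl ⟨hc, h1⟩) hne, ind, ind, if_pos h1, if_neg (by linarith), add_assoc]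
    congr 1
  · rw [NH_eq_NL hn hC G (cyc_mem hc).1, NH_eq_NL hn hC G (cyc_mem hc).2,
      NL_step hn hC G (Or.inl ⟨hc, h1⟩) hne, ind, ind, if_pos h2, if_neg (by linarith), add_zero]

theorem cyc_const {α β : Type} (l : List α) (f : α → β) (h : ∀ c ∈ cyc l, f c.1 = f c.2) :
    ∀ x ∈ l, ∀ y ∈ l, f x = f y := by
  cases l with
  | nil => simp
  | cons a t =>
    have key : ∀ (t : List α) (a z : α), (∀ c ∈ (a :: t).zip (t ++ [z]), f c.1 = f c.2) →
        ∀ x ∈ a :: t, f x = f a := by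
      intro t
      induction t with
      | nil => simp
      | cons b t ih =>
        intro a z h x hx
        simp only [List.cons_append, List.zip_cons_cons, List.forall_mem_cons] at h
        rcases List.mem_cons.1 hx with rfl | hx
        · rfl
        · rw [ih b z h.2 x hx, h.1]
    have := key t a a (by simpa [cyc] using h)
    intro x hx y hy
    rw [this x hx, this y hy]

theorem Jv_const {l : List Edge} (hn : l.Nodup) (hC : Chn l) (G : GeoL l) {p q : Edge}
    (hp : p ∈ l) (hq : q ∈ l) : Jv l p = Jv l q :=
  cyc_const l (Jv l) (fun c hc => Jv_step hn hC G (p := c.1) (q := c.2) hc) p hp q hq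

theorem Good.J {ε : ZMod 2} {l : List Edge} (h : Good ε l) {p : Edge} (hp : p ∈ l) :
    Jv l p = ε := by
  obtain ⟨hn, hC, G, _, q, hq, e⟩ := h
  rw [← e]; exact Jv_const hn hC G hp hq

end FC

set_option linter.unusedVariables false
set_option linter.unusedSimpArgs false
namespace FC

theorem mem_cyc_map {α β : Type} {l : List α} {f : α → β} {c : β × β} :
    c ∈ cyc (l.map f) ↔ ∃ x y, (x, y) ∈ cyc l ∧ c = (f x, f y) := by
  rw [cyc_map, List.mem_map]
  constructor
  · rintro ⟨⟨x, y⟩, h, rfl⟩; exact ⟨x, y, h, rfl⟩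
  · rintro ⟨x, y, h, rfl⟩; exact ⟨(x, y), h, rfl⟩

theorem geo_map {E : Type} {F : E → Prop} {CL CR : E → E → Prop} {lo hi L : E → ℝ}
    (G : Geo F CL CR lo hi L) (t : List E) (φ : E → Edge) (hF : ∀ x ∈ t, F x)
    (hlo : ∀ x ∈ t, (φ x).lo = lo x) (hhi : ∀ x ∈ t, (φ x).hi = hi x)
    (hL : ∀ x ∈ t, (φ x).L = L x)
    (h1 : ∀ x y, (x, y) ∈ cyc t → (φ x).a < (φ x).b → CL x y)
    (h2 : ∀ x y, (x, y) ∈ cyc t → (φ x).b < (φ x).a → CR x y) :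
    GeoL (t.map φ) := by
  have kL : ∀ p q, CLof (t.map φ) p q → ∃ x y, x ∈ t ∧ y ∈ t ∧ p = φ x ∧ q = φ y ∧ CL x y := by
    rintro p q (⟨h, h'⟩ | ⟨h, h'⟩)
    · obtain ⟨x, y, hxy, e⟩ := mem_cyc_map.1 h
      simp only [Prod.mk.injEq] at e
      obtain ⟨rfl, rfl⟩ := e
      exact ⟨x, y, (cyc_mem hxy).1, (cyc_mem hxy).2, rfl, rfl, h1 _ _ hxy h'⟩
    · obtain ⟨x, y, hxy, e⟩ := mem_cyc_map.1 h
      simp only [Prod.mk.injEq] at e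
      obtain ⟨rfl, rfl⟩ := e
      exact ⟨y, x, (cyc_mem hxy).2, (cyc_mem hxy).1, rfl, rfl, G.cls _ _ (h1 _ _ hxy h')⟩
  have kR : ∀ p q, CRof (t.map φ) p q → ∃ x y, x ∈ t ∧ y ∈ t ∧ p = φ x ∧ q = φ y ∧ CR x y := by
    rintro p q (⟨h, h'⟩ | ⟨h, h'⟩)
    · obtain ⟨x, y, hxy, e⟩ := mem_cyc_map.1 h
      simp only [Prod.mk.injEq] at e
      obtain ⟨rfl, rfl⟩ := e
      exact ⟨x, y, (cyc_mem hxy).1, (cyc_mem hxy).2, rfl, rfl, h2 _ _ hxy h'⟩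
    · obtain ⟨x, y, hxy, e⟩ := mem_cyc_map.1 h
      simp only [Prod.mk.injEq] at e
      obtain ⟨rfl, rfl⟩ := e
      exact ⟨y, x, (cyc_mem hxy).2, (cyc_mem hxy).1, rfl, rfl, G.crs _ _ (h2 _ _ hxy h')⟩
  constructor
  · intro e he
    obtain ⟨x, hx, rfl⟩ := List.mem_map.1 he
    rw [hlo x hx, hhi x hx]; exact G.pos x (hF x hx)
  · intro e f he hf hh
    obtain ⟨x, hx, rfl⟩ := List.mem_map.1 he
    obtain ⟨y, hy, rfl⟩ := List.mem_map.1 hf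
    rw [hL x hx, hL y hy] at hh
    rw [G.inj x y (hF x hx) (hF y hy) hh]
  · rintro p q h; unfold CLof at *; tauto
  · rintro p q h; unfold CRof at *; tauto
  · intro p q h
    obtain ⟨x, y, hx, hy, rfl, rfl, hc⟩ := kL p q h
    refine ⟨List.mem_map_of_mem hx, List.mem_map_of_mem hy, ?_⟩
    rw [hhi x hx, hhi y hy]; exact (G.cl _ _ hc).2.2
  · intro p q h
    obtain ⟨x, y, hx, hy, rfl, rfl, hc⟩ := kR p q h
    refine ⟨List.mem_map_of_mem hx, List.mem_map_of_mem hy, ?_⟩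
    rw [hlo x hx, hlo y hy]; exact (G.cr _ _ hc).2.2
  · intro p q g h hg
    obtain ⟨x, y, hx, hy, rfl, rfl, hc⟩ := kL p q h
    obtain ⟨z, hz, rfl⟩ := List.mem_map.1 hg
    rw [hhi x hx, hhi z hz, hlo z hz, hL x hx, hL y hy, hL z hz]
    exact G.l1 x y z hc (hF z hz)
  · intro p q g h hg
    obtain ⟨x, y, hx, hy, rfl, rfl, hc⟩ := kR p q h
    obtain ⟨z, hz, rfl⟩ := List.mem_map.1 hg
    rw [hlo x hx, hhi z hz, hlo z hz, hL x hx, hL y hy, hL z hz]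
    exact G.r1 x y z hc (hF z hz)
  · intro p q p' q' h h'
    obtain ⟨x, y, hx, hy, rfl, rfl, hc⟩ := kL p q h
    obtain ⟨x', y', hx', hy', rfl, rfl, hc'⟩ := kL p' q' h'
    rw [hhi x hx, hhi x' hx', hL x hx, hL y hy, hL x' hx', hL y' hy']
    exact G.l2 x y x' y' hc hc'
  · intro p q p' q' h h'
    obtain ⟨x, y, hx, hy, rfl, rfl, hc⟩ := kR p q h
    obtain ⟨x', y', hx', hy', rfl, rfl, hc'⟩ := kR p' q' h'
    rw [hlo x hx, hlo x' hx', hL x hx, hL y hy, hL x' hx', hL y' hy']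
    exact G.r2 x y x' y' hc hc'

theorem Good.rotate {ε : ZMod 2} {l : List Edge} (h : Good ε l) (k : ℕ) : Good ε (l.rotate k) := by
  obtain ⟨hn, hC, G, hM, p, hp, e⟩ := h
  have hm : ∀ c, c ∈ cyc (l.rotate k) ↔ c ∈ cyc l := mem_cyc_rotate l k
  refine ⟨List.nodup_rotate.2 hn, fun c hc => hC c ((hm c).1 hc), ?_,
    fun c hc => hM c ((hm c).1 hc), p, List.mem_rotate.2 hp, ?_⟩
  · have e1 : CLof (l.rotate k) = CLof l := by
      funext p q; unfold CLof; rw [hm, hm]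
    have e2 : CRof (l.rotate k) = CRof l := by
      funext p q; unfold CRof; rw [hm, hm]
    have e3 : (fun e => e ∈ l.rotate k) = (fun e => e ∈ l) := by
      funext e; rw [List.mem_rotate]
    unfold GeoL
    rw [e1, e2, e3]; exact G
  · rw [← e]
    unfold Jv NH
    congr 1
    apply List.Perm.sum_eq
    exact (List.rotate_perm l k).map _

def Edge.refl (e : Edge) : Edge := ⟨-e.a, -e.b, e.L, !e.m⟩
def Edge.rot (e : Edge) : Edge := ⟨-e.a, -e.b, -e.L, e.m⟩

theorem Edge.refl_inj : Function.Injective Edge.refl := by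
  rintro ⟨a, b, L, m⟩ ⟨a', b', L', m'⟩ h
  simpa [Edge.refl] using h
theorem Edge.rot_inj : Function.Injective Edge.rot := by
  rintro ⟨a, b, L, m⟩ ⟨a', b', L', m'⟩ h
  simpa [Edge.rot] using h

theorem refl_lo (e : Edge) : e.refl.lo = -e.hi := by
  simp only [Edge.refl, Edge.lo, Edge.hi]; exact min_neg_neg _ _
theorem refl_hi (e : Edge) : e.refl.hi = -e.lo := by
  simp only [Edge.refl, Edge.lo, Edge.hi]; exact max_neg_neg _ _
theorem rot_lo (e : Edge) : e.rot.lo = -e.hi := by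
  simp only [Edge.rot, Edge.lo, Edge.hi]; exact min_neg_neg _ _
theorem rot_hi (e : Edge) : e.rot.hi = -e.lo := by
  simp only [Edge.rot, Edge.lo, Edge.hi]; exact max_neg_neg _ _

theorem cover_evenR {l : List Edge} (hn : l.Nodup) (hC : Chn l) (G : GeoL l) (c : ℝ) :
    (l.map fun g => ind (g.lo ≤ c ∧ c < g.hi)).sum = 0 := by
  have h1 := CL_match hn hC (fun g => g.hi ≤ c) (by
    intro p hp q hq h
    rw [(G.cl p q h).2.2])
  have h2 := CR_match hn hC (fun g => g.lo ≤ c) (by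
    intro p hp q hq h
    rw [(G.cr p q h).2.2])
  have h3 : (0 : ZMod 2) = 0 + 0 := by simp
  rw [h3]
  nth_rewrite 1 [← h1]
  rw [← h2, ← List.sum_map_add]
  congr 1
  apply List.map_congr_left
  intro g hg
  have := G.pos g hg
  rw [ind_add]
  congr 1
  simp only [eq_iff_iff]
  grind

theorem Good.refl {ε : ZMod 2} {l : List Edge} (h : Good ε l) : Good (ε + 1) (l.map Edge.refl) := by
  obtain ⟨hn, hC, G, hM, p, hp, e⟩ := h
  refine ⟨hn.map Edge.refl_inj, ?_, ?_, ?_, p.refl, List.mem_map_of_mem hp, ?_⟩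
  · intro c hc
    obtain ⟨x, y, hxy, rfl⟩ := mem_cyc_map.1 hc
    have := hC _ hxy
    simp only [Edge.refl] at this ⊢
    grind
  · refine geo_map G.reflect l Edge.refl (fun x hx => hx) (fun x _ => refl_lo x)
      (fun x _ => refl_hi x) (fun x _ => rfl) ?_ ?_
    · intro x y h h'
      exact Or.inl ⟨h, by simpa [Edge.refl] using h'⟩
    · intro x y h h'
      exact Or.inl ⟨h, by simpa [Edge.refl] using h'⟩
  · intro c hc
    obtain ⟨x, y, hxy, rfl⟩ := mem_cyc_map.1 hc
    have h1 := hM _ hxy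
    have := hC _ hxy
    simp only [Edge.refl] at this h1 ⊢
    cases hy : y.m <;> simp [hy] at h1 ⊢ <;> grind
  · rw [← e]
    unfold Jv
    rw [NH_eq_NL hn hC G hp, add_assoc]
    congr 1
    · unfold NH NL
      rw [List.map_map]
      congr 1
      apply List.map_congr_left
      intro g hg
      simp only [Function.comp, refl_lo, refl_hi]
      congr 1
      simp only [Edge.refl, eq_iff_iff, neg_lt_neg_iff, neg_le_neg_iff]
      tauto
    · have := hC.pos hp
      simp only [Edge.refl, neg_lt_neg_iff]
      rcases this with h | h
      · rw [ind, ind, if_neg (by linarith), if_pos h]; rfl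
      · rw [ind, ind, if_pos (by linarith), if_neg (by linarith)]; rfl

theorem Good.rot {ε : ZMod 2} {l : List Edge} (h : Good ε l) : Good ε (l.map Edge.rot) := by
  obtain ⟨hn, hC, G, hM, p, hp, e⟩ := h
  refine ⟨hn.map Edge.rot_inj, ?_, ?_, ?_, p.rot, List.mem_map_of_mem hp, ?_⟩
  · intro c hc
    obtain ⟨x, y, hxy, rfl⟩ := mem_cyc_map.1 hc
    have := hC _ hxy
    simp only [Edge.rot] at this ⊢
    grind
  · refine geo_map G.reflect.flip l Edge.rot (fun x hx => hx) (fun x _ => rot_lo x)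
      (fun x _ => rot_hi x) (fun x _ => rfl) ?_ ?_
    · intro x y h h'
      exact Or.inl ⟨h, by simpa [Edge.rot] using h'⟩
    · intro x y h h'
      exact Or.inl ⟨h, by simpa [Edge.rot] using h'⟩
  · intro c hc
    obtain ⟨x, y, hxy, rfl⟩ := mem_cyc_map.1 hc
    have h1 := hM _ hxy
    have := hC _ hxy
    have i := G.inj _ _ (cyc_mem hxy).1 (cyc_mem hxy).2
    have hne : x ≠ y := by rintro rfl; simp only at this; grind
    simp only [Edge.rot] at this h1 i ⊢
    rw [h1]
    grind
  · rw [← e]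
    unfold Jv
    have key : NH (l.map Edge.rot) p.rot = NL l p + 1 := by
      apply z2_eq_of_add
      rw [← cover_evenR hn hC G p.lo, ← ind_single hn hp]
      unfold NH NL
      rw [List.map_map, ← List.sum_map_add, ← List.sum_map_add]
      congr 1
      apply List.map_congr_left
      intro g hg
      rw [ind_add, Function.comp, ind_add]
      congr 1
      have := G.inj g p hg hp
      have := G.pos p hp
      simp only [rot_lo, rot_hi, eq_iff_iff]
      simp only [Edge.rot, neg_lt_neg_iff, neg_le_neg_iff]
      grind
    rw [key, NH_eq_NL hn hC G hp, add_assoc]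
    congr 1
    have := hC.pos hp
    simp only [Edge.rot, neg_lt_neg_iff]
    rcases this with h | h
    · rw [ind, ind, if_neg (by linarith), if_pos h]; rfl
    · rw [ind, ind, if_pos (by linarith), if_neg (by linarith)]; rfl

end FC

set_option linter.unusedVariables false
set_option linter.unusedSimpArgs false
namespace FC

noncomputable def wd (e : Edge) : ℝ × Bool := (|e.b - e.a|, e.m)

def FF (ε : ZMod 2) (w : List (ℝ × Bool)) : Prop := ∃ l : List Edge, l.map wd = w ∧ Good ε l

theorem FF_rotate {ε : ZMod 2} {w : List (ℝ × Bool)} (h : FF ε w) (k : ℕ) : FF ε (w.rotate k) := by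
  obtain ⟨l, rfl, h⟩ := h
  exact ⟨l.rotate k, by rw [List.map_rotate], h.rotate k⟩

theorem FF_isRotated {ε : ZMod 2} {w w' : List (ℝ × Bool)} (h : w ~r w') : FF ε w ↔ FF ε w' := by
  constructor
  · intro hw; obtain ⟨k, rfl⟩ := h; exact FF_rotate hw k
  · intro hw; obtain ⟨k, rfl⟩ := h.symm; exact FF_rotate hw k

def ng (w : List (ℝ × Bool)) : List (ℝ × Bool) := w.map fun x => (x.1, !x.2)

theorem ng_ng (w : List (ℝ × Bool)) : ng (ng w) = w := by
  simp [ng, Function.comp_def]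

theorem FF_ng' {ε : ZMod 2} {w : List (ℝ × Bool)} (h : FF ε w) : FF (ε + 1) (ng w) := by
  obtain ⟨l, rfl, h⟩ := h
  refine ⟨l.map Edge.refl, ?_, h.refl⟩
  simp only [ng, List.map_map]
  apply List.map_congr_left
  intro e _
  simp only [Function.comp, wd, Edge.refl, Prod.mk.injEq, and_true]
  rw [← abs_neg]; congr 1; ring

theorem FF_ng {ε : ZMod 2} {w : List (ℝ × Bool)} : FF (ε + 1) (ng w) ↔ FF ε w := by
  refine ⟨fun h => ?_, FF_ng'⟩
  have := FF_ng' h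
  rw [ng_ng] at this
  rw [add_assoc] at this
  have h2 : (1 + 1 : ZMod 2) = 0 := by decide
  rwa [h2, add_zero] at this

/-- get a witness whose first edge goes right -/
theorem FF_right {ε : ZMod 2} {x : ℝ × Bool} {w : List (ℝ × Bool)} (h : FF ε (x :: w)) :
    ∃ (e : Edge) (l : List Edge), wd e = x ∧ l.map wd = w ∧ Good ε (e :: l) ∧ e.a < e.b := by
  obtain ⟨l, hl, h⟩ := h
  cases l with
  | nil => simp at hl
  | cons e l =>
    simp only [List.map_cons, List.cons.injEq] at hl
    rcases h.2.1.pos (f := e) (by simp) with h1 | h1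
    · exact ⟨e, l, hl.1, hl.2, h, h1⟩
    · have hw : ∀ e : Edge, wd e.rot = wd e := by
        intro e
        simp only [wd, Edge.rot, Prod.mk.injEq, and_true]
        rw [← abs_neg]; congr 1; ring
      refine ⟨e.rot, l.map Edge.rot, ?_, ?_, ?_, ?_⟩
      · rw [hw]; exact hl.1
      · rw [← hl.2, List.map_map]
        apply List.map_congr_left
        intro e _; exact hw e
      · exact h.rot
      · simp only [Edge.rot]; linarith

theorem cyc_cons {α : Type} (a : α) (t : List α) : cyc (a :: t) = (a :: t).zip (t ++ [a]) := by
  simp [cyc]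

theorem cyc3 {α : Type} (E0 E1 E2 : α) (R : List α) : cyc (E0 :: E1 :: E2 :: R) =
    (E0, E1) :: (E1, E2) ::
      (cyc (none :: R.map some)).map (Prod.map (rep E2) (rep E0)) := by
  rw [cyc_cons, cyc_cons]
  simp only [List.cons_append, List.zip_cons_cons, List.cons.injEq, true_and]
  rw [← List.zip_map]
  congr 1
  · simp [rep, Function.comp_def]
  · simp [rep, Function.comp_def]

theorem crimp_fwd {ε : ZMod 2} {E0 E1 E2 : Edge} {R : List Edge}
    (h : Good ε (E0 :: E1 :: E2 :: R)) (hr : E0.a < E0.b) (hu : E1.m = false) (hv : E2.m = true)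
    (h1 : (wd E1).1 ≤ (wd E0).1) (h2 : (wd E1).1 ≤ (wd E2).1) :
    FF ε (((wd E0).1 - (wd E1).1 + (wd E2).1, E0.m) :: R.map wd) := by
  obtain ⟨hn, hC, G, hM, p0, hp0, ej⟩ := id h
  set l := E0 :: E1 :: E2 :: R with hl
  have c01 : (E0, E1) ∈ cyc l := by rw [hl, cyc3]; simp
  have c12 : (E1, E2) ∈ cyc l := by rw [hl, cyc3]; simp
  have cg : ∀ x y, (x, y) ∈ cyc (none :: R.map some) → (rep E2 x, rep E0 y) ∈ cyc l := by
    intro x y hxy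
    rw [hl, cyc3]
    refine List.mem_cons_of_mem _ (List.mem_cons_of_mem _ ?_)
    exact List.mem_map.2 ⟨(x, y), hxy, rfl⟩
  have k01 := hC _ c01
  have k12 := hC _ c12
  have m01 := hM _ c01
  have m12 := hM _ c12
  simp only [hu, hv] at k01 k12 m01 m12
  have r1 : E1.b < E1.a := by grind
  have r2 : E2.a < E2.b := by grind
  have L01 : E0.L < E1.L := by grind
  have i12 := G.inj E1 E2 (cyc_mem c12).1 (cyc_mem c12).2
  have L12 : E1.L < E2.L := by grind
  simp only [wd] at h1 h2
  rw [abs_of_neg (by linarith : E1.b - E1.a < 0), abs_of_pos (by linarith)] at h1 h2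
  simp only [wd]
  rw [abs_of_neg (by linarith : E1.b - E1.a < 0), abs_of_pos (by linarith : 0 < E0.b - E0.a),
    abs_of_pos (by linarith : 0 < E2.b - E2.a)]
  have lo0 : E0.lo = E0.a := min_eq_left hr.le
  have hi0 : E0.hi = E0.b := max_eq_right hr.le
  have lo1 : E1.lo = E1.b := min_eq_right r1.le
  have hi1 : E1.hi = E1.a := max_eq_left r1.le
  have lo2 : E2.lo = E2.a := min_eq_left r2.le
  have hi2 : E2.hi = E2.b := max_eq_right r2.le
  have nd : E0 ∉ R ∧ E1 ∉ R ∧ E2 ∉ R ∧ R.Nodup := by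
    rw [hl] at hn; simp only [List.nodup_cons, List.mem_cons] at hn; tauto
  have hRl : ∀ g, g ∈ R → g ∈ l := by intro g hg; rw [hl]; simp [hg]
  obtain ⟨up, H, L', hL⟩ := core_exists (R := fun g => g ∈ R) (P := E0) (Z := E1) (Q := E2) G
    hRl (List.finite_toSet R) (cyc_mem c01).1 (cyc_mem c01).2 (cyc_mem c12).2
    (Or.inl ⟨c01, hr⟩) (Or.inl ⟨c12, r1⟩) L01 L12 (by rw [lo0, lo1]; linarith)
    (by rw [hi1, hi2]; linarith) ⟨nd.1, nd.2.1, nd.2.2.1⟩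
  have G' := core_geo H hL
  set t : List (Option Edge) := none :: R.map some with ht
  have hFO : ∀ x ∈ t, FO (fun g => g ∈ R) x := by
    intro x hx
    rw [ht] at hx
    rcases List.mem_cons.1 hx with rfl | hx
    · trivial
    · obtain ⟨g, hg, rfl⟩ := List.mem_map.1 hx; exact hg
  let φ : Option Edge → Edge := fun x => ⟨(rep E0 x).a, (rep E2 x).b, L' x, (rep E0 x).m⟩
  have dir : ∀ x ∈ t, ((φ x).a < (φ x).b ↔ (rep E2 x).a < (rep E2 x).b) ∧
      ((φ x).b < (φ x).a ↔ (rep E2 x).b < (rep E2 x).a) := by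
    intro x hx
    cases x with
    | none => simp only [φ, rep]; constructor <;> constructor <;> intro h <;> linarith
    | some g => simp [φ, rep]
  have cLL : ∀ x y, (x, y) ∈ cyc t → (φ x).a < (φ x).b →
      CO (fun g => g ∈ R) (CLof l) E2 x y ∧ rep E0 y = rep E2 y := by
    intro x y hxy hd
    have hx := cyc_mem hxy
    rw [(dir x hx.1).1] at hd
    have e : rep E0 y = rep E2 y := by
      cases y with
      | none => have := (hC _ (cg _ _ hxy)).2; simp only [rep] at this hd; grind
      | some g => rfl
    refine ⟨⟨hFO _ hx.1, hFO _ hx.2, Or.inl ⟨?_, hd⟩⟩, e⟩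
    rw [← e]; exact cg _ _ hxy
  have cRR : ∀ x y, (x, y) ∈ cyc t → (φ x).b < (φ x).a →
      CO (fun g => g ∈ R) (CRof l) E0 x y ∧ rep E0 x = rep E2 x := by
    intro x y hxy hd
    have hx := cyc_mem hxy
    have hd' := hd
    rw [(dir x hx.1).2] at hd
    have e : rep E0 x = rep E2 x := by
      cases x with
      | none => simp only [rep] at hd; linarith
      | some g => rfl
    refine ⟨⟨hFO _ hx.1, hFO _ hx.2, Or.inl ⟨?_, e ▸ hd⟩⟩, e⟩
    rw [e]; exact cg _ _ hxy
  have hφC : Chn (t.map φ) := by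
    intro c hc
    obtain ⟨x, y, hxy, rfl⟩ := mem_cyc_map.1 hc
    have hx := cyc_mem hxy
    have := hC _ (cg _ _ hxy)
    have d1 := dir x hx.1
    have d2 : ((φ y).a < (φ y).b ↔ (rep E0 y).a < (rep E0 y).b) ∧
      ((φ y).b < (φ y).a ↔ (rep E0 y).b < (rep E0 y).a) := by
      cases y with
      | none => simp only [φ, rep]; constructor <;> constructor <;> intro h <;> linarith
      | some g => simp [φ, rep]
    simp only at this ⊢
    refine ⟨this.1, ?_⟩
    rw [d1.1, d1.2, d2.1, d2.2]; exact this.2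
  have tn : t.Nodup := by
    rw [ht]
    refine List.nodup_cons.2 ⟨by simp, nd.2.2.2.map (Option.some_injective _)⟩
  refine ⟨t.map φ, ?_, ?_, hφC, ?_, ?_, φ none, ?_, ?_⟩
  · rw [ht]
    simp only [List.map_cons, List.map_map, List.cons.injEq]
    constructor
    · simp only [wd, φ, rep, Prod.mk.injEq, and_true]
      rw [abs_of_pos (by linarith)]; linarith
    · rfl
  · refine List.Nodup.map_on ?_ tn
    intro x hx y hy hxy
    exact G'.inj x y (hFO x hx) (hFO y hy) (congrArg Edge.L hxy)
  · refine geo_map G' t φ hFO ?_ ?_ (fun x _ => rfl) (fun x y h h' => (cLL x y h h').1)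
      (fun x y h h' => (cRR x y h h').1)
    · intro x hx
      cases x with
      | none => simp only [φ, rep]; rw [lo0]; exact min_eq_left (by simp only; linarith)
      | some g => rfl
    · intro x hx
      cases x with
      | none => simp only [φ, rep]; rw [hi2]; exact max_eq_right (by simp only; linarith)
      | some g => rfl
  · intro c hc
    have hp := hφC.pos (cyc_mem hc).1
    obtain ⟨x, y, hxy, rfl⟩ := mem_cyc_map.1 hc
    have hx := cyc_mem hxy
    have m := hM _ (cg _ _ hxy)
    simp only at m hp ⊢
    rw [(dir x hx.1).1]
    show (rep E0 y).m = true ↔ ¬ (_ ↔ L' x < L' y)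
    rw [m]
    rcases hp with hp | hp
    · have := cLL x y hxy hp
      rw [core_ordL H hL x y this.1, this.2]
    · have := cRR x y hxy hp
      rw [core_ordR H hL x y this.1, this.2]
  · exact List.mem_map_of_mem (by simp [ht])
  · rw [← h.J (cyc_mem c12).2]
    have hb := between_evenL hn hC G (Or.inl ⟨c01, hr⟩ : CLof l E0 E1)
    unfold Jv
    have e1 : ind ((φ none).a < (φ none).b) = ind (E2.a < E2.b) := by
      rw [ind, ind, if_pos r2, if_pos]; simp only [φ, rep]; linarith
    rw [e1]
    congr 1
    have hh : (φ none).hi = E2.hi := by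
      simp only [φ, rep]; rw [hi2]; exact max_eq_right (by simp only; linarith)
    have hf : ∀ P : Prop, ¬ P → ind P = 0 := fun P h => if_neg h
    have n1 : NH (t.map φ) (φ none) = (R.map fun g => ind (up g ∧ g.lo < E2.hi ∧ E2.hi ≤ g.hi)).sum := by
      unfold NH
      rw [hh, ht]
      simp only [List.map_cons, List.map_map, List.sum_cons]
      rw [hf _ (by simp), zero_add]
      congr 1
      apply List.map_congr_left
      intro g hg
      have : (L' none < L' (some g)) = up g := by rw [eq_iff_iff]; exact hL.2.1 g hg
      simp only [Function.comp]
      show ind (L' none < L' (some g) ∧ g.lo < E2.hi ∧ E2.hi ≤ g.hi) = _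
      rw [this]
    have n2 : NH l E2 = (R.map fun g => ind (E2.L < g.L ∧ g.lo < E2.hi ∧ E2.hi ≤ g.hi)).sum := by
      unfold NH
      rw [hl]
      simp only [List.map_cons, List.sum_cons]
      rw [hf _ (by intro h; linarith [h.1]), hf _ (by intro h; linarith [h.1]), hf _ (by simp)]
      simp
    rw [hl] at hb
    simp only [List.map_cons, List.sum_cons] at hb
    rw [hf (btw E0.L E1.L E0.L ∧ _) (by unfold btw; grind),
      hf (btw E0.L E1.L E1.L ∧ _) (by unfold btw; grind),
      hf (btw E0.L E1.L E2.L ∧ _) (by unfold btw; grind)] at hb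
    simp only [zero_add] at hb
    rw [n1, n2]
    have hiZ : E1.hi = E0.hi := by rw [hi1, hi0]; exact k01.1.symm
    by_cases hcase : E1.hi = E2.hi
    · rw [← add_zero (List.sum (R.map fun g => ind (E2.L < g.L ∧ _))), ← hb, ← List.sum_map_add]
      congr 1
      apply List.map_congr_left
      intro g hg
      rw [ind_add]
      congr 1
      rw [eq_iff_iff]
      have u1 := H.hu.1 g hg
      have u2 := H.hu.2 g hg
      have := G.pos g (hRl g hg)
      have := G.pos E1 (cyc_mem c12).1
      unfold btw
      grind
    · congr 1
      apply List.map_congr_left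
      intro g hg
      congr 1
      rw [eq_iff_iff]
      have u1 := H.hu.1 g hg
      have u2 := H.hu.2 g hg
      have := G.pos g (hRl g hg)
      have := G.pos E1 (cyc_mem c12).1
      have : E1.hi ≤ E2.hi := by rw [hi1, hi2]; linarith
      grind

end FC

set_option linter.unusedVariables false
set_option linter.unusedSimpArgs false
namespace FC

structure SplitH {E E' : Type} (F : E → Prop) (CL : E → E → Prop) (lo hi L : E → ℝ)
    (F' : E' → Prop) (CL' : E' → E' → Prop) (lo' hi' L' : E' → ℝ) (back : E' → E) (P Z Q : E')
    (M : E) : Prop where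
  l1 : ∀ p q g, CL p q → F g → lo g < hi p → hi p < hi g → ¬ btw (L p) (L q) (L g)
  l2 : ∀ p q p' q', CL p q → CL p' q' → hi p = hi p' →
    (btw (L p') (L q') (L p) ↔ btw (L p') (L q') (L q))
  F'P : F' P
  F'Z : F' Z
  F'Q : F' Q
  hF : ∀ e, F' e → F (back e)
  hT : ∀ e, F' e → (back e = M ↔ e = P ∨ e = Z ∨ e = Q)
  lo1 : ∀ e, F' e → lo (back e) ≤ lo' e
  hi1 : ∀ e, F' e → hi' e ≤ hi (back e)
  hi2 : ∀ e, F' e → e ≠ P → e ≠ Z → hi' e = hi (back e)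
  hord : ∀ e f, F' e → F' f → back e ≠ back f → (L' e < L' f ↔ L (back e) < L (back f))
  binj : ∀ e f, F' e → F' f → back e = back f → back e ≠ M → e = f
  hPZ : L' P < L' Z
  hZQ : L' Z < L' Q
  hc : ∀ p q, CL' p q → (F' p ∧ F' q ∧ hi' p = hi' q) ∧ ((p = P ∧ q = Z) ∨ (p = Z ∧ q = P) ∨
    (CL (back p) (back q) ∧ p ≠ P ∧ p ≠ Z ∧ q ≠ P ∧ q ≠ Z ∧ back p ≠ back q))

section
variable {E E' : Type} {F : E → Prop} {CL : E → E → Prop} {lo hi L : E → ℝ}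
    {F' : E' → Prop} {CL' : E' → E' → Prop} {lo' hi' L' : E' → ℝ} {back : E' → E} {P Z Q : E'}
    {M : E}

theorem SplitH.near (H : SplitH F CL lo hi L F' CL' lo' hi' L' back P Z Q M) (g : E') (hg : F' g)
    (hn : ¬ (g = P ∨ g = Z ∨ g = Q)) :
    (L' P < L' g ↔ L M < L (back g)) ∧ (L' Z < L' g ↔ L M < L (back g)) ∧
    (L' Q < L' g ↔ L M < L (back g)) ∧ (L' g < L' P ↔ L (back g) < L M) ∧
    (L' g < L' Z ↔ L (back g) < L M) ∧ (L' g < L' Q ↔ L (back g) < L M) ∧ back g ≠ M := by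
  have hP := (H.hT P H.F'P).2 (by simp)
  have hZ := (H.hT Z H.F'Z).2 (by simp)
  have hQ := (H.hT Q H.F'Q).2 (by simp)
  have hne : back g ≠ M := by rw [Ne, H.hT g hg]; exact hn
  have a1 := H.hord P g H.F'P hg (by rw [hP]; exact hne.symm)
  have a2 := H.hord Z g H.F'Z hg (by rw [hZ]; exact hne.symm)
  have a3 := H.hord Q g H.F'Q hg (by rw [hQ]; exact hne.symm)
  have a4 := H.hord g P hg H.F'P (by rw [hP]; exact hne)
  have a5 := H.hord g Z hg H.F'Z (by rw [hZ]; exact hne)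
  have a6 := H.hord g Q hg H.F'Q (by rw [hQ]; exact hne)
  rw [hP] at a1 a4
  rw [hZ] at a2 a5
  rw [hQ] at a3 a6
  exact ⟨a1, a2, a3, a4, a5, a6, hne⟩

theorem split_l1 (H : SplitH F CL lo hi L F' CL' lo' hi' L' back P Z Q M)
    (p q g : E') (c : CL' p q) (hg : F' g) (y1 : lo' g < hi' p) (y2 : hi' p < hi' g) :
    ¬ btw (L' p) (L' q) (L' g) := by
  have hPZ := H.hPZ
  have hZQ := H.hZQ
  obtain ⟨⟨hp, hq, e⟩, c⟩ := H.hc p q c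
  rcases c with ⟨rfl, rfl⟩ | ⟨rfl, rfl⟩ | ⟨c, n1, n2, n3, n4, hne⟩
  · by_cases hn : g = p ∨ g = q ∨ g = Q
    · unfold btw; rcases hn with rfl | rfl | rfl <;> grind
    · have := H.near g hg hn; unfold btw; grind
  · by_cases hn : g = q ∨ g = p ∨ g = Q
    · unfold btw; rcases hn with rfl | rfl | rfl <;> grind
    · have := H.near g hg hn; unfold btw; grind
  · have k := H.l1 _ _ (back g) c (H.hF g hg)
      (by have := H.hi1 p hp; have := H.lo1 g hg; linarith)
      (by have := H.hi2 p hp n1 n2; have := H.hi1 g hg; linarith)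
    have m1 : back p ≠ back g := by
      intro h; have := H.hi2 p hp n1 n2; have := H.hi1 g hg; rw [← h] at this; linarith
    have m2 : back q ≠ back g := by
      intro h; have := H.hi2 q hq n3 n4; have := H.hi1 g hg; rw [← h] at this; linarith
    unfold btw at k ⊢
    rw [H.hord p g hp hg m1, H.hord g q hg hq m2.symm, H.hord q g hq hg m2, H.hord g p hg hp m1.symm]
    exact k

theorem split_l2 (H : SplitH F CL lo hi L F' CL' lo' hi' L' back P Z Q M)
    (p q p' q' : E') (c : CL' p q) (c' : CL' p' q') (y : hi' p = hi' p') :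
    (btw (L' p') (L' q') (L' p) ↔ btw (L' p') (L' q') (L' q)) := by
  have hPZ := H.hPZ
  have hZQ := H.hZQ
  obtain ⟨⟨hp, hq, e⟩, c⟩ := H.hc p q c
  obtain ⟨⟨hp', hq', e'⟩, c'⟩ := H.hc p' q' c'
  have gen : ∀ p', F' p' → p' ≠ P → p' ≠ Z → p' = Q ∨ ((L' P < L' p' ↔ L M < L (back p')) ∧
    (L' Z < L' p' ↔ L M < L (back p')) ∧ (L' p' < L' P ↔ L (back p') < L M) ∧
    (L' p' < L' Z ↔ L (back p') < L M)) := by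
    intro p' hp' n1 n2
    by_cases h : p' = Q
    · exact Or.inl h
    · have h1 : ¬ (p' = P ∨ p' = Z ∨ p' = Q) := by
        rintro (h' | h' | h')
        · exact n1 h'
        · exact n2 h'
        · exact h h'
      obtain ⟨a1, a2, a3, a4, a5, a6, a7⟩ := H.near p' hp' h1
      exact Or.inr ⟨a1, a2, a4, a5⟩
  rcases c with ⟨rfl, rfl⟩ | ⟨rfl, rfl⟩ | ⟨c, n1, n2, n3, n4, hne⟩ <;>
  rcases c' with ⟨c1, c2⟩ | ⟨c1, c2⟩ | ⟨c', n1', n2', n3', n4', hne'⟩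
  · subst c1 c2; unfold btw; grind
  · subst c1 c2; unfold btw; grind
  · have g1 := gen p' hp' n1' n2'
    have g2 := gen q' hq' n3' n4'
    unfold btw; grind
  · subst c1 c2; unfold btw; grind
  · subst c1 c2; unfold btw; grind
  · have g1 := gen p' hp' n1' n2'
    have g2 := gen q' hq' n3' n4'
    unfold btw; grind
  · subst c1 c2
    have g1 := gen p hp n1 n2
    have g2 := gen q hq n3 n4
    unfold btw; grind
  · subst c1 c2
    have g1 := gen p hp n1 n2
    have g2 := gen q hq n3 n4
    unfold btw; grind
  · have k := H.l2 _ _ _ _ c c' (by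
      rw [← H.hi2 p hp n1 n2, ← H.hi2 p' hp' n1' n2']; exact y)
    have ord : ∀ e f, F' e → F' f → e ≠ P → e ≠ Z → f ≠ P → f ≠ Z →
        (L' e < L' f ↔ L (back e) < L (back f)) := by
      intro e f he hf a1 a2 a3 a4
      by_cases hb : back e = back f
      · have : e = f := by
          by_cases hM : back e = M
          · have h1 := (H.hT e he).1 hM
            have h2 := (H.hT f hf).1 (hb ▸ hM)
            rw [(h1.resolve_left a1).resolve_left a2, (h2.resolve_left a3).resolve_left a4]
          · exact H.binj e f he hf hb hM
        subst this; simp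
      · exact H.hord e f he hf hb
    unfold btw at k ⊢
    rw [ord p' p hp' hp n1' n2' n1 n2, ord p q' hp hq' n1 n2 n3' n4',
      ord q' p hq' hp n3' n4' n1 n2, ord p p' hp hp' n1 n2 n1' n2',
      ord p' q hp' hq n1' n2' n3 n4, ord q q' hq hq' n3 n4 n3' n4',
      ord q' q hq' hq n3' n4' n3 n4, ord q p' hq hp' n3 n4 n1' n2']
    exact k
end

theorem exists_delta (R : List Edge) (c : ℝ) (h : ∀ g ∈ R, g.L ≠ c) :
    ∃ δ > 0, ∀ g ∈ R, δ < |g.L - c| := by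
  induction R with
  | nil => exact ⟨1, one_pos, by simp⟩
  | cons g R ih =>
    obtain ⟨δ, hδ, hR⟩ := ih (fun g hg => h g (List.mem_cons_of_mem _ hg))
    have h0 : 0 < |g.L - c| := abs_pos.2 (sub_ne_zero.2 (h g (by simp)))
    refine ⟨min δ (|g.L - c| / 2), lt_min hδ (by linarith), ?_⟩
    intro g' hg'
    rcases List.mem_cons.1 hg' with rfl | hg'
    · exact lt_of_le_of_lt (min_le_right _ _) (by linarith)
    · exact lt_of_le_of_lt (min_le_left _ _) (hR g' hg')

end FC

set_option linter.unusedVariables false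
set_option linter.unusedSimpArgs false
namespace FC

theorem cyc1 {α : Type} (M : α) (R : List α) : cyc (M :: R) =
      (cyc (none :: R.map some)).map (Prod.map (rep M) (rep M)) := by
  rw [← cyc_map]
  congr 1
  simp [rep, Function.comp_def]

set_option maxHeartbeats 2000000 in
theorem crimp_bwd {ε : ZMod 2} {M : Edge} {R : List Edge} (h : Good ε (M :: R)) (hr : M.a < M.b)
    {p θ q : ℝ} (hθ : 0 < θ) (hp : θ ≤ p) (hq : θ ≤ q) (hs : M.b - M.a = p - θ + q) :
    FF ε ((p, M.m) :: (θ, false) :: (q, true) :: R.map wd) := by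
  classical
  obtain ⟨hn, hC, G, hM, p0, hp0, ej⟩ := id h
  set l := M :: R with hl
  have hMl : M ∈ l := by simp [hl]
  have hRl : ∀ g, g ∈ R → g ∈ l := by intro g hg; rw [hl]; simp [hg]
  have hMR : M ∉ R ∧ R.Nodup := by rw [hl] at hn; exact List.nodup_cons.1 hn
  obtain ⟨δ, hδ, hR⟩ := exists_delta R M.L (by
    intro g hg e
    have := G.inj g M (hRl g hg) hMl e
    exact hMR.1 (this ▸ hg))
  obtain ⟨E0, hE0⟩ : ∃ E0 : Edge, E0 = ⟨M.a, M.a + p, M.L - δ, M.m⟩ := ⟨_, rfl⟩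
  obtain ⟨E1, hE1⟩ : ∃ E1 : Edge, E1 = ⟨M.a + p, M.a + p - θ, M.L, false⟩ := ⟨_, rfl⟩
  obtain ⟨E2, hE2⟩ : ∃ E2 : Edge, E2 = ⟨M.a + p - θ, M.b, M.L + δ, true⟩ := ⟨_, rfl⟩
  have a0 : E0.a = M.a := by rw [hE0]
  have b0 : E0.b = M.a + p := by rw [hE0]
  have L0 : E0.L = M.L - δ := by rw [hE0]
  have a1 : E1.a = M.a + p := by rw [hE1]
  have b1 : E1.b = M.a + p - θ := by rw [hE1]
  have L1 : E1.L = M.L := by rw [hE1]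
  have a2 : E2.a = M.a + p - θ := by rw [hE2]
  have b2 : E2.b = M.b := by rw [hE2]
  have L2 : E2.L = M.L + δ := by rw [hE2]
  have m0 : E0.m = M.m := by rw [hE0]
  have m1 : E1.m = false := by rw [hE1]
  have m2 : E2.m = true := by rw [hE2]
  have lo0 : E0.lo = M.a := by rw [← a0]; exact min_eq_left (by linarith)
  have hi0 : E0.hi = M.a + p := by rw [← b0]; exact max_eq_right (by linarith)
  have lo1 : E1.lo = M.a + p - θ := by rw [← b1]; exact min_eq_right (by linarith)
  have hi1 : E1.hi = M.a + p := by rw [← a1]; exact max_eq_left (by linarith)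
  have lo2 : E2.lo = M.a + p - θ := by rw [← a2]; exact min_eq_left (by linarith)
  have hi2 : E2.hi = M.b := by rw [← b2]; exact max_eq_right (by linarith)
  have loM : M.lo = M.a := min_eq_left hr.le
  have hiM : M.hi = M.b := max_eq_right hr.le
  clear hE0 hE1 hE2
  have fR : ∀ g ∈ R, (g.L < M.L - δ ∧ g.L < M.L ∧ g.L < M.L + δ) ∨
      (M.L - δ < g.L ∧ M.L < g.L ∧ M.L + δ < g.L) := by
    intro g hg
    have := hR g hg
    rcases lt_abs.1 this with h | h
    · right; exact ⟨by linarith, by linarith, by linarith⟩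
    · left; exact ⟨by linarith, by linarith, by linarith⟩
  have nR : ∀ g ∈ R, g ≠ E0 ∧ g ≠ E1 ∧ g ≠ E2 := by
    intro g hg
    have := fR g hg
    refine ⟨?_, ?_, ?_⟩ <;> rintro rfl <;> rcases this with h | h <;> linarith [h.1, h.2.1, h.2.2]
  have n01 : E0 ≠ E1 := by intro e; rw [e] at L0; linarith
  have n02 : E0 ≠ E2 := by intro e; rw [e] at L0; linarith
  have n12 : E1 ≠ E2 := by intro e; rw [e] at L1; linarith
  set l' := E0 :: E1 :: E2 :: R with hl'
  have mem' : ∀ e, e ∈ l' ↔ e = E0 ∨ e = E1 ∨ e = E2 ∨ e ∈ R := by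
    intro e; rw [hl']; simp
  obtain ⟨back, hb1, hb2⟩ : ∃ back : Edge → Edge, (∀ e, e = E0 ∨ e = E1 ∨ e = E2 → back e = M) ∧
      (∀ e ∈ R, back e = e) := by
    refine ⟨fun e => if e = E0 ∨ e = E1 ∨ e = E2 then M else e, fun e he => if_pos he, ?_⟩
    intro e he
    have := nR e he
    exact if_neg (by tauto)
  have hbR : ∀ e ∈ l', (e = E0 ∨ e = E1 ∨ e = E2) ∧ back e = M ∨ (e ∈ R ∧ back e = e) := by
    intro e he
    rcases (mem' e).1 he with h | h | h | h
    · exact Or.inl ⟨by tauto, hb1 e (by tauto)⟩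
    · exact Or.inl ⟨by tauto, hb1 e (by tauto)⟩
    · exact Or.inl ⟨by tauto, hb1 e (by tauto)⟩
    · exact Or.inr ⟨h, hb2 e h⟩
  set t : List (Option Edge) := none :: R.map some with ht
  have hFO : ∀ x ∈ t, x = none ∨ ∃ g ∈ R, x = some g := by
    intro x hx
    rw [ht] at hx
    rcases List.mem_cons.1 hx with rfl | hx
    · exact Or.inl rfl
    · obtain ⟨g, hg, rfl⟩ := List.mem_map.1 hx; exact Or.inr ⟨g, hg, rfl⟩
  have cg : ∀ x y, (x, y) ∈ cyc t → (rep M x, rep M y) ∈ cyc l := by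
    intro x y hxy
    rw [hl, cyc1]
    exact List.mem_map.2 ⟨(x, y), hxy, rfl⟩
  have cl' : ∀ e f, (e, f) ∈ cyc l' → (e = E0 ∧ f = E1) ∨ (e = E1 ∧ f = E2) ∨
      ∃ x y, (x, y) ∈ cyc t ∧ e = rep E2 x ∧ f = rep E0 y := by
    intro e f hc
    rw [hl', cyc3] at hc
    rcases List.mem_cons.1 hc with h | hc
    · left; simpa using h
    rcases List.mem_cons.1 hc with h | hc
    · right; left; simpa using h
    · obtain ⟨⟨x, y⟩, hxy, e⟩ := List.mem_map.1 hc
      simp only [Prod.map, Prod.mk.injEq] at e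
      exact Or.inr (Or.inr ⟨x, y, hxy, e.1.symm, e.2.symm⟩)
  have bk2 : ∀ x ∈ t, back (rep E2 x) = rep M x := by
    intro x hx
    rcases hFO x hx with rfl | ⟨g, hg, rfl⟩
    · exact hb1 _ (by simp [rep])
    · exact hb2 g hg
  have bk0 : ∀ x ∈ t, back (rep E0 x) = rep M x := by
    intro x hx
    rcases hFO x hx with rfl | ⟨g, hg, rfl⟩
    · exact hb1 _ (by simp [rep])
    · exact hb2 g hg
  -- structure of creases
  have cA : ∀ e f, (e, f) ∈ cyc l' → e.a < e.b → (e = E0 ∧ f = E1) ∨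
      (((back e, back f) ∈ cyc l ∧ (back e).a < (back e).b) ∧
        e ≠ E0 ∧ e ≠ E1 ∧ f ≠ E0 ∧ f ≠ E1 ∧ back e ≠ back f ∧
        (e = E2 ∨ e ∈ R) ∧ f ∈ R ∧ e.b = f.a ∧ f.b < f.a) := by
    intro e f hc hd
    rcases cl' e f hc with h | ⟨rfl, rfl⟩ | ⟨x, y, hxy, rfl, rfl⟩
    · exact Or.inl h
    · linarith
    · right
      have hx := cyc_mem hxy
      have k := hC _ (cg _ _ hxy)
      simp only at k
      rw [bk2 x hx.1, bk0 y hx.2]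
      rcases hFO x hx.1 with rfl | ⟨g, hg, rfl⟩ <;> rcases hFO y hx.2 with rfl | ⟨g', hg', rfl⟩ <;>
        simp only [rep] at *
      · grind
      · have := nR g' hg'
        refine ⟨⟨cg _ _ hxy, hr⟩, n02.symm, n12.symm, this.1, this.2.1, ?_, by simp, hg',
          by rw [b2]; exact k.1, by grind⟩
        rintro rfl; exact hMR.1 hg'
      · grind
      · have := nR g' hg'
        have := nR g hg
        refine ⟨⟨cg _ _ hxy, hd⟩, by tauto, by tauto, by tauto, by tauto, ?_, by tauto, hg', k.1,
          by grind⟩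
        rintro rfl; grind
  have cB : ∀ e f, (e, f) ∈ cyc l' → e.b < e.a → (e = E1 ∧ f = E2) ∨
      (((back e, back f) ∈ cyc l ∧ (back e).b < (back e).a) ∧
        e ≠ E2 ∧ e ≠ E1 ∧ f ≠ E2 ∧ f ≠ E1 ∧ back e ≠ back f ∧
        e ∈ R ∧ (f = E0 ∨ f ∈ R) ∧ e.b = f.a ∧ f.a < f.b) := by
    intro e f hc hd
    rcases cl' e f hc with ⟨rfl, rfl⟩ | h | ⟨x, y, hxy, rfl, rfl⟩
    · linarith
    · exact Or.inl h
    · right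
      have hx := cyc_mem hxy
      have k := hC _ (cg _ _ hxy)
      simp only at k
      rw [bk2 x hx.1, bk0 y hx.2]
      rcases hFO x hx.1 with rfl | ⟨g, hg, rfl⟩ <;> rcases hFO y hx.2 with rfl | ⟨g', hg', rfl⟩ <;>
        simp only [rep] at *
      · linarith
      · linarith
      · have := nR g hg
        refine ⟨⟨cg _ _ hxy, hd⟩, this.2.2, this.2.1, n02, n01, ?_, hg, by simp,
          by rw [a0]; exact k.1, by linarith⟩
        rintro rfl; exact hMR.1 hg
      · have := nR g' hg'
        have := nR g hg
        refine ⟨⟨cg _ _ hxy, hd⟩, by tauto, by tauto, by tauto, by tauto, ?_, hg, by tauto, k.1,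
          by grind⟩
        rintro rfl; grind
  have hpos : ∀ e ∈ l', e.a < e.b ∨ e.b < e.a := by
    intro e he
    rcases (mem' e).1 he with rfl | rfl | rfl | h
    · left; linarith
    · right; linarith
    · left; linarith
    · exact hC.pos (hRl e h)
  have hC' : Chn l' := by
    rintro ⟨e, f⟩ hc
    simp only
    rcases hpos e (cyc_mem hc).1 with hd | hd
    · rcases cA e f hc hd with ⟨rfl, rfl⟩ | h
      · exact ⟨by linarith, Or.inl ⟨hd, by linarith⟩⟩
      · exact ⟨by tauto, by tauto⟩
    · rcases cB e f hc hd with ⟨rfl, rfl⟩ | h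
      · exact ⟨by linarith, Or.inr ⟨hd, by linarith⟩⟩
      · exact ⟨by tauto, by tauto⟩
  have hn' : l'.Nodup := by
    rw [hl']
    simp only [List.nodup_cons, List.mem_cons, not_or]
    exact ⟨⟨n01, n02, fun h => (nR _ h).1 rfl⟩, ⟨n12, fun h => (nR _ h).2.1 rfl⟩,
      fun h => (nR _ h).2.2 rfl, hMR.2⟩
  have hord : ∀ e f, e ∈ l' → f ∈ l' → back e ≠ back f → (e.L < f.L ↔ (back e).L < (back f).L) := by
    intro e f he hf hne
    rcases hbR e he with ⟨h1, h2⟩ | ⟨h1, h2⟩ <;> rcases hbR f hf with ⟨h3, h4⟩ | ⟨h3, h4⟩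
    · exact absurd (h2.trans h4.symm) hne
    · rw [h2, h4]
      have := fR f h3
      rcases h1 with rfl | rfl | rfl <;> grind
    · rw [h2, h4]
      have := fR e h1
      rcases h3 with rfl | rfl | rfl <;> grind
    · rw [h2, h4]
  have hT : ∀ e, e ∈ l' → (back e = M ↔ e = E0 ∨ e = E1 ∨ e = E2) := by
    intro e he
    rcases hbR e he with ⟨h1, h2⟩ | ⟨h1, h2⟩
    · simp [h1, h2]
    · have := nR e h1
      rw [h2]
      constructor
      · rintro rfl; exact absurd h1 hMR.1
      · tauto
  have hF : ∀ e, e ∈ l' → back e ∈ l := by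
    intro e he
    rcases hbR e he with ⟨h1, h2⟩ | ⟨h1, h2⟩
    · rw [h2]; exact hMl
    · rw [h2]; exact hRl e h1
  have binj : ∀ e f, e ∈ l' → f ∈ l' → back e = back f → back e ≠ M → e = f := by
    intro e f he hf hb hne
    rcases hbR e he with ⟨h1, h2⟩ | ⟨h1, h2⟩ <;> rcases hbR f hf with ⟨h3, h4⟩ | ⟨h3, h4⟩
    · exact absurd h2 hne
    · exact absurd h2 hne
    · exact absurd (hb.trans h4) hne
    · rw [← h2, hb, h4]
  have hlo1 : ∀ e, e ∈ l' → (back e).lo ≤ e.lo := by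
    intro e he
    rcases hbR e he with ⟨h1, h2⟩ | ⟨h1, h2⟩
    · rw [h2, loM]; rcases h1 with rfl | rfl | rfl <;> linarith
    · rw [h2]
  have hhi1 : ∀ e, e ∈ l' → e.hi ≤ (back e).hi := by
    intro e he
    rcases hbR e he with ⟨h1, h2⟩ | ⟨h1, h2⟩
    · rw [h2, hiM]; rcases h1 with rfl | rfl | rfl <;> linarith
    · rw [h2]
  have hhi2 : ∀ e, e ∈ l' → e ≠ E0 → e ≠ E1 → e.hi = (back e).hi := by
    intro e he k1 k2
    rcases hbR e he with ⟨h1, h2⟩ | ⟨h1, h2⟩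
    · rw [h2, hiM, (h1.resolve_left k1).resolve_left k2, hi2]
    · rw [h2]
  have hlo2 : ∀ e, e ∈ l' → e ≠ E2 → e ≠ E1 → e.lo = (back e).lo := by
    intro e he k1 k2
    rcases hbR e he with ⟨h1, h2⟩ | ⟨h1, h2⟩
    · rw [h2, loM, ← lo0]; congr 1; tauto
    · rw [h2]
  have Lcl : ∀ e f, CLof l' e f → e ∈ l' ∧ f ∈ l' ∧ e.hi = f.hi := by
    rintro e f (⟨h1, h2⟩ | ⟨h1, h2⟩)
    · refine ⟨(cyc_mem h1).1, (cyc_mem h1).2, ?_⟩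
      have := hC' _ h1
      simp only at this
      rw [Edge.hi, Edge.hi, max_eq_right h2.le, max_eq_left (by grind)]; exact this.1
    · refine ⟨(cyc_mem h1).2, (cyc_mem h1).1, ?_⟩
      have := hC' _ h1
      simp only at this
      rw [Edge.hi, Edge.hi, max_eq_right h2.le, max_eq_left (by grind)]; exact this.1.symm
  have Lcr : ∀ e f, CRof l' e f → e ∈ l' ∧ f ∈ l' ∧ e.lo = f.lo := by
    rintro e f (⟨h1, h2⟩ | ⟨h1, h2⟩)
    · refine ⟨(cyc_mem h1).1, (cyc_mem h1).2, ?_⟩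
      have := hC' _ h1
      simp only at this
      rw [Edge.lo, Edge.lo, min_eq_right h2.le, min_eq_left (by grind)]; exact this.1
    · refine ⟨(cyc_mem h1).2, (cyc_mem h1).1, ?_⟩
      have := hC' _ h1
      simp only at this
      rw [Edge.lo, Edge.lo, min_eq_right h2.le, min_eq_left (by grind)]; exact this.1.symm
  have H1 : SplitH (fun e => e ∈ l) (CLof l) Edge.lo Edge.hi Edge.L (fun e => e ∈ l') (CLof l')
      Edge.lo Edge.hi Edge.L back E0 E1 E2 M := by
    refine ⟨G.l1, G.l2, (mem' _).2 (by simp), (mem' _).2 (by simp), (mem' _).2 (by simp), hF, hT,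
      hlo1, hhi1, hhi2, hord, binj, by rw [L0, L1]; linarith, by rw [L1, L2]; linarith, ?_⟩
    intro e f hc
    refine ⟨Lcl e f hc, ?_⟩
    rcases hc with ⟨h1, h2⟩ | ⟨h1, h2⟩
    · rcases cA _ _ h1 h2 with h | h
      · exact Or.inl h
      · exact Or.inr (Or.inr ⟨Or.inl h.1, h.2.1, h.2.2.1, h.2.2.2.1, h.2.2.2.2.1, h.2.2.2.2.2.1⟩)
    · rcases cA _ _ h1 h2 with h | h
      · exact Or.inr (Or.inl ⟨h.2, h.1⟩)
      · exact Or.inr (Or.inr ⟨Or.inr h.1, h.2.2.2.1, h.2.2.2.2.1, h.2.1, h.2.2.1,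
          h.2.2.2.2.2.1.symm⟩)
  have Gr := G.reflect.flip
  have H2 : SplitH (fun e => e ∈ l) (CRof l) (fun e => - Edge.hi e) (fun e => - Edge.lo e)
      (fun e => - Edge.L e) (fun e => e ∈ l') (CRof l')
      (fun e => - Edge.hi e) (fun e => - Edge.lo e) (fun e => - Edge.L e) back E2 E1 E0 M := by
    refine ⟨Gr.l1, Gr.l2, (mem' _).2 (by simp), (mem' _).2 (by simp), (mem' _).2 (by simp), hF,
      ?_, ?_, ?_, ?_, ?_, binj, by rw [L2, L1]; linarith,
      by rw [L1, L0]; linarith, ?_⟩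
    · intro e he; rw [hT e he]; tauto
    · intro e he; exact neg_le_neg (hhi1 e he)
    · intro e he; exact neg_le_neg (hlo1 e he)
    · intro e he h1 h2; rw [hlo2 e he h1 h2]
    · intro e f he hf hne
      rw [neg_lt_neg_iff, neg_lt_neg_iff]
      exact hord f e hf he hne.symm
    intro e f hc
    refine ⟨by have := Lcr e f hc; exact ⟨this.1, this.2.1, by rw [this.2.2]⟩, ?_⟩
    rcases hc with ⟨h1, h2⟩ | ⟨h1, h2⟩
    · rcases cB _ _ h1 h2 with h | h
      · exact Or.inr (Or.inl h)
      · exact Or.inr (Or.inr ⟨Or.inl h.1, h.2.1, h.2.2.1, h.2.2.2.1, h.2.2.2.2.1, h.2.2.2.2.2.1⟩)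
    · rcases cB _ _ h1 h2 with h | h
      · exact Or.inl ⟨h.2, h.1⟩
      · exact Or.inr (Or.inr ⟨Or.inr h.1, h.2.2.2.1, h.2.2.2.2.1, h.2.1, h.2.2.1,
          h.2.2.2.2.2.1.symm⟩)
  refine ⟨l', ?_, hn', hC', ?_, ?_, E2, (mem' _).2 (by simp), ?_⟩
  · rw [hl']
    simp only [List.map_cons, wd, m0, m1, m2, a0, a1, a2, b0, b1, b2, List.cons.injEq,
      Prod.mk.injEq, and_true]
    refine ⟨?_, ?_, ?_⟩
    · rw [abs_of_pos (by linarith)]; ring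
    · rw [abs_of_neg (by linarith)]; ring
    · rw [abs_of_pos (by linarith)]; linarith
  · refine ⟨?_, ?_, ?_, ?_, Lcl, Lcr, fun e f g hc hg h1 h2 => split_l1 H1 e f g hc hg h1 h2, ?_,
      split_l2 H1, ?_⟩
    · intro e he
      exact min_lt_max.2 (by rcases hpos e he with h | h <;> linarith)
    · intro e f he hf hL
      by_cases hne : back e = back f
      · by_cases hbM : back e = M
        · have k1 := (hT e he).1 hbM
          have k2 := (hT f hf).1 (hne ▸ hbM)
          rcases k1 with rfl | rfl | rfl <;> rcases k2 with rfl | rfl | rfl <;>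
            first | rfl | (exfalso; linarith)
        · exact binj e f he hf hne hbM
      · have k1 := hord e f he hf hne
        have k2 := hord f e hf he (Ne.symm hne)
        rw [hL] at k1 k2
        exact absurd (G.inj _ _ (hF e he) (hF f hf) (by
          simp only [lt_irrefl, false_iff, not_lt] at k1 k2
          exact le_antisymm k2 k1)) hne
    · intro e f hh; unfold CLof at *; tauto
    · intro e f hh; unfold CRof at *; tauto
    · intro e f g hc hg h1 h2
      have := split_l1 H2 e f g hc hg (by linarith) (by linarith)
      rw [btw_neg] at this; exact this
    · intro e f e' f' hc hc' hh
      have := split_l2 H2 e f e' f' hc hc' (by rw [hh])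
      rw [btw_neg, btw_neg] at this; exact this
  · rintro ⟨e, f⟩ hc
    simp only
    have hfm : ∀ f ∈ l', f ≠ E1 → f ≠ E2 → f.m = (back f).m := by
      intro f hf h1 h2
      rcases hbR f hf with ⟨h3, h4⟩ | ⟨h3, h4⟩
      · rw [h4, h3.resolve_right (by tauto), m0]
      · rw [h4]
    have hm := cyc_mem hc
    rcases hpos e (cyc_mem hc).1 with hd | hd
    · rcases cA e f hc hd with ⟨rfl, rfl⟩ | k
      · rw [m1, L0, L1]; simp; exact ⟨fun _ => hδ, fun _ => hd⟩
      · have := hM _ k.1.1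
        have k3 := hord e f hm.1 hm.2 k.2.2.2.2.2.1
        have k4 := hfm f hm.2 k.2.2.2.2.1 (by
          have := nR f k.2.2.2.2.2.2.2.1; exact this.2.2)
        simp only at this
        rw [k4, this, k3]
        simp [hd, k.1.2]
    · rcases cB e f hc hd with ⟨rfl, rfl⟩ | k
      · rw [m2, L1, L2]; simp only [true_iff]; intro h
        have := h.2 (by linarith); linarith
      · have := hM _ k.1.1
        have k3 := hord e f hm.1 hm.2 k.2.2.2.2.2.1
        have k4 := hfm f hm.2 k.2.2.2.2.1 k.2.2.2.1
        simp only at this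
        rw [k4, this, k3]
        simp [hd.le, k.1.2.le, not_lt.2 hd.le, not_lt.2 k.1.2.le]
  · rw [← h.J hMl]
    unfold Jv
    have hf : ∀ P : Prop, ¬ P → ind P = 0 := fun P h => if_neg h
    congr 1
    · unfold NH
      rw [hl', hl]
      simp only [List.map_cons, List.sum_cons]
      rw [hf (E2.L < E0.L ∧ _) (by intro h; linarith [h.1]),
        hf (E2.L < E1.L ∧ _) (by intro h; linarith [h.1]), hf (E2.L < E2.L ∧ _) (by simp),
        hf (M.L < M.L ∧ _) (by simp)]
      simp only [zero_add]
      congr 1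
      apply List.map_congr_left
      intro g hg
      congr 1
      rw [hi2, hiM, L2, eq_iff_iff]
      have := fR g hg
      grind
    · rw [ind, ind, if_pos (by linarith), if_pos hr]

end FC

set_option linter.unusedVariables false
set_option linter.unusedSimpArgs false
namespace FC

theorem crimp0 {ε : ZMod 2} {p θ q : ℝ} {m : Bool} {R : List (ℝ × Bool)}
    (hθ : 0 < θ) (hp : θ ≤ p) (hq : θ ≤ q) :
    FF ε ((p, m) :: (θ, false) :: (q, true) :: R) ↔ FF ε ((p - θ + q, m) :: R) := by
  constructor
  · intro h
    obtain ⟨E0, l, h0, hl, hG, hr⟩ := FF_right h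
    rcases l with _ | ⟨E1, _ | ⟨E2, l⟩⟩
    · simp at hl
    · simp at hl
    · simp only [List.map_cons, List.cons.injEq] at hl
      obtain ⟨h1, h2, rfl⟩ := hl
      have := crimp_fwd hG hr (congrArg Prod.snd h1) (congrArg Prod.snd h2)
        (by rw [h1, h0]; exact hp) (by rw [h1, h2]; exact hq)
      rw [h0, h1, h2] at this
      have e : E0.m = m := congrArg Prod.snd h0
      rw [e] at this
      exact this
  · intro h
    obtain ⟨M, l, h0, rfl, hG, hr⟩ := FF_right h
    have h1 : |M.b - M.a| = p - θ + q := congrArg Prod.fst h0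
    have h2 : M.m = m := congrArg Prod.snd h0
    rw [abs_of_pos (by linarith)] at h1
    have := crimp_bwd hG hr hθ hp hq h1
    rw [h2] at this; exact this

theorem crimp1 {ε : ZMod 2} {p θ q : ℝ} {m u v : Bool} {R : List (ℝ × Bool)}
    (hθ : 0 < θ) (hp : θ ≤ p) (hq : θ ≤ q) (huv : u ≠ v) :
    FF ε ((p, m) :: (θ, u) :: (q, v) :: R) ↔ FF ε ((p - θ + q, m) :: R) := by
  cases u <;> cases v
  · exact absurd rfl huv
  · exact crimp0 hθ hp hq
  · rw [← FF_ng, ← FF_ng (w := (p - θ + q, m) :: R)]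
    exact crimp0 hθ hp hq
  · exact absurd rfl huv

theorem FF_append {ε : ZMod 2} (s t : List (ℝ × Bool)) : FF ε (s ++ t) ↔ FF ε (t ++ s) :=
  FF_isRotated List.isRotated_append

theorem crimp {ε : ZMod 2} {p θ q : ℝ} {m u v : Bool} (S R : List (ℝ × Bool))
    (hθ : 0 < θ) (hp : θ ≤ p) (hq : θ ≤ q) (huv : u ≠ v) :
    FF ε (S ++ (p, m) :: (θ, u) :: (q, v) :: R) ↔ FF ε (S ++ (p - θ + q, m) :: R) := by
  rw [FF_append, FF_append S]
  simp only [List.cons_append]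
  exact crimp1 hθ hp hq huv

end FC

set_option linter.unusedVariables false
set_option linter.unusedSimpArgs false
namespace FC

theorem len_cases {l : List Edge} (hC : Chn l) {e : Edge} (he : e ∈ l) :
    (e.a < e.b ∧ (wd e).1 = e.b - e.a ∧ e.lo = e.a ∧ e.hi = e.b) ∨
    (e.b < e.a ∧ (wd e).1 = e.a - e.b ∧ e.lo = e.b ∧ e.hi = e.a) := by
  rcases hC.pos he with h | h
  · left; exact ⟨h, abs_of_pos (by linarith), min_eq_left h.le, max_eq_right h.le⟩
  · right
    refine ⟨h, ?_, min_eq_right h.le, max_eq_left h.le⟩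
    simp only [wd]; rw [abs_of_neg (by linarith)]; ring

/-- along a crease: layer comparison determined -/
theorem crease_L {l : List Edge} (hC : Chn l) (G : GeoL l) (hM : MVok l) {e f : Edge}
    (h : (e, f) ∈ cyc l) : (e.a < e.b ↔ f.b < f.a) ∧ (e.b < e.a ↔ f.a < f.b) ∧ e.b = f.a ∧
    (f.m = true → (e.a < e.b → f.L < e.L) ∧ (e.b < e.a → e.L < f.L)) ∧
    (f.m = false → (e.a < e.b → e.L < f.L) ∧ (e.b < e.a → f.L < e.L)) := by
  have h1 := hC _ h
  have h2 := hM _ h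
  have h3 := G.inj _ _ (cyc_mem h).1 (cyc_mem h).2
  simp only at h1 h2 h3
  have hne : e ≠ f := by rintro rfl; grind
  cases hf : f.m <;> simp only [hf] at h2 ⊢ <;> grind

theorem fin4 {x0 x1 x2 x3 : ℝ} (h : btw x0 x1 x2 ↔ btw x0 x1 x3) (n02 : x0 ≠ x2) (n13 : x1 ≠ x3)
    (g1 : |x1 - x2| ≤ |x0 - x1|) (g2 : |x1 - x2| ≤ |x2 - x3|)
    (c : (x0 < x1 ∧ x2 < x1 ∧ x2 < x3) ∨ (x1 < x0 ∧ x1 < x2 ∧ x3 < x2)) : False := by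
  unfold btw at h
  rcases c with ⟨a, b, c⟩ | ⟨a, b, c⟩
  · rw [abs_of_pos (by linarith), abs_of_neg (by linarith)] at g1
    rw [abs_of_pos (by linarith), abs_of_neg (by linarith)] at g2
    have h1 : x0 < x2 := lt_of_le_of_ne (by linarith) n02
    have h2 : x1 < x3 := lt_of_le_of_ne (by linarith) n13
    rcases h.1 (Or.inl ⟨h1, b⟩) with ⟨_, _⟩ | ⟨_, _⟩ <;> linarith
  · rw [abs_of_neg (by linarith), abs_of_pos (by linarith)] at g1
    rw [abs_of_neg (by linarith), abs_of_pos (by linarith)] at g2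
    have h1 : x2 < x0 := lt_of_le_of_ne (by linarith) n02.symm
    have h2 : x3 < x1 := lt_of_le_of_ne (by linarith) n13.symm
    rcases h.1 (Or.inr ⟨b, h1⟩) with ⟨_, _⟩ | ⟨_, _⟩ <;> linarith

theorem lemX {l : List Edge} (hC : Chn l) (G : GeoL l) (hM : MVok l) {e0 e1 e2 e3 : Edge}
    (h01 : (e0, e1) ∈ cyc l) (h12 : (e1, e2) ∈ cyc l) (h23 : (e2, e3) ∈ cyc l)
    (hm1 : e1.m = e2.m) (hm2 : e2.m = e3.m) (hlen : (wd e1).1 = (wd e2).1)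
    (g1 : |e1.L - e2.L| ≤ |e0.L - e1.L|) (g2 : |e1.L - e2.L| ≤ |e2.L - e3.L|)
    (n02 : e0 ≠ e2) (n13 : e1 ≠ e3) : False := by
  obtain ⟨a1, b1, c1, d1, f1⟩ := crease_L hC G hM h01
  obtain ⟨a2, b2, c2, d2, f2⟩ := crease_L hC G hM h12
  obtain ⟨a3, b3, c3, d3, f3⟩ := crease_L hC G hM h23
  have i02 : e0.L ≠ e2.L := fun h => n02 (G.inj _ _ (cyc_mem h01).1 (cyc_mem h12).2 h)
  have i13 : e1.L ≠ e3.L := fun h => n13 (G.inj _ _ (cyc_mem h12).1 (cyc_mem h23).2 h)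
  have l1 := len_cases hC (cyc_mem h12).1
  have l2 := len_cases hC (cyc_mem h23).1
  have l0 := len_cases hC (cyc_mem h01).1
  simp only at l1 l2 l0
  have key : (e1.a < e1.b → (btw e0.L e1.L e2.L ↔ btw e0.L e1.L e3.L)) ∧
      (e1.b < e1.a → (btw e0.L e1.L e2.L ↔ btw e0.L e1.L e3.L)) := by
    constructor
    · intro h
      refine G.r2 e2 e3 e0 e1 (Or.inl ⟨h23, a2.1 h⟩) (Or.inl ⟨h01, b1.2 h⟩) ?_
      have := a2.1 h
      have := b1.2 h
      rcases l2 with ⟨_, _, _, _⟩ | ⟨_, y2, y3, _⟩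
      · linarith
      rcases l0 with ⟨_, _, _, _⟩ | ⟨_, _, z3, _⟩
      · linarith
      rcases l1 with ⟨_, x2, _, _⟩ | ⟨_, _, x3, _⟩
      · rw [y3, z3]; linarith
      · linarith
    · intro h
      refine G.l2 e2 e3 e0 e1 (Or.inl ⟨h23, b2.1 h⟩) (Or.inl ⟨h01, a1.2 h⟩) ?_
      have := b2.1 h
      have := a1.2 h
      rcases l2 with ⟨_, y2, _, y3⟩ | ⟨_, _, _, _⟩
      swap
      · linarith
      rcases l0 with ⟨_, _, _, z3⟩ | ⟨_, _, _, _⟩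
      swap
      · linarith
      rcases l1 with ⟨_, x2, _, _⟩ | ⟨_, _, x3, _⟩
      · linarith
      · rw [y3, z3]; linarith
  rw [← hm2, ← hm1] at d3 f3
  rw [← hm1] at d2 f2
  rcases hC.pos (cyc_mem h12).1 with h | h <;> simp only at h
  · refine fin4 (key.1 h) i02 i13 g1 g2 ?_
    cases hm : e1.m
    · exact Or.inr ⟨(f1 hm).2 (b1.2 h), (f2 hm).1 h, (f3 hm).2 (a2.1 h)⟩
    · exact Or.inl ⟨(d1 hm).2 (b1.2 h), (d2 hm).1 h, (d3 hm).2 (a2.1 h)⟩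
  · refine fin4 (key.2 h) i02 i13 g1 g2 ?_
    cases hm : e1.m
    · exact Or.inl ⟨(f1 hm).1 (a1.2 h), (f2 hm).2 h, (f3 hm).1 (b2.1 h)⟩
    · exact Or.inr ⟨(d1 hm).1 (a1.2 h), (d2 hm).2 h, (d3 hm).1 (b2.1 h)⟩

theorem lemY {l : List Edge} (hC : Chn l) (G : GeoL l) (hM : MVok l) {e0 e1 e2 : Edge}
    (h01 : (e0, e1) ∈ cyc l) (h12 : (e1, e2) ∈ cyc l)
    (hm1 : e1.m = e2.m) (hlen : (wd e1).1 < (wd e0).1)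
    (g1 : |e0.L - e1.L| ≤ |e1.L - e2.L|)
    (n02 : e0 ≠ e2) : False := by
  have c1 := crease_L hC G hM h01
  have c2 := crease_L hC G hM h12
  have i02 := G.inj _ _ (cyc_mem h01).1 (cyc_mem h12).2
  simp only at i02
  have l1 := len_cases hC (cyc_mem h12).1
  have l0 := len_cases hC (cyc_mem h01).1
  have l2 := len_cases hC (cyc_mem h12).2
  simp only at l1 l2 l0
  have kl := G.l1 e1 e2 e0
  have kr := G.r1 e1 e2 e0
  have m0 := (cyc_mem h01).1
  simp only [CLof, CRof, btw] at kl kr m0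
  cases hm : e2.m <;> rcases l1 with l1 | l1 <;> rw [hm] at hm1 <;> simp only [hm, hm1] at * <;>
    simp only [abs_le, le_abs] at g1 <;> grind

theorem lemY' {l : List Edge} (hC : Chn l) (G : GeoL l) (hM : MVok l) {e0 e1 e2 : Edge}
    (h01 : (e0, e1) ∈ cyc l) (h12 : (e1, e2) ∈ cyc l)
    (hm1 : e1.m = e2.m) (hlen : (wd e1).1 < (wd e2).1)
    (g1 : |e1.L - e2.L| ≤ |e0.L - e1.L|)
    (n02 : e0 ≠ e2) : False := by
  have c1 := crease_L hC G hM h01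
  have c2 := crease_L hC G hM h12
  have i02 := G.inj _ _ (cyc_mem h01).1 (cyc_mem h12).2
  simp only at i02
  have l1 := len_cases hC (cyc_mem h12).1
  have l0 := len_cases hC (cyc_mem h01).1
  have l2 := len_cases hC (cyc_mem h12).2
  simp only at l1 l2 l0
  have kl := G.l1 e0 e1 e2
  have kr := G.r1 e0 e1 e2
  have m0 := (cyc_mem h12).2
  simp only [CLof, CRof, btw] at kl kr m0
  cases hm : e2.m <;> rcases l1 with l1 | l1 <;> rw [hm] at hm1 <;> simp only [hm, hm1] at * <;>
    simp only [abs_le, le_abs] at g1 <;> grind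

end FC

set_option linter.unusedVariables false
set_option linter.unusedSimpArgs false
namespace FC

theorem cyc_get {α : Type} [Inhabited α] {l : List α} (h : l ≠ []) (i : ℕ) :
    (l[i % l.length]!, l[(i+1) % l.length]!) ∈ cyc l := by
  have hl : 0 < l.length := List.length_pos_iff.2 h
  have h1 : i % l.length < l.length := Nat.mod_lt _ hl
  have h2 : (i+1) % l.length < l.length := Nat.mod_lt _ hl
  rw [getElem!_pos l _ h1, getElem!_pos l _ h2]
  unfold cyc
  rw [List.mem_iff_getElem]
  refine ⟨i % l.length, by simpa using h1, ?_⟩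
  rw [List.getElem_zip, List.getElem_rotate]
  simp only [Prod.mk.injEq, true_and]
  congr 1
  rw [Nat.mod_add_mod]

instance : Inhabited Edge := ⟨⟨0, 0, 0, true⟩⟩

theorem get_ne {l : List Edge} (hn : l.Nodup) (h3 : 3 ≤ l.length) (i : ℕ) :
    l[i % l.length]! ≠ l[(i+2) % l.length]! := by
  have h1 : i % l.length < l.length := Nat.mod_lt _ (by omega)
  have h2 : (i+2) % l.length < l.length := Nat.mod_lt _ (by omega)
  rw [getElem!_pos l _ h1, getElem!_pos l _ h2]
  intro h
  rw [hn.getElem_inj_iff] at h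
  rw [Nat.add_mod] at h
  have : 2 % l.length = 2 := Nat.mod_eq_of_lt (by omega)
  rw [this] at h
  generalize i % l.length = r at h h1
  rcases lt_or_ge (r + 2) l.length with h5 | h5
  · rw [Nat.mod_eq_of_lt h5] at h; omega
  · rw [Nat.mod_eq_sub_mod h5, Nat.mod_eq_of_lt (by omega)] at h; omega

theorem lemB' {ε : ZMod 2} {l : List Edge} (hG : Good ε l) {k : ℕ} (hk : 1 ≤ k)
    (hkn : k + 2 ≤ l.length) {a b θ : ℝ} {c : Bool} (ha : θ < a) (hb : θ < b)
    (h0 : (wd l[0 % l.length]!).1 = a) (h1 : (wd l[(k+1) % l.length]!).1 = b)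
    (hm : ∀ i, 1 ≤ i → i ≤ k + 1 → (l[i % l.length]!).m = c)
    (hl : ∀ i, 1 ≤ i → i ≤ k → (wd l[i % l.length]!).1 = θ) : False := by
  obtain ⟨hn, hC, G, hM, _⟩ := hG
  have hne : l ≠ [] := by rintro rfl; simp at hkn
  obtain ⟨j, hj, hmin⟩ := Finset.exists_min_image (Finset.range (k+1))
    (fun i => |(l[i % l.length]!).L - (l[(i+1) % l.length]!).L|) ⟨0, by simp⟩
  simp only [Finset.mem_range] at hj hmin
  rcases Nat.eq_zero_or_pos j with rfl | hj0
  · exact lemY hC G hM (cyc_get hne 0) (cyc_get hne 1)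
      (by rw [hm 1 (by omega) (by omega), hm 2 (by omega) (by omega)])
      (by rw [h0, hl 1 (by omega) (by omega)]; exact ha) (hmin 1 (by omega)) (get_ne hn (by omega) 0)
  obtain ⟨i, rfl⟩ : ∃ i, j = i + 1 := ⟨j - 1, by omega⟩
  rcases eq_or_ne (i+1) k with rfl | hjk
  · exact lemY' hC G hM (cyc_get hne i) (cyc_get hne (i+1))
      (by rw [hm (i+1) (by omega) (by omega), hm (i+1+1) (by omega) (by omega)])
      (by rw [h1, hl (i+1) (by omega) (by omega)]; exact hb) (hmin i (by omega)) (get_ne hn (by omega) i)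
  · exact lemX hC G hM (cyc_get hne i) (cyc_get hne (i+1)) (cyc_get hne (i+1+1))
      (by rw [hm (i+1) (by omega) (by omega), hm (i+1+1) (by omega) (by omega)])
      (by rw [hm (i+1+1) (by omega) (by omega), hm (i+1+1+1) (by omega) (by omega)])
      (by rw [hl (i+1) (by omega) (by omega), hl (i+1+1) (by omega) (by omega)])
      (hmin i (by omega)) (hmin (i+1+1) (by omega))
      (get_ne hn (by omega) i) (get_ne hn (by omega) (i+1))

theorem lemC' {ε : ZMod 2} {l : List Edge} (hG : Good ε l) (hkn : 3 ≤ l.length) {θ : ℝ} {c : Bool}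
    (hm : ∀ e ∈ l, wd e = (θ, c)) : False := by
  obtain ⟨hn, hC, G, hM, _⟩ := hG
  have hne : l ≠ [] := by rintro rfl; simp at hkn
  have hw : ∀ i, wd l[i % l.length]! = (θ, c) := by
    intro i
    have h1 : i % l.length < l.length := Nat.mod_lt _ (by omega)
    rw [getElem!_pos l _ h1]
    exact hm _ (List.getElem_mem _)
  have hw1 : ∀ i, (wd l[i % l.length]!).1 = θ := fun i => by rw [hw]
  have hw2 : ∀ i, (l[i % l.length]!).m = c := fun i => congrArg Prod.snd (hw i)
  obtain ⟨j, hj, hmin⟩ := Finset.exists_min_image (Finset.range l.length)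
    (fun i => |(l[i % l.length]!).L - (l[(i+1) % l.length]!).L|) ⟨0, by simp; omega⟩
  have hmin' : ∀ i, |(l[j % l.length]!).L - (l[(j+1) % l.length]!).L| ≤
      |(l[i % l.length]!).L - (l[(i+1) % l.length]!).L| := by
    intro i
    have := hmin (i % l.length) (by simp; exact Nat.mod_lt _ (by omega))
    simp only [Nat.mod_mod, Nat.mod_add_mod] at this
    exact this
  have e0 : (j + (l.length - 1) + 1) % l.length = j % l.length := by
    rw [show j + (l.length - 1) + 1 = j + l.length by omega]; simp
  have e1 : (j + (l.length - 1) + 2) % l.length = (j + 1) % l.length := by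
    rw [show j + (l.length - 1) + 2 = (j + 1) + l.length by omega]; simp
  have c1 := cyc_get hne (j + (l.length - 1))
  have d1 := get_ne hn hkn (j + (l.length - 1))
  have m1 := hmin' (j + (l.length - 1))
  rw [e0] at c1 m1
  rw [e1] at d1
  exact lemX hC G hM c1 (cyc_get hne j) (cyc_get hne (j+1))
    (by rw [hw2, hw2]) (by rw [hw2, hw2]) (by rw [hw1, hw1]) m1 (hmin' (j+1)) d1 (get_ne hn hkn j)

theorem lemC {ε : ZMod 2} {w : List (ℝ × Bool)} (h3 : 3 ≤ w.length) {θ : ℝ} {c : Bool}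
    (hm : ∀ e ∈ w, e = (θ, c)) : ¬ FF ε w := by
  rintro ⟨l, rfl, hG⟩
  exact lemC' hG (by simpa using h3) (θ := θ) (c := c) (fun e he => hm _ (List.mem_map_of_mem he))

theorem lemB {ε : ZMod 2} {ms : List Bool} {rest : List (ℝ × Bool)} {a b θ : ℝ} {m0 c : Bool}
    (hk : ms ≠ []) (ha : θ < a) (hb : θ < b) (hm : ∀ x ∈ ms, x = c) :
    ¬ FF ε ((a, m0) :: (ms.map (fun x => (θ, x)) ++ (b, c) :: rest)) := by
  rintro ⟨l, hl, hG⟩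
  have hlen := congrArg List.length hl
  have hk' := List.length_pos_iff.2 hk
  simp at hlen
  have key : ∀ i (hi : i < l.length), wd l[i % l.length]! =
     ((a, m0) :: (ms.map (fun x => (θ, x)) ++ (b, c) :: rest))[i]'(by simp; omega) := by
    intro i hi
    rw [Nat.mod_eq_of_lt hi, getElem!_pos l _ hi]
    simp only [← hl, List.getElem_map]
  have hmid : ∀ i, 1 ≤ i → i ≤ ms.length → wd l[i % l.length]! = (θ, c) := by
    intro i h1 h2
    obtain ⟨i, rfl⟩ : ∃ j, i = j + 1 := ⟨i - 1, by omega⟩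
    rw [key _ (by omega), List.getElem_cons_succ, List.getElem_append_left (by simp; omega)]
    simp only [List.getElem_map]
    rw [hm _ (List.getElem_mem _)]
  have hend : wd l[(ms.length + 1) % l.length]! = (b, c) := by
    rw [key _ (by omega), List.getElem_cons_succ, List.getElem_append_right (by simp)]
    simp
  refine lemB' hG (k := ms.length) (by omega) (by omega) ha hb
    (by rw [key _ (by omega)]; rfl) (by rw [hend]) (c := c) ?_ ?_
  · intro i h1 h2
    rcases Nat.lt_or_ge ms.length i with h | h
    · obtain rfl : i = ms.length + 1 := by omega
      exact congrArg Prod.snd hend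
    · exact congrArg Prod.snd (hmid i h1 h)
  · intro i h1 h2
    rw [hmid i h1 h2]

end FC

set_option linter.unusedVariables false
set_option linter.unusedSimpArgs false
namespace FC

theorem adj_ne (cs : List Bool) : (∃ c, ∀ x ∈ cs, x = c) ∨
    ∃ P u v Q, cs = P ++ u :: v :: Q ∧ u ≠ v := by
  induction cs with
  | nil => left; exact ⟨true, by simp⟩
  | cons x t ih =>
    rcases ih with ⟨c, hc⟩ | ⟨P, u, v, Q, rfl, h⟩
    · cases t with
      | nil => left; exact ⟨x, by simp⟩
      | cons y t =>
        rcases eq_or_ne x y with rfl | hxy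
        · left; exact ⟨c, by simpa using hc⟩
        · right; exact ⟨[], x, y, t, rfl, hxy⟩
    · right; exact ⟨x :: P, u, v, Q, rfl, h⟩

theorem run_step {ε : ZMod 2} {a b θ : ℝ} (hθ : 0 < θ) (ha : θ < a) (hb : θ < b) {m0 mb : Bool}
    {rest : List (ℝ × Bool)} {ms P Q : List Bool} {u v : Bool} (hk : 2 ≤ ms.length)
    (hcs : ms ++ [mb] = P ++ u :: v :: Q) (huv : u ≠ v) :
    ∃ ms' mb', ms' ++ [mb'] = P ++ Q ∧
      (FF ε ((a, m0) :: (ms.map (fun x => (θ, x)) ++ (b, mb) :: rest)) ↔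
       FF ε ((a, m0) :: (ms'.map (fun x => (θ, x)) ++ (b, mb') :: rest))) := by
  rcases List.eq_nil_or_concat Q with rfl | ⟨Q', y, rfl⟩
  · -- pair at the end
    have h1 : ms ++ [mb] = (P ++ [u]) ++ [v] := by rw [hcs]; simp
    obtain ⟨rfl, h2⟩ := List.append_inj' h1 rfl
    simp only [List.cons.injEq, and_true] at h2
    subst h2
    rcases List.eq_nil_or_concat P with rfl | ⟨P', p, rfl⟩
    · simp at hk
    · refine ⟨P', p, by simp, ?_⟩
      have := crimp (ε := ε) (p := θ) (q := b) (m := p) ((a, m0) :: P'.map (fun x => (θ, x))) rest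
        hθ le_rfl hb.le huv
      simpa using this
  · have h1 : ms ++ [mb] = (P ++ u :: v :: Q') ++ [y] := by rw [hcs]; simp
    obtain ⟨rfl, h2⟩ := List.append_inj' h1 rfl
    simp only [List.cons.injEq, and_true] at h2
    subst h2
    refine ⟨P ++ Q', mb, by simp, ?_⟩
    rcases List.eq_nil_or_concat P with rfl | ⟨P', p, rfl⟩
    · have := crimp (ε := ε) (p := a) (q := θ) (m := m0) [] (Q'.map (fun x => (θ, x)) ++ (b, mb) :: rest)
        hθ ha.le le_rfl huv
      simpa using this
    · have := crimp (ε := ε) (p := θ) (q := θ) (m := p) ((a, m0) :: P'.map (fun x => (θ, x)))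
        (Q'.map (fun x => (θ, x)) ++ (b, mb) :: rest) hθ le_rfl le_rfl huv
      simpa using this

theorem count_pair {P Q : List Bool} {u v : Bool} (huv : u ≠ v) :
    (P ++ u :: v :: Q).count true = (P ++ Q).count true + 1 := by
  cases u <;> cases v <;> simp at huv ⊢ <;> omega

theorem count_all {cs : List Bool} {c : Bool} (h : ∀ x ∈ cs, x = c) :
    cs.count true = if c then cs.length else 0 := by
  have : cs = List.replicate cs.length c := List.eq_replicate_iff.2 ⟨rfl, h⟩
  rw [this]; cases c <;> simp [List.count_replicate]

theorem run_odd {ε : ZMod 2} {a b θ : ℝ} (hθ : 0 < θ) (ha : θ < a) (hb : θ < b)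
    {rest : List (ℝ × Bool)} {m0 : Bool} (j : ℕ) : ∀ (mb : Bool) (ms : List Bool)
    (hk : ms.length = 2 * j + 1),
    (FF ε ((a, m0) :: (ms.map (fun x => (θ, x)) ++ (b, mb) :: rest)) ↔
      (ms ++ [mb]).count true = j + 1 ∧ FF ε ((a - θ + b, m0) :: rest)) := by
  induction j with
  | zero =>
    intro mb ms hk
    obtain ⟨u, rfl⟩ := List.length_eq_one_iff.1 hk
    rcases eq_or_ne u mb with rfl | h
    · have := lemB (ε := ε) (ms := [u]) (rest := rest) (m0 := m0) (c := u) (by simp) ha hb (by simp)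
      simp only [this, false_iff, not_and]
      intro h; exfalso; cases u <;> simp at h
    · have := crimp (ε := ε) (p := a) (q := b) (m := m0) [] rest hθ ha.le hb.le h
      simp only [List.map_cons, List.map_nil, List.nil_append, List.cons_append] at this ⊢
      rw [this]
      have h2 := count_pair (P := []) (Q := []) h
      simp only [List.nil_append] at h2
      rw [h2]; simp
  | succ j ih =>
    intro mb ms hk
    rcases adj_ne (ms ++ [mb]) with ⟨c, hc⟩ | ⟨P, u, v, Q, hcs, huv⟩
    · obtain rfl : mb = c := hc mb (by simp)
      have := lemB (ε := ε) (ms := ms) (rest := rest) (m0 := m0) (c := mb)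
        (by rintro rfl; simp at hk) ha hb (fun x hx => hc x (by simp [hx]))
      simp only [this, false_iff, not_and]
      intro h; rw [count_all hc] at h; exfalso
      cases mb <;> simp at h; omega
    · obtain ⟨ms', mb', h1, h2⟩ := run_step (ε := ε) (rest := rest) (m0 := m0) hθ ha hb (by omega) hcs huv
      have hlen := congrArg List.length hcs
      have hlen' := congrArg List.length h1
      simp at hlen hlen'
      rw [h2, ih mb' ms' (by omega), hcs, count_pair huv, h1]
      simp

theorem run_even {ε : ZMod 2} {a b θ : ℝ} (hθ : 0 < θ) (ha : θ < a) (hb : θ < b)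
    {rest : List (ℝ × Bool)} {m0 : Bool} (j : ℕ) : ∀ (mb : Bool) (ms : List Bool)
    (hk : ms.length = 2 * j),
    (FF ε ((a, m0) :: (ms.map (fun x => (θ, x)) ++ (b, mb) :: rest)) ↔
      ∃ w : Bool, (ms ++ [mb]).count true = j + w.toNat ∧ FF ε ((a, m0) :: (b, w) :: rest)) := by
  induction j with
  | zero =>
    intro mb ms hk
    obtain rfl := List.length_eq_zero_iff.1 hk
    simp only [List.map_nil, List.nil_append]
    constructor
    · intro h; exact ⟨mb, by cases mb <;> simp, h⟩
    · rintro ⟨w, h1, h2⟩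
      have : mb = w := by cases mb <;> cases w <;> simp at h1 ⊢
      rw [this]; exact h2
  | succ j ih =>
    intro mb ms hk
    rcases adj_ne (ms ++ [mb]) with ⟨c, hc⟩ | ⟨P, u, v, Q, hcs, huv⟩
    · obtain rfl : mb = c := hc mb (by simp)
      have := lemB (ε := ε) (ms := ms) (rest := rest) (m0 := m0) (c := mb)
        (by rintro rfl; simp at hk) ha hb (fun x hx => hc x (by simp [hx]))
      simp only [this, false_iff, not_exists, not_and]
      intro w h; rw [count_all hc] at h; exfalso
      cases mb <;> cases w <;> simp at h <;> omega
    · obtain ⟨ms', mb', h1, h2⟩ := run_step (ε := ε) (rest := rest) (m0 := m0) hθ ha hb (by omega) hcs huv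
      have hlen := congrArg List.length hcs
      have hlen' := congrArg List.length h1
      simp at hlen hlen'
      rw [h2, ih mb' ms' (by omega), hcs, count_pair huv, h1]
      apply exists_congr; intro w
      apply and_congr_left'
      omega

end FC

set_option linter.unusedVariables false
set_option linter.unusedSimpArgs false
namespace FC

theorem FF2_fwd {ε : ZMod 2} {θ : ℝ} {u v : Bool} (h : FF ε [(θ, u), (θ, v)]) :
    [u, v].count true = 2 * ε.val := by
  obtain ⟨e, l, he, hl, hG, hr⟩ := FF_right h
  have hJ := hG.J (p := e) (by simp)
  obtain ⟨hn, hC, G, hM, _⟩ := hG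
  rcases l with _ | ⟨f, _ | _⟩
  · simp at hl
  swap
  · simp at hl
  simp only [List.map_cons, List.map_nil, List.cons.injEq, and_true] at hl
  have hcy : cyc [e, f] = [(e, f), (f, e)] := by simp [cyc_cons]
  have M1 := hM (e, f) (by simp [hcy])
  have M2 := hM (f, e) (by simp [hcy])
  have C1 := hC (e, f) (by simp [hcy])
  have C2 := hC (f, e) (by simp [hcy])
  have hu : e.m = u := congrArg Prod.snd he
  have hv : f.m = v := congrArg Prod.snd hl
  have hne : e ≠ f := by simpa using hn
  have hLL : e.L ≠ f.L := fun h => hne (G.inj _ _ (by simp) (by simp) h)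
  simp only [hu, hv] at M1 M2 C1 C2
  have e1 : e.lo = e.a := min_eq_left hr.le
  have e2 : e.hi = e.b := max_eq_right hr.le
  have hf : f.b < f.a := by rcases C1.2 with h | h; exact h.2; linarith [h.1]
  have e3 : f.lo = f.b := min_eq_right hf.le
  have e4 : f.hi = f.a := max_eq_left hf.le
  have hnf : ¬ f.a < f.b := not_lt.2 hf.le
  simp only [hr, hnf, true_iff, false_iff, not_not] at M1 M2
  simp only [Jv, NH, List.map_cons, List.map_nil, List.sum_cons, List.sum_nil, e1, e2, e3, e4, ind, hr,
    if_true, lt_irrefl, false_and, if_false, zero_add, add_zero] at hJ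
  rcases lt_or_gt_of_ne hLL with h1 | h1
  · rw [if_pos ⟨h1, by linarith [C1.1], by linarith [C1.1]⟩] at hJ
    have : ε = 0 := by rw [← hJ]; decide
    subst this
    have a1 : u ≠ true := fun h => absurd (M2.1 h) (not_lt.2 h1.le)
    have a2 : v ≠ true := fun h => (M1.1 h) h1
    simp at a1 a2
    simp [a1, a2]
  · rw [if_neg (fun h => absurd h.1 (not_lt.2 h1.le))] at hJ
    have : ε = 1 := by rw [← hJ]; decide
    subst this
    have a1 : u = true := M2.2 h1
    have a2 : v = true := M1.2 (not_lt.2 h1.le)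
    rw [a1, a2]; simp [ZMod.val_one]

theorem FF2_bwd1 {θ : ℝ} (hθ : 0 < θ) : FF 1 [(θ, true), (θ, true)] := by
  obtain ⟨e, he⟩ : ∃ e : Edge, e = ⟨0, θ, 1, true⟩ := ⟨_, rfl⟩
  obtain ⟨f, hf⟩ : ∃ e : Edge, e = ⟨θ, 0, 0, true⟩ := ⟨_, rfl⟩
  have hcy : cyc [e, f] = [(e, f), (f, e)] := by simp [cyc_cons]
  have e1 : e.lo = 0 := by subst he; exact min_eq_left hθ.le
  have e2 : e.hi = θ := by subst he; exact max_eq_right hθ.le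
  have e3 : f.lo = 0 := by subst hf; exact min_eq_right hθ.le
  have e4 : f.hi = θ := by subst hf; exact max_eq_left hθ.le
  have ea : e.a = 0 := by rw [he]
  have eb : e.b = θ := by rw [he]
  have eL : e.L = 1 := by rw [he]
  have em : e.m = true := by rw [he]
  have fa : f.a = θ := by rw [hf]
  have fb : f.b = 0 := by rw [hf]
  have fL : f.L = 0 := by rw [hf]
  have fm : f.m = true := by rw [hf]
  have hne : e ≠ f := fun h => by rw [h, fL] at eL; norm_num at eL
  clear he hf
  refine ⟨[e, f], ?_, ?_, ?_, ?_, ?_, e, by simp, ?_⟩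
  · simp [wd, ea, eb, fa, fb, em, fm, abs_of_pos hθ]
  · simpa using hne
  · intro c hc
    rw [hcy] at hc
    simp at hc
    rcases hc with rfl | rfl <;> simp only <;> grind
  · constructor
    all_goals simp only [CLof, CRof, hcy, List.mem_cons, List.not_mem_nil, or_false, Prod.mk.injEq, btw]
    all_goals grind
  · intro c hc
    rw [hcy] at hc
    simp at hc
    rcases hc with rfl | rfl <;> simp only <;> grind
  · simp only [Jv, NH, List.map_cons, List.map_nil, List.sum_cons, List.sum_nil, e1, e2, e3, e4, ind,
      ea, eb, eL, fL]
    norm_num [hθ]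

theorem FF2 {ε : ZMod 2} {θ : ℝ} (hθ : 0 < θ) {u v : Bool} :
    FF ε [(θ, u), (θ, v)] ↔ [u, v].count true = 2 * ε.val := by
  refine ⟨FF2_fwd, fun h => ?_⟩
  have h1 := FF2_bwd1 hθ
  have h0 := (FF_ng (ε := 1)).2 h1
  fin_cases ε
  · have : u = false ∧ v = false := by cases u <;> cases v <;> revert h <;> decide
    obtain ⟨rfl, rfl⟩ := this
    exact h0
  · have : u = true ∧ v = true := by cases u <;> cases v <;> revert h <;> decide
    obtain ⟨rfl, rfl⟩ := this
    exact h1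

theorem all_eq {ε : ZMod 2} {θ : ℝ} (hθ : 0 < θ) (j : ℕ) : ∀ cs : List Bool, cs.length = 2 * j + 2 →
    (FF ε (cs.map fun x => (θ, x)) ↔ cs.count true = j + 2 * ε.val) := by
  induction j with
  | zero =>
    intro cs hc
    obtain ⟨u, v, rfl⟩ := List.length_eq_two.1 hc
    rw [zero_add, ← FF2 hθ]; rfl
  | succ j ih =>
    intro cs hc
    rcases adj_ne cs with ⟨c, hcc⟩ | ⟨P, u, v, Q, rfl, huv⟩
    · have := lemC (ε := ε) (w := cs.map fun x => (θ, x)) (θ := θ) (c := c) (by simp; omega) (by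
        intro e he
        obtain ⟨x, hx, rfl⟩ := List.mem_map.1 he
        rw [hcc x hx])
      simp only [this, false_iff]
      intro h; rw [count_all hcc] at h
      have h2 := ZMod.val_lt ε
      cases c <;> simp at h <;> omega
    · rw [count_pair huv]
      have hlen : (P ++ Q).length = 2 * j + 2 := by simp at hc ⊢; omega
      have key : FF ε ((P ++ u :: v :: Q).map fun x => (θ, x)) ↔ FF ε ((P ++ Q).map fun x => (θ, x)) := by
        rw [List.map_append, FF_append, List.map_append, FF_append (P.map _)]
        rw [← List.map_append, ← List.map_append]
        have hR : (Q ++ P) ≠ [] := by intro h; have := congrArg List.length h; rw [List.length_append] at this hlen; simp only [List.length_nil] at this; omega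
        rw [List.cons_append, List.cons_append]
        rcases List.eq_nil_or_concat (Q ++ P) with h | ⟨R, p, h⟩
        · exact absurd h hR
        rw [h]
        have e1 : FF ε ((u :: v :: (R ++ [p])).map fun x => (θ, x)) ↔
            FF ε ([(θ, p)] ++ (θ, u) :: (θ, v) :: R.map fun x => (θ, x)) := by
          rw [FF_append]; simp
        have e2 : FF ε ((R ++ [p]).map fun x => (θ, x)) ↔ FF ε ([(θ, p)] ++ R.map fun x => (θ, x)) := by
          rw [FF_append]; simp
        have := crimp (ε := ε) (p := θ) (q := θ) (m := p) [] (R.map fun x => (θ, x)) hθ le_rfl le_rfl huv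
        simp only [List.concat_eq_append]
        rw [e1, e2]
        simpa using this
      rw [key, ih _ hlen]
      omega

end FC

set_option linter.unusedVariables false
set_option linter.unusedSimpArgs false
namespace FC

def alt : List (ℝ × ℕ) → ℝ
  | [] => 0
  | x :: l => x.1 - alt l

theorem alt_append (s t : List (ℝ × ℕ)) : alt (s ++ t) = alt s + (-1) ^ s.length * alt t := by
  induction s with
  | nil => simp [alt]
  | cons x s ih => simp only [List.cons_append, alt, ih, List.length_cons, pow_succ]; ring

structure Inv (M : ℕ) (l : List (ℝ × ℕ)) : Prop where
  nd : (l.map Prod.snd).Nodup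
  lt : ∀ x ∈ l, x.2 < M
  pos : ∀ x ∈ l, 0 < x.1
  alt0 : alt l = 0
  ev : Even l.length
  two : 2 ≤ l.length

theorem Inv.swap {M : ℕ} {s t : List (ℝ × ℕ)} (h : Inv M (s ++ t)) : Inv M (t ++ s) where
  nd := (List.perm_append_comm.map _).nodup_iff.1 h.nd
  lt x hx := h.lt x (by simp at hx ⊢; tauto)
  pos x hx := h.pos x (by simp at hx ⊢; tauto)
  alt0 := by
    have h0 := h.alt0
    have h1 := h.ev
    rw [List.length_append, Nat.even_add] at h1
    rw [alt_append] at h0 ⊢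
    rcases Nat.even_or_odd t.length with h2 | h2
    · rw [(h1.2 h2).neg_one_pow] at h0; rw [h2.neg_one_pow]; linarith
    · have h3 : Odd s.length := by rw [← Nat.not_even_iff_odd] at h2 ⊢; tauto
      rw [h3.neg_one_pow] at h0; rw [h2.neg_one_pow]; linarith
  ev := by have := h.ev; rw [List.length_append] at this ⊢; rwa [add_comm]
  two := by have := h.two; rw [List.length_append] at this ⊢; omega

def wv (β : ℕ → Bool) (l : List (ℝ × ℕ)) : List (ℝ × Bool) := l.map fun x => (x.1, β x.2)

def Csp (ε : ZMod 2) (M : ℕ) (l : List (ℝ × ℕ)) : Prop :=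
  ∃ cl : List (Finset ℕ × ℕ), cl.length + 1 ≤ l.length ∧
    (∀ c ∈ cl, ∀ v ∈ c.1, (v < M → v ∈ l.map Prod.snd) ∧ v < M + l.length) ∧
    (∀ v < M, cl.countP (fun c => decide (v ∈ c.1)) ≤ 1) ∧
    (∀ v, M ≤ v → cl.countP (fun c => decide (v ∈ c.1)) ≤ 2) ∧
    ∀ β : ℕ → Bool, FF ε (wv β l) ↔ ∃ b : ℕ → Bool, (∀ v < M, b v = β v) ∧
      ∀ c ∈ cl, (c.1.filter fun v => b v = true).card = c.2

theorem Csp.swap {ε : ZMod 2} {M : ℕ} {s t : List (ℝ × ℕ)} (h : Csp ε M (t ++ s)) : Csp ε M (s ++ t) := by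
  obtain ⟨cl, h1, h2, h3, h4, h5⟩ := h
  refine ⟨cl, ?_, ?_, h3, h4, ?_⟩
  · rw [List.length_append] at h1 ⊢; omega
  · intro c hc v hv
    have := h2 c hc v hv
    rw [List.length_append, List.map_append, List.mem_append] at this ⊢
    rw [add_comm s.length]; exact ⟨fun h => (this.1 h).symm, this.2⟩
  · intro β
    rw [← h5 β, wv, wv, List.map_append, List.map_append, FF_append]

/-- split at first non-min -/
theorem span_run {θ : ℝ} {z : ℝ × ℕ} (hz : θ < z.1) : ∀ p : List (ℝ × ℕ), (∀ x ∈ p, θ ≤ x.1) →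
    ∃ run b B, p ++ [z] = run ++ b :: B ∧ (∀ x ∈ run, x.1 = θ) ∧ θ < b.1 := by
  intro p
  induction p with
  | nil => intro _; exact ⟨[], z, [], rfl, by simp, hz⟩
  | cons y p ih =>
    intro h
    rcases eq_or_lt_of_le (h y (by simp)) with h1 | h1
    · obtain ⟨run, b, B, e, h2, h3⟩ := ih (fun x hx => h x (by simp [hx]))
      refine ⟨y :: run, b, B, by simp [e], ?_, h3⟩
      intro x hx; rcases List.mem_cons.1 hx with rfl | hx
      · exact h1.symm
      · exact h2 x hx
    · exact ⟨[], y, p ++ [z], rfl, by simp, h1⟩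

theorem seg_run {θ : ℝ} {z : ℝ × ℕ} (hz : θ < z.1) : ∀ (p : List (ℝ × ℕ)) (x : ℝ × ℕ), θ < x.1 →
    (∀ x ∈ p, θ ≤ x.1) → (∃ y ∈ p, y.1 = θ) →
    ∃ A a run b B, x :: (p ++ [z]) = A ++ a :: (run ++ b :: B) ∧ run ≠ [] ∧
      (∀ x ∈ run, x.1 = θ) ∧ θ < a.1 ∧ θ < b.1 := by
  intro p
  induction p with
  | nil => intro x _ _ h; simp at h
  | cons y p ih =>
    intro x hx h hy
    rcases eq_or_lt_of_le (h y (by simp)) with h1 | h1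
    · obtain ⟨run, b, B, e, h2, h3⟩ := span_run hz p (fun x hx => h x (by simp [hx]))
      refine ⟨[], x, y :: run, b, B, by simp [e], by simp, ?_, hx, h3⟩
      intro x hx; rcases List.mem_cons.1 hx with rfl | hx
      · exact h1.symm
      · exact h2 x hx
    · have hy' : ∃ y ∈ p, y.1 = θ := by
        obtain ⟨w, hw, hw2⟩ := hy
        rcases List.mem_cons.1 hw with rfl | hw
        · linarith
        · exact ⟨w, hw, hw2⟩
      obtain ⟨A, a, run, b, B, e, r⟩ := ih y h1 (fun x hx => h x (by simp [hx])) hy'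
      exact ⟨x :: A, a, run, b, B, by simp [e], r⟩

theorem alt_even {θ : ℝ} (j : ℕ) : ∀ (run t : List (ℝ × ℕ)), (∀ x ∈ run, x.1 = θ) →
    run.length = 2 * j → alt (run ++ t) = alt t := by
  induction j with
  | zero => intro run t _ h; obtain rfl := List.length_eq_zero_iff.1 h; rfl
  | succ j ih =>
    intro run t h hl
    rcases run with _ | ⟨x, _ | ⟨y, run⟩⟩
    · simp at hl
    · simp at hl; omega
    · simp only [List.cons_append, alt, ih run t (fun x hx => h x (by simp [hx])) (by simp at hl; omega)]
      rw [h x (by simp), h y (by simp)]; ring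

theorem alt_odd {θ : ℝ} (j : ℕ) (run t : List (ℝ × ℕ)) (h : ∀ x ∈ run, x.1 = θ)
    (hl : run.length = 2 * j + 1) : alt (run ++ t) = θ - alt t := by
  rcases run with _ | ⟨x, run⟩
  · simp at hl
  · simp only [List.cons_append, alt, alt_even j run t (fun x hx => h x (by simp [hx])) (by simpa using hl)]
    rw [h x (by simp)]

/-- decomposition of a non-constant cycle -/
theorem decomp {M : ℕ} {l : List (ℝ × ℕ)} (h : Inv M l) :
    (∃ θ, 0 < θ ∧ ∀ x ∈ l, x.1 = θ) ∨
    ∃ θ s t a run b R, 0 < θ ∧ l = s ++ t ∧ t ++ s = a :: (run ++ b :: R) ∧ run ≠ [] ∧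
      (∀ x ∈ run, x.1 = θ) ∧ θ < a.1 ∧ θ < b.1 := by
  have hne : l ≠ [] := by rintro rfl; have := h.two; simp at this
  obtain ⟨y, hy, hmin⟩ := Finset.exists_min_image l.toFinset Prod.fst
    (by simpa using hne)
  simp only [List.mem_toFinset] at hy hmin
  by_cases hall : ∀ x ∈ l, x.1 = y.1
  · left; exact ⟨y.1, h.pos y hy, hall⟩
  right
  push Not at hall
  obtain ⟨x, hx, hxy⟩ := hall
  have hxy : y.1 < x.1 := lt_of_le_of_ne (hmin x hx) hxy.symm
  obtain ⟨l1, l2, rfl⟩ := List.append_of_mem hx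
  -- rotate
  have h' := h.swap
  have hz : ∃ z ∈ l2 ++ l1, y.1 < z.1 := by
    by_contra hcon
    push Not at hcon
    have hc : ∀ z ∈ l2 ++ l1, z.1 = y.1 := fun z hz => le_antisymm (hcon z hz) (hmin z (by simp at hz ⊢; tauto))
    have h0 := h'.alt0
    have h1 := h'.ev
    rw [List.cons_append] at h0 h1
    obtain ⟨j, hj⟩ := h1
    have h2 := alt_odd (j - 1) (l2 ++ l1) [] hc (by simp at hj ⊢; omega)
    simp only [alt, List.append_nil] at h0 h2
    linarith
  have hy' : y ∈ l2 ++ l1 := by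
    have : y ≠ x := by rintro rfl; exact lt_irrefl _ hxy
    simp at hy ⊢; tauto
  have hmin' : ∀ z ∈ l2 ++ l1, y.1 ≤ z.1 := fun z hz => hmin z (by simp at hz ⊢; tauto)
  obtain ⟨z, hz, hyz⟩ := hz
  obtain ⟨p, q, hpq⟩ := List.append_of_mem hz
  rw [hpq] at hy' hmin'
  -- l1 ++ x :: l2 rotated to x :: p ++ z :: q
  have main : ∃ A a run b B C, (A ++ a :: (run ++ b :: B)) ++ C ~r l1 ++ x :: l2 ∧ run ≠ [] ∧
      (∀ x ∈ run, x.1 = y.1) ∧ y.1 < a.1 ∧ y.1 < b.1 := by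
    have r1 : x :: (p ++ z :: q) ~r l1 ++ x :: l2 := by
      rw [← hpq, ← List.cons_append]; exact List.isRotated_append
    have hyz' : y ≠ z := by rintro rfl; exact lt_irrefl _ hyz
    have hy2 : y ∈ p ∨ y ∈ q := by simp at hy'; tauto
    rcases hy2 with hy2 | hy2
    · obtain ⟨A, a, run, b, B, e, r⟩ := seg_run hyz p x hxy (fun x hx => hmin' x (by simp [hx])) ⟨y, hy2, rfl⟩
      refine ⟨A, a, run, b, B, q, ?_, r⟩
      rw [← e]; simpa using r1
    · obtain ⟨A, a, run, b, B, e, r⟩ := seg_run hxy q z hyz (fun x hx => hmin' x (by simp [hx])) ⟨y, hy2, rfl⟩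
      refine ⟨A, a, run, b, B, p, ?_, r⟩
      rw [← e]
      refine List.IsRotated.trans ?_ r1
      have : z :: (q ++ [x]) ++ p = (z :: q) ++ (x :: p) := by simp
      rw [this, ← List.cons_append]
      exact List.isRotated_append
  obtain ⟨A, a, run, b, B, C, hr, h1, h2, h3, h4⟩ := main
  have hr2 : l1 ++ x :: l2 ~r a :: (run ++ b :: (B ++ C ++ A)) := by
    refine hr.symm.trans ?_
    have : a :: (run ++ b :: (B ++ C ++ A)) = (a :: (run ++ b :: B) ++ C) ++ A := by simp
    rw [this, List.append_assoc]; exact List.isRotated_append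
  obtain ⟨k, hk⟩ := hr2
  have hk' := List.rotate_eq_drop_append_take_mod (l := l1 ++ x :: l2) (n := k)
  rw [hk] at hk'
  exact ⟨y.1, _, _, a, run, b, B ++ C ++ A, h.pos y hy, (List.take_append_drop (k % (l1 ++ x :: l2).length) _).symm,
    hk'.symm, h1, h2, h3, h4⟩

end FC

set_option linter.unusedVariables false
set_option linter.unusedSimpArgs false
namespace FC

theorem card_filter_list {vs : List ℕ} (h : vs.Nodup) (b : ℕ → Bool) :
    (vs.toFinset.filter fun v => b v = true).card = (vs.map b).count true := by
  induction vs with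
  | nil => simp
  | cons x t ih =>
    rw [List.nodup_cons] at h
    rw [List.toFinset_cons, Finset.filter_insert, List.map_cons, List.count_cons, ← ih h.2]
    cases hb : b x
    · simp
    · simp [h.1]

theorem wv_congr {β b : ℕ → Bool} {l : List (ℝ × ℕ)} (h : ∀ x ∈ l, b x.2 = β x.2) : wv b l = wv β l := by
  apply List.map_congr_left
  intro x hx; rw [h x hx]

theorem wv_const {θ : ℝ} {l : List (ℝ × ℕ)} (h : ∀ x ∈ l, x.1 = θ) (β : ℕ → Bool) :
    wv β l = ((l.map Prod.snd).map β).map fun x => (θ, x) := by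
  unfold wv
  rw [List.map_map, List.map_map]
  apply List.map_congr_left
  intro x hx; simp [h x hx]

theorem csp_const {ε : ZMod 2} {M : ℕ} {l : List (ℝ × ℕ)} (h : Inv M l) {θ : ℝ} (hθ : 0 < θ)
    (hl : ∀ x ∈ l, x.1 = θ) : Csp ε M l := by
  obtain ⟨j, hj⟩ := h.ev
  have h2 := h.two
  refine ⟨[((l.map Prod.snd).toFinset, j - 1 + 2 * ε.val)], by simp; omega, ?_, ?_, ?_, ?_⟩
  · intro c hc v hv
    simp only [List.mem_singleton] at hc
    subst hc
    simp only [List.mem_toFinset] at hv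
    refine ⟨fun _ => hv, ?_⟩
    obtain ⟨x, hx, rfl⟩ := List.mem_map.1 hv
    have := h.lt x hx; omega
  · intro v hv; refine List.countP_le_length.trans (by simp)
  · intro v hv; refine List.countP_le_length.trans (by simp)
  · intro β
    rw [wv_const hl, all_eq hθ (j - 1) _ (by simp; omega)]
    simp only [List.mem_singleton, forall_eq, card_filter_list h.nd]
    constructor
    · intro h; exact ⟨β, fun _ _ => rfl, h⟩
    · rintro ⟨b, h1, h2⟩
      rw [← h2]; congr 1
      rw [List.map_map, List.map_map]
      apply List.map_congr_left
      intro x hx; exact (h1 _ (h.lt x hx)).symm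

/-- variables of the run -/
theorem wv_run {θ : ℝ} {a b : ℝ × ℕ} {run R : List (ℝ × ℕ)} (hr : ∀ x ∈ run, x.1 = θ) (β : ℕ → Bool) :
    wv β (a :: (run ++ b :: R)) = (a.1, β a.2) :: (((run.map Prod.snd).map β).map (fun x => (θ, x)) ++
      (b.1, β b.2) :: wv β R) := by
  have := wv_const hr β
  unfold wv at *
  rw [List.map_cons, List.map_append, this, List.map_cons]

theorem csp_odd {ε : ZMod 2} {M : ℕ} {θ : ℝ} {a b : ℝ × ℕ} {run R : List (ℝ × ℕ)} (hθ : 0 < θ)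
    (ha : θ < a.1) (hb : θ < b.1) (hr : ∀ x ∈ run, x.1 = θ) {j : ℕ} (hj : run.length = 2 * j + 1)
    (hI : Inv M (a :: (run ++ b :: R)))
    (ih : Inv M ((a.1 - θ + b.1, a.2) :: R) → Csp ε M ((a.1 - θ + b.1, a.2) :: R)) :
    Csp ε M (a :: (run ++ b :: R)) := by
  have nd := hI.nd
  have lt := hI.lt
  simp only [List.map_cons, List.map_append] at nd
  have hsub : ((a.2 :: R.map Prod.snd)).Sublist (a.2 :: (run.map Prod.snd ++ b.2 :: R.map Prod.snd)) :=
    ((List.sublist_cons_self _ _).trans (List.sublist_append_right _ _)).cons_cons _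
  have hI' : Inv M ((a.1 - θ + b.1, a.2) :: R) := by
    refine ⟨?_, ?_, ?_, ?_, ?_, ?_⟩
    · simp only [List.map_cons]; exact nd.sublist hsub
    · intro x hx; rcases List.mem_cons.1 hx with rfl | hx
      · exact lt a (by simp)
      · exact lt x (by simp [hx])
    · intro x hx; rcases List.mem_cons.1 hx with rfl | hx
      · simp only; linarith
      · exact hI.pos x (by simp [hx])
    · have := hI.alt0
      simp only [alt, alt_odd j run (b :: R) hr hj] at this ⊢
      linarith
    · have := hI.ev
      simp only [List.length_cons, List.length_append, hj, Nat.even_iff] at this ⊢; omega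
    · have := hI.ev
      simp only [List.length_cons, List.length_append, hj, Nat.even_iff] at this ⊢; omega
  obtain ⟨cl, h1, h2, h3, h4, h5⟩ := ih hI'
  have ndV : (run.map Prod.snd ++ [b.2]).Nodup := by
    refine nd.sublist (List.Sublist.cons _ ?_)
    exact (List.Sublist.refl _).append (by simp)
  have hdis : ∀ v ∈ run.map Prod.snd ++ [b.2], v ∉ a.2 :: R.map Prod.snd := by
    grind
  have hVlt : ∀ v ∈ run.map Prod.snd ++ [b.2], v < M := by
    intro v hv
    rw [List.mem_append, List.mem_map, List.mem_singleton] at hv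
    rcases hv with ⟨x, hx, rfl⟩ | rfl
    · exact lt x (by simp [hx])
    · exact lt b (by simp)
  refine ⟨((run.map Prod.snd ++ [b.2]).toFinset, j + 1) :: cl, ?_, ?_, ?_, ?_, ?_⟩
  · simp only [List.length_cons, List.length_append] at h1 ⊢; omega
  · intro c hc v hv
    rcases List.mem_cons.1 hc with rfl | hc
    · rw [List.mem_toFinset] at hv
      have := hVlt v hv
      refine ⟨fun _ => ?_, by omega⟩
      simp only [List.map_cons, List.map_append] at hv ⊢
      simp only [List.mem_append, List.mem_cons, List.not_mem_nil, or_false] at hv ⊢; tauto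
    · obtain ⟨h6, h7⟩ := h2 c hc v hv
      simp only [List.length_cons, List.length_append] at h7 ⊢
      refine ⟨fun h => ?_, by omega⟩
      have := h6 h
      simp only [List.map_cons, List.map_append] at this ⊢
      simp only [List.mem_append, List.mem_cons] at this ⊢; tauto
  · intro v hv
    rw [List.countP_cons]
    by_cases hvV : v ∈ run.map Prod.snd ++ [b.2]
    · have : cl.countP (fun c => decide (v ∈ c.1)) = 0 := by
        rw [List.countP_eq_zero]
        intro c hc
        simp only [decide_eq_true_eq]
        intro hvc
        have := (h2 c hc v hvc).1 hv
        simp only [List.map_cons] at this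
        exact hdis v hvV this
      rw [this]; split_ifs <;> simp
    · rw [if_neg (by rw [decide_eq_true_eq, List.mem_toFinset]; exact hvV)]; exact h3 v hv
  · intro v hv
    rw [List.countP_cons]
    have : v ∉ run.map Prod.snd ++ [b.2] := fun h => absurd (hVlt v h) (not_lt.2 hv)
    rw [if_neg (by rw [decide_eq_true_eq, List.mem_toFinset]; exact this)]; exact h4 v hv
  · intro β
    rw [wv_run hr, run_odd hθ ha hb j _ _ (by simpa using hj)]
    have e := h5 β
    have e2 : wv β ((a.1 - θ + b.1, a.2) :: R) = (a.1 - θ + b.1, β a.2) :: wv β R := rfl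
    rw [e2] at e
    rw [e]
    have e3 : (run.map Prod.snd).map β ++ [β b.2] = (run.map Prod.snd ++ [b.2]).map β := by simp
    rw [e3]
    have cc : ∀ b' : ℕ → Bool, (∀ v < M, b' v = β v) →
       (run.map Prod.snd ++ [b.2]).map b' = (run.map Prod.snd ++ [b.2]).map β := by
      intro b' hb'
      apply List.map_congr_left
      intro v hv; exact hb' v (hVlt v hv)
    constructor
    · rintro ⟨h6, b', h7, h8⟩
      refine ⟨b', h7, ?_⟩
      intro c hc
      rcases List.mem_cons.1 hc with rfl | hc
      · simp only; rw [card_filter_list ndV, cc b' h7, h6]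
      · exact h8 c hc
    · rintro ⟨b', h7, h8⟩
      refine ⟨?_, b', h7, fun c hc => h8 c (by simp [hc])⟩
      have := h8 _ (List.mem_cons_self)
      simp only at this
      rw [card_filter_list ndV, cc b' h7] at this
      exact this

end FC

set_option linter.unusedVariables false
set_option linter.unusedSimpArgs false
namespace FC

theorem csp_even {ε : ZMod 2} {M : ℕ} {θ : ℝ} {a b : ℝ × ℕ} {run R : List (ℝ × ℕ)} (hθ : 0 < θ)
    (ha : θ < a.1) (hb : θ < b.1) (hr : ∀ x ∈ run, x.1 = θ) {j : ℕ} (hj : run.length = 2 * j)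
    (hj1 : 1 ≤ j)
    (hI : Inv M (a :: (run ++ b :: R)))
    (ih : Inv (M + 2) (a :: (b.1, M) :: R) → Csp ε (M + 2) (a :: (b.1, M) :: R)) :
    Csp ε M (a :: (run ++ b :: R)) := by
  have nd := hI.nd
  have lt := hI.lt
  simp only [List.map_cons, List.map_append] at nd
  have hsub : ((a.2 :: R.map Prod.snd)).Sublist (a.2 :: (run.map Prod.snd ++ b.2 :: R.map Prod.snd)) :=
    ((List.sublist_cons_self _ _).trans (List.sublist_append_right _ _)).cons_cons _
  have hRlt : ∀ v ∈ R.map Prod.snd, v < M := by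
    intro v hv
    obtain ⟨x, hx, rfl⟩ := List.mem_map.1 hv
    exact lt x (by simp [hx])
  have halt : a.2 < M := lt a (by simp)
  have hI' : Inv (M + 2) (a :: (b.1, M) :: R) := by
    refine ⟨?_, ?_, ?_, ?_, ?_, ?_⟩
    · simp only [List.map_cons]
      have h1 := nd.sublist hsub
      rw [List.nodup_cons] at h1 ⊢
      rw [List.nodup_cons]
      refine ⟨?_, ?_, h1.2⟩
      · rw [List.mem_cons, not_or]; exact ⟨halt.ne, h1.1⟩
      · intro h; exact lt_irrefl _ (hRlt M h)
    · intro x hx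
      rcases List.mem_cons.1 hx with rfl | hx
      · omega
      rcases List.mem_cons.1 hx with rfl | hx
      · simp
      · have := lt x (by simp [hx]); omega
    · intro x hx
      rcases List.mem_cons.1 hx with rfl | hx
      · exact hI.pos _ (by simp)
      rcases List.mem_cons.1 hx with rfl | hx
      · exact hI.pos b (by simp)
      · exact hI.pos x (by simp [hx])
    · have := hI.alt0
      simp only [alt, alt_even j run (b :: R) hr hj] at this ⊢
      linarith
    · have := hI.ev
      simp only [List.length_cons, List.length_append, hj, Nat.even_iff] at this ⊢; omega
    · simp
  obtain ⟨cl, h1, h2, h3, h4, h5⟩ := ih hI'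
  have ndV : (run.map Prod.snd ++ [b.2]).Nodup := by
    refine nd.sublist (List.Sublist.cons _ ?_)
    exact (List.Sublist.refl _).append (by simp)
  have hdis : ∀ v ∈ run.map Prod.snd ++ [b.2], v ∉ a.2 :: R.map Prod.snd := by
    grind
  have hVlt : ∀ v ∈ run.map Prod.snd ++ [b.2], v < M := by
    intro v hv
    rw [List.mem_append, List.mem_map, List.mem_singleton] at hv
    rcases hv with ⟨x, hx, rfl⟩ | rfl
    · exact lt x (by simp [hx])
    · exact lt b (by simp)
  have hlen : (a :: (run ++ b :: R)).length = R.length + 2 * j + 2 := by simp; omega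
  have hlen' : (a :: (b.1, M) :: R).length = R.length + 2 := by simp
  rw [hlen'] at h1
  have ndV1 : ((M + 1) :: (run.map Prod.snd ++ [b.2])).Nodup := by
    rw [List.nodup_cons]; exact ⟨fun h => by have := hVlt _ h; omega, ndV⟩
  have ndV2 : ([M, M + 1] : List ℕ).Nodup := by simp
  have hmem : ∀ v, v ∈ (a :: (b.1, M) :: R).map Prod.snd ↔ v = M ∨ v ∈ a.2 :: R.map Prod.snd := by
    intro v; simp only [List.map_cons, List.mem_cons]; tauto
  have hcz : ∀ v, v < M + 2 → v ≠ M → v ∉ a.2 :: R.map Prod.snd →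
      cl.countP (fun c => decide (v ∈ c.1)) = 0 := by
    intro v hv hvM hvR
    rw [List.countP_eq_zero]
    intro c hc
    simp only [decide_eq_true_eq]
    intro hvc
    have := (h2 c hc v hvc).1 hv
    rw [hmem] at this; tauto
  refine ⟨(((M + 1) :: (run.map Prod.snd ++ [b.2])).toFinset, j + 1) :: (([M, M + 1] : List ℕ).toFinset, 1) :: cl,
    ?_, ?_, ?_, ?_, ?_⟩
  · rw [hlen, List.length_cons, List.length_cons]; omega
  · intro c hc v hv
    rw [hlen]
    rcases List.mem_cons.1 hc with rfl | hc
    · rw [List.mem_toFinset, List.mem_cons] at hv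
      rcases hv with rfl | hv
      · exact ⟨by omega, by omega⟩
      have := hVlt v hv
      refine ⟨fun _ => ?_, by omega⟩
      simp only [List.map_cons, List.map_append] at hv ⊢
      simp only [List.mem_append, List.mem_cons, List.not_mem_nil, or_false] at hv ⊢; tauto
    rcases List.mem_cons.1 hc with rfl | hc
    · simp only [List.mem_toFinset, List.mem_cons, List.not_mem_nil, or_false] at hv
      constructor <;> omega
    · obtain ⟨h6, h7⟩ := h2 c hc v hv
      rw [hlen'] at h7
      refine ⟨fun h => ?_, by omega⟩
      have := (hmem v).1 (h6 (by omega))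
      simp only [List.map_cons, List.map_append]
      simp only [List.mem_append, List.mem_cons] at this ⊢
      rcases this with rfl | this
      · omega
      · tauto
  · intro v hv
    rw [List.countP_cons, List.countP_cons]
    rw [if_neg (c := decide (v ∈ ([M, M+1] : List ℕ).toFinset) = true) (by simp; omega)]
    by_cases hvV : v ∈ run.map Prod.snd ++ [b.2]
    · rw [hcz v (by omega) (by omega) (hdis v hvV)]; split_ifs <;> simp
    · rw [if_neg (by
        rw [decide_eq_true_eq, List.mem_toFinset, List.mem_cons, not_or]
        exact ⟨by omega, hvV⟩)]; exact h3 v (by omega)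
  · intro v hv
    rw [List.countP_cons, List.countP_cons]
    have hnV : v ∉ run.map Prod.snd ++ [b.2] := fun h => absurd (hVlt v h) (not_lt.2 hv)
    rcases eq_or_ne v M with rfl | hvM
    · rw [if_neg (c := decide (v ∈ ((v + 1) :: (run.map Prod.snd ++ [b.2])).toFinset) = true) (by
        rw [decide_eq_true_eq, List.mem_toFinset, List.mem_cons, not_or]
        exact ⟨by omega, hnV⟩)]
      have := h3 v (by omega)
      split_ifs <;> omega
    rcases eq_or_ne v (M + 1) with rfl | hvM1
    · rw [hcz (M + 1) (by omega) (by omega) (by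
        rw [List.mem_cons, not_or]
        exact ⟨by omega, fun h => by have := hRlt _ h; omega⟩)]
      split_ifs <;> omega
    · rw [if_neg (c := decide (v ∈ ([M, M+1] : List ℕ).toFinset) = true) (by simp; omega)]
      rw [if_neg (by
        rw [decide_eq_true_eq, List.mem_toFinset, List.mem_cons, not_or]
        exact ⟨by omega, hnV⟩)]
      exact h4 v (by omega)
  · intro β
    rw [wv_run hr, run_even hθ ha hb j _ _ (by simpa using hj)]
    have cc : ∀ b' : ℕ → Bool, (∀ v < M, b' v = β v) →
       (run.map Prod.snd ++ [b.2]).map b' = (run.map Prod.snd).map β ++ [β b.2] := by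
      intro b' hb'
      have e3 : (run.map Prod.snd).map β ++ [β b.2] = (run.map Prod.snd ++ [b.2]).map β := by simp
      rw [e3]
      apply List.map_congr_left
      intro v hv; exact hb' v (hVlt v hv)
    have e2 : ∀ b' : ℕ → Bool, (∀ v < M, b' v = β v) →
        wv b' (a :: (b.1, M) :: R) = (a.1, β a.2) :: (b.1, b' M) :: wv β R := by
      intro b' hb'
      have : wv b' R = wv β R := wv_congr (fun x hx => hb' _ (hRlt _ (List.mem_map_of_mem hx)))
      rw [← this, ← hb' _ halt]; rfl
    constructor
    · rintro ⟨w, h6, h7⟩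
      obtain ⟨β', hβ', hM0, hM1⟩ : ∃ β' : ℕ → Bool, (∀ v < M, β' v = β v) ∧ β' M = w ∧ β' (M + 1) = !w :=
        ⟨fun v => if v < M then β v else if v = M then w else !w, by
          intro v hv; simp [hv], by simp, by simp⟩
      rw [← hM0, ← e2 β' hβ', h5] at h7
      obtain ⟨b', h7, h8⟩ := h7
      have hb' : ∀ v < M, b' v = β v := fun v hv => by rw [h7 v (by omega), hβ' v hv]
      refine ⟨b', hb', ?_⟩
      intro c hc
      rcases List.mem_cons.1 hc with rfl | hc
      · simp only; rw [card_filter_list ndV1, List.map_cons, cc b' hb', List.count_cons, h6, h7 _ (by omega), hM1]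
        cases w <;> simp
      rcases List.mem_cons.1 hc with rfl | hc
      · simp only; rw [card_filter_list ndV2, List.map_cons, List.map_cons, h7 _ (by omega), h7 _ (by omega), hM1, hM0]
        cases w <;> simp
      · exact h8 c hc
    · rintro ⟨b', h7, h8⟩
      refine ⟨b' M, ?_, ?_⟩
      · have k1 := h8 _ (List.mem_cons_self)
        have k2 := h8 _ (List.mem_cons_of_mem _ List.mem_cons_self)
        simp only at k1 k2
        rw [card_filter_list ndV1, List.map_cons, cc b' h7, List.count_cons] at k1
        rw [card_filter_list ndV2] at k2
        simp only [List.map_cons, List.map_nil] at k2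
        cases u1 : b' M <;> cases u2 : b' (M + 1) <;> simp [u1, u2] at k1 k2 ⊢ <;> omega
      · rw [← e2 b' h7, h5]
        exact ⟨b', fun _ _ => rfl, fun c hc => h8 c (by simp [hc])⟩

theorem csp_all {ε : ZMod 2} (N : ℕ) : ∀ (l : List (ℝ × ℕ)) (M : ℕ), l.length ≤ N → Inv M l → Csp ε M l := by
  induction N with
  | zero => intro l M hl h; have := h.two; omega
  | succ N ih =>
    intro l M hl hI
    rcases decomp hI with ⟨θ, hθ, h⟩ | ⟨θ, s, t, a, run, b, R, hθ, rfl, hts, hne, hr, ha, hb⟩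
    · exact csp_const hI hθ h
    apply Csp.swap
    have hI2 := hI.swap
    have hlen : (t ++ s).length ≤ N + 1 := by rw [List.length_append] at hl ⊢; omega
    rw [hts] at hI2 hlen ⊢
    have hrl := List.length_pos_iff.2 hne
    simp only [List.length_cons, List.length_append] at hlen
    rcases Nat.even_or_odd' run.length with ⟨j, hj | hj⟩
    · exact csp_even hθ ha hb hr hj (by omega) hI2 (ih _ _ (by simp; omega))
    · exact csp_odd hθ ha hb hr hj hI2 (ih _ _ (by simp; omega))

end FC

set_option linter.unusedVariables false
set_option linter.unusedSimpArgs false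
namespace FC

def zl (n : ℕ) : List (ZMod n) := (List.range n).map fun i : ℕ => (i : ZMod n)

theorem zl_nodup (n : ℕ) : (zl n).Nodup := by
  apply List.Nodup.map_on _ List.nodup_range
  intro i hi j hj h
  rw [List.mem_range] at hi hj
  have := congrArg ZMod.val h
  rwa [ZMod.val_natCast_of_lt hi, ZMod.val_natCast_of_lt hj] at this

theorem mem_zl {n : ℕ} [NeZero n] (i : ZMod n) : i ∈ zl n :=
  List.mem_map.2 ⟨i.val, List.mem_range.2 (ZMod.val_lt i), ZMod.natCast_zmod_val i⟩

theorem cyc_zl {n : ℕ} [NeZero n] (p q : ZMod n) : (p, q) ∈ cyc (zl n) ↔ q = p + 1 := by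
  unfold cyc
  rw [List.mem_iff_getElem]
  simp only [List.getElem_zip, List.getElem_rotate, Prod.mk.injEq]
  simp only [zl, List.getElem_map, List.getElem_range, List.length_map, List.length_range, ZMod.natCast_mod,
    List.length_zip, List.length_rotate, min_self]
  constructor
  · rintro ⟨i, hi, rfl, rfl⟩; push_cast; rfl
  · rintro rfl
    exact ⟨p.val, ZMod.val_lt p, by simp, by simp⟩

theorem cyc_zlE {n : ℕ} [NeZero n] (E : ZMod n → Edge) (p q : Edge) :
    (p, q) ∈ cyc ((zl n).map E) ↔ ∃ i, p = E i ∧ q = E (i + 1) := by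
  rw [cyc_map, List.mem_map]
  constructor
  · rintro ⟨⟨i, j⟩, h, e⟩
    rw [cyc_zl] at h
    subst h
    simp only [Prod.map_apply, Prod.mk.injEq] at e
    exact ⟨i, e.1.symm, e.2.symm⟩
  · rintro ⟨i, rfl, rfl⟩
    exact ⟨(i, i + 1), (cyc_zl _ _).2 rfl, rfl⟩

theorem mem_zlE {n : ℕ} [NeZero n] (E : ZMod n → Edge) (p : Edge) :
    p ∈ (zl n).map E ↔ ∃ i, p = E i := by
  rw [List.mem_map]
  constructor
  · rintro ⟨i, _, h⟩; exact ⟨i, h.symm⟩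
  · rintro ⟨i, h⟩; exact ⟨i, mem_zl i, h.symm⟩

theorem zconst {n : ℕ} [NeZero n] {f : ZMod n → ℝ} (h : ∀ i, f (i + 1) = f i) (i : ZMod n) : f i = f 0 := by
  have : ∀ k : ℕ, f (k : ZMod n) = f 0 := by
    intro k
    induction k with
    | zero => simp
    | succ k ih => push_cast; rw [h, ih]
  rw [← ZMod.natCast_zmod_val i]; exact this _

theorem folded_step {n : ℕ} {θ : ZMod n → ℝ} (h : IsClosedCycle n θ) :
    ∃ sg : ZMod n → ℝ, (∀ i, sg i = 1 ∨ sg i = -1) ∧ (∀ i, sg (i + 1) = - sg i) ∧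
      ∀ i, foldedX n θ (i + 1) = foldedX n θ i + sg i * θ i := by
  obtain ⟨hev, h2, hpos, hs⟩ := h
  have : NeZero n := ⟨by omega⟩
  have : Fact (1 < n) := ⟨by omega⟩
  have hv : ∀ i : ZMod n, (i + 1).val = i.val + 1 ∨ ((i + 1).val = 0 ∧ i.val + 1 = n) := by
    intro i
    have h1 := ZMod.val_lt i
    rcases Nat.lt_or_ge (i.val + 1) n with h | h
    · left; rw [ZMod.val_add_of_lt]; simp [ZMod.val_one]; rwa [ZMod.val_one]
    · right; refine ⟨?_, by omega⟩
      rw [ZMod.val_add, ZMod.val_one, show i.val + 1 = n by omega, Nat.mod_self]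
  refine ⟨fun i => (-1) ^ i.val, fun i => neg_one_pow_eq_or ℝ _, ?_, ?_⟩
  · intro i
    simp only
    rcases hv i with h | ⟨h, h'⟩
    · rw [h, pow_succ]; ring
    · have hodd : Odd i.val := by
        rw [← h'] at hev
        rwa [Nat.even_add_one, Nat.not_even_iff_odd] at hev
      rw [h, hodd.neg_one_pow]; simp
  · intro i
    unfold foldedX
    rcases hv i with h | ⟨h, h'⟩
    · rw [h, Finset.sum_range_succ, ZMod.natCast_zmod_val]
    · rw [h, Finset.sum_range_zero]
      have hr : Finset.range n = Finset.range (i.val + 1) := by rw [h']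
      rw [hr, Finset.sum_range_succ] at hs
      rw [ZMod.natCast_zmod_val] at hs
      rw [hs]

theorem betw_affine {σ κ : ℝ} (hσ : σ = 1 ∨ σ = -1) (a b c : ℝ) :
    (κ + σ * c ∈ betw (κ + σ * a) (κ + σ * b)) ↔ c ∈ betw a b := by
  unfold betw
  simp only [Set.mem_Ioo, min_lt_iff, lt_max_iff]
  rcases hσ with rfl | rfl
  · grind
  · grind

theorem mem_betw (a b c : ℝ) : c ∈ betw a b ↔ btw a b c := by
  unfold betw btw
  simp only [Set.mem_Ioo, min_lt_iff, lt_max_iff]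
  grind

theorem VL_affine {n : ℕ} {σ κ : ℝ} (hσ : σ = 1 ∨ σ = -1) (x L : ZMod n → ℝ) :
    ValidLayering n (fun i => κ + σ * x i) L ↔ ValidLayering n x L := by
  have h0 : σ ≠ 0 := by rcases hσ with rfl | rfl <;> norm_num
  have hsg : ∀ a b c d : ℝ, Real.sign ((κ + σ * a) - (κ + σ * b)) = Real.sign ((κ + σ * c) - (κ + σ * d)) ↔
      Real.sign (a - b) = Real.sign (c - d) := by
    intro a b c d
    rcases hσ with rfl | rfl
    · rw [show κ + 1 * a - (κ + 1 * b) = a - b by ring, show κ + 1 * c - (κ + 1 * d) = c - d by ring]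
    · rw [show κ + -1 * a - (κ + -1 * b) = -(a - b) by ring,
        show κ + -1 * c - (κ + -1 * d) = -(c - d) by ring, Real.sign_neg, Real.sign_neg, neg_inj]
  unfold ValidLayering
  simp only [betw_affine hσ, hsg, add_right_inj, mul_right_inj' h0]

/-- noncrossing -/
theorem nc_iff {a b c d : ℝ} (hac : a ≠ c) (had : a ≠ d) (hbc : b ≠ c) (hbd : b ≠ d) (hab : a ≠ b) (hcd : c ≠ d) :
    (Disjoint (betw a b) (betw c d) ∨ betw a b ⊆ betw c d ∨ betw c d ⊆ betw a b) ↔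
      (btw c d a ↔ btw c d b) := by
  constructor
  · intro h
    by_contra hcon
    -- crossing
    have wit : (∃ x, x ∈ betw a b ∧ x ∈ betw c d) ∧ (∃ x, x ∈ betw a b ∧ x ∉ betw c d) ∧
        (∃ x, x ∈ betw c d ∧ x ∉ betw a b) := by
      have key : ∀ p q r : ℝ, p < q → q < r → ∃ u v, p < u ∧ u < q ∧ q < v ∧ v < r := by
        intro p q r h1 h2
        exact ⟨(p+q)/2, (q+r)/2, by linarith, by linarith, by linarith, by linarith⟩
      simp only [mem_betw]
      unfold btw at *
      have key2 : ∀ p q r s : ℝ, p < q → q < r → r < s → ∃ u v w, p < u ∧ u < q ∧ q < v ∧ v < r ∧ r < w ∧ w < s := by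
        intro p q r s h1 h2 h3
        exact ⟨(p+q)/2, (q+r)/2, (r+s)/2, by linarith, by linarith, by linarith, by linarith, by linarith, by linarith⟩
      have ord : (∃ p r q s, p < q ∧ q < r ∧ r < s ∧
          (((p = a ∧ r = b) ∨ (p = b ∧ r = a)) ∧ ((q = c ∧ s = d) ∨ (q = d ∧ s = c)))) ∨
          (∃ p r q s, p < q ∧ q < r ∧ r < s ∧
          (((p = c ∧ r = d) ∨ (p = d ∧ r = c)) ∧ ((q = a ∧ s = b) ∨ (q = b ∧ s = a)))) := by
        rcases lt_or_gt_of_ne hac with h1 | h1 <;> rcases lt_or_gt_of_ne had with h2 | h2 <;>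
        rcases lt_or_gt_of_ne hbc with h3 | h3 <;> rcases lt_or_gt_of_ne hbd with h4 | h4 <;>
        first
          | (exfalso; apply hcon; constructor <;> rintro (h | h) <;> first | (left; constructor <;> linarith) | (right; constructor <;> linarith) | (exfalso; linarith [h.1, h.2]))
          | (left; exact ⟨a, b, c, d, by linarith, by linarith, by linarith, by simp⟩)
          | (left; exact ⟨a, b, d, c, by linarith, by linarith, by linarith, by simp⟩)
          | (left; exact ⟨b, a, c, d, by linarith, by linarith, by linarith, by simp⟩)
          | (left; exact ⟨b, a, d, c, by linarith, by linarith, by linarith, by simp⟩)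
          | (right; exact ⟨c, d, a, b, by linarith, by linarith, by linarith, by simp⟩)
          | (right; exact ⟨c, d, b, a, by linarith, by linarith, by linarith, by simp⟩)
          | (right; exact ⟨d, c, a, b, by linarith, by linarith, by linarith, by simp⟩)
          | (right; exact ⟨d, c, b, a, by linarith, by linarith, by linarith, by simp⟩)
      rcases ord with ⟨p, r, q, s, h1, h2, h3, h4, h5⟩ | ⟨p, r, q, s, h1, h2, h3, h4, h5⟩
      · obtain ⟨u, v, w, _, _, _, _, _, _⟩ := key2 p q r s h1 h2 h3
        exact ⟨⟨v, by grind, by grind⟩, ⟨u, by grind, by grind⟩, ⟨w, by grind, by grind⟩⟩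
      · obtain ⟨u, v, w, _, _, _, _, _, _⟩ := key2 p q r s h1 h2 h3
        exact ⟨⟨v, by grind, by grind⟩, ⟨w, by grind, by grind⟩, ⟨u, by grind, by grind⟩⟩
    obtain ⟨⟨x, hx1, hx2⟩, ⟨y, hy1, hy2⟩, ⟨z, hz1, hz2⟩⟩ := wit
    rcases h with h | h | h
    · exact Set.disjoint_left.1 h hx1 hx2
    · exact hy2 (h hy1)
    · exact hz2 (h hz1)
  · intro h
    by_cases h1 : btw c d a
    · have h2 := h.1 h1
      right; left
      intro x hx
      rw [mem_betw] at hx ⊢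
      unfold btw at *
      grind
    · have h2 : ¬ btw c d b := fun h' => h1 (h.2 h')
      by_cases h3 : btw a b c
      · right; right
        intro x hx
        rw [mem_betw] at hx ⊢
        unfold btw at *
        grind
      · left
        rw [Set.disjoint_left]
        intro x hx hx'
        rw [mem_betw] at hx hx'
        unfold btw at *
        grind

end FC

set_option linter.unusedVariables false
set_option linter.unusedSimpArgs false
namespace FC

/-- setup: edges from coordinates -/
structure Set1 (n : ℕ) (y s : ZMod n → ℝ) (θ : ZMod n → ℝ) (E : ZMod n → Edge) : Prop where
  pm : ∀ i, s i = 1 ∨ s i = -1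
  al : ∀ i, s (i + 1) = - s i
  th : ∀ i, 0 < θ i
  ea : ∀ i, (E i).a = y i
  eb : ∀ i, (E i).b = y (i + 1)
  st : ∀ i, y (i + 1) = y i + s i * θ i

variable {n : ℕ} {y s θ : ZMod n → ℝ} {E : ZMod n → Edge}

theorem Set1.right (S : Set1 n y s θ E) {i : ZMod n} (h : s i = 1) :
    (E i).a < (E i).b ∧ (E i).lo = y i ∧ (E i).hi = y (i + 1) ∧ y i < y (i + 1) := by
  have h1 := S.st i
  have h2 := S.th i
  rw [h] at h1
  have h3 : y i < y (i + 1) := by linarith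
  refine ⟨?_, ?_, ?_, h3⟩
  · rw [S.ea, S.eb]; exact h3
  · unfold Edge.lo; rw [S.ea, S.eb]; exact min_eq_left h3.le
  · unfold Edge.hi; rw [S.ea, S.eb]; exact max_eq_right h3.le

theorem Set1.left (S : Set1 n y s θ E) {i : ZMod n} (h : s i = -1) :
    (E i).b < (E i).a ∧ (E i).lo = y (i + 1) ∧ (E i).hi = y i ∧ y (i + 1) < y i := by
  have h1 := S.st i
  have h2 := S.th i
  rw [h] at h1
  have h3 : y (i + 1) < y i := by linarith
  refine ⟨?_, ?_, ?_, h3⟩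
  · rw [S.ea, S.eb]; exact h3
  · unfold Edge.lo; rw [S.ea, S.eb]; exact min_eq_right h3.le
  · unfold Edge.hi; rw [S.ea, S.eb]; exact max_eq_left h3.le

theorem Set1.right_iff (S : Set1 n y s θ E) (i : ZMod n) : (E i).a < (E i).b ↔ s i = 1 := by
  rcases S.pm i with h | h
  · simp [h, (S.right h).1]
  · have := (S.left h).1
    rw [h]; constructor
    · intro h; linarith
    · intro h; norm_num at h

theorem Set1.left_iff (S : Set1 n y s θ E) (i : ZMod n) : (E i).b < (E i).a ↔ s i = -1 := by
  rcases S.pm i with h | h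
  · have := (S.right h).1
    rw [h]; constructor
    · intro h; linarith
    · intro h; norm_num at h
  · simp [h, (S.left h).1]

theorem Set1.sgn (S : Set1 n y s θ E) (i : ZMod n) : Real.sign (y (i + 1) - y i) = s i := by
  rcases S.pm i with h | h
  · rw [h]; apply Real.sign_of_pos; linarith [(S.right h).2.2.2]
  · rw [h]; apply Real.sign_of_neg; linarith [(S.left h).2.2.2]

theorem Set1.inside (S : Set1 n y s θ E) (i : ZMod n) (c : ℝ) :
    ((E i).lo < c ∧ c < (E i).hi) ↔ c ∈ betw (y i) (y (i + 1)) := by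
  unfold Edge.lo Edge.hi betw
  rw [S.ea, S.eb, Set.mem_Ioo]

theorem Set1.chn [NeZero n] (S : Set1 n y s θ E) : Chn ((zl n).map E) := by
  rintro ⟨p, q⟩ hc
  obtain ⟨i, rfl, rfl⟩ := (cyc_zlE E _ _).1 hc
  refine ⟨by simp only [S.ea, S.eb], ?_⟩
  simp only [S.right_iff, S.left_iff, S.al]
  rcases S.pm i with h | h <;> simp [h]

theorem Set1.CL [NeZero n] (S : Set1 n y s θ E) (p q : Edge) : CLof ((zl n).map E) p q ↔
    ∃ i, s i = 1 ∧ ((p = E i ∧ q = E (i + 1)) ∨ (p = E (i + 1) ∧ q = E i)) := by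
  unfold CLof
  simp only [cyc_zlE]
  constructor
  · rintro (⟨⟨i, rfl, rfl⟩, h⟩ | ⟨⟨i, rfl, rfl⟩, h⟩)
    · exact ⟨i, (S.right_iff i).1 h, by simp⟩
    · exact ⟨i, (S.right_iff i).1 h, by simp⟩
  · rintro ⟨i, h, ⟨rfl, rfl⟩ | ⟨rfl, rfl⟩⟩
    · exact Or.inl ⟨⟨i, rfl, rfl⟩, (S.right_iff i).2 h⟩
    · exact Or.inr ⟨⟨i, rfl, rfl⟩, (S.right_iff i).2 h⟩

theorem Set1.CR [NeZero n] (S : Set1 n y s θ E) (p q : Edge) : CRof ((zl n).map E) p q ↔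
    ∃ i, s i = -1 ∧ ((p = E i ∧ q = E (i + 1)) ∨ (p = E (i + 1) ∧ q = E i)) := by
  unfold CRof
  simp only [cyc_zlE]
  constructor
  · rintro (⟨⟨i, rfl, rfl⟩, h⟩ | ⟨⟨i, rfl, rfl⟩, h⟩)
    · exact ⟨i, (S.left_iff i).1 h, by simp⟩
    · exact ⟨i, (S.left_iff i).1 h, by simp⟩
  · rintro ⟨i, h, ⟨rfl, rfl⟩ | ⟨rfl, rfl⟩⟩
    · exact Or.inl ⟨⟨i, rfl, rfl⟩, (S.left_iff i).2 h⟩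
    · exact Or.inr ⟨⟨i, rfl, rfl⟩, (S.left_iff i).2 h⟩

theorem Set1.hi_eq (S : Set1 n y s θ E) {i : ZMod n} (h : s i = 1) :
    (E i).hi = y (i + 1) ∧ (E (i + 1)).hi = y (i + 1) :=
  ⟨(S.right h).2.2.1, (S.left (by rw [S.al, h])).2.2.1⟩

theorem Set1.lo_eq (S : Set1 n y s θ E) {i : ZMod n} (h : s i = -1) :
    (E i).lo = y (i + 1) ∧ (E (i + 1)).lo = y (i + 1) :=
  ⟨(S.left h).2.1, (S.right (by rw [S.al, h, neg_neg])).2.1⟩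

theorem btw_sym2 (a b c : ℝ) : btw a b c ↔ btw b a c := by unfold btw; tauto

/-- the noncrossing part, in index form -/
theorem Set1.nc (S : Set1 n y s θ E) (hinj : Function.Injective fun i => (E i).L) {i j : ZMod n}
    (hs : s i = s j) (hij : i ≠ j) :
    (Disjoint (betw (E i).L (E (i+1)).L) (betw (E j).L (E (j+1)).L) ∨
      betw (E i).L (E (i+1)).L ⊆ betw (E j).L (E (j+1)).L ∨
      betw (E j).L (E (j+1)).L ⊆ betw (E i).L (E (i+1)).L) ↔
    (btw (E j).L (E (j+1)).L (E i).L ↔ btw (E j).L (E (j+1)).L (E (i+1)).L) := by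
  have hne : ∀ k, s k ≠ s (k + 1) := by
    intro k h; rw [S.al] at h
    rcases S.pm k with h' | h' <;> rw [h'] at h <;> norm_num at h
  have hL : ∀ p q : ZMod n, p ≠ q → (E p).L ≠ (E q).L := fun p q h h' => h (hinj h')
  apply nc_iff
  · exact hL _ _ hij
  · apply hL; rintro rfl; exact hne _ hs.symm
  · apply hL; rintro rfl; exact hne _ hs
  · apply hL; intro h; exact hij (add_right_cancel h)
  · apply hL; intro h; exact hne i (congrArg s h)
  · apply hL; intro h; exact hne j (congrArg s h)

theorem Set1.geo_of_valid [NeZero n] (S : Set1 n y s θ E) (hV : ValidLayering n y fun i => (E i).L) :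
    GeoL ((zl n).map E) := by
  obtain ⟨hinj, h1, h2⟩ := hV
  have h1' : ∀ i e, (E e).lo < y (i + 1) → y (i + 1) < (E e).hi → ¬ btw (E i).L (E (i+1)).L (E e).L := by
    intro i e ha hb hc
    have := h1 (i + 1) e ((S.inside e _).1 ⟨ha, hb⟩)
    simp only [add_sub_cancel_right, mem_betw] at this
    exact this hc
  have h2' : ∀ i j, s i = s j → y (i + 1) = y (j + 1) →
      (btw (E j).L (E (j+1)).L (E i).L ↔ btw (E j).L (E (j+1)).L (E (i+1)).L) := by
    intro i j hs hy
    rcases eq_or_ne i j with rfl | hij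
    · unfold btw; constructor <;> intro h <;> exfalso <;> rcases h with h | h <;> linarith [h.1, h.2]
    rw [← S.nc hinj hs hij]
    have := h2 (i + 1) (j + 1) (fun h => hij (add_right_cancel h)) hy
      (by rw [S.sgn, S.sgn, S.al, S.al, hs])
    simpa only [add_sub_cancel_right] using this
  constructor
  · intro e he
    obtain ⟨i, rfl⟩ := (mem_zlE E e).1 he
    rcases S.pm i with h | h
    · obtain ⟨_, a, b, c⟩ := S.right h; rw [a, b]; exact c
    · obtain ⟨_, a, b, c⟩ := S.left h; rw [a, b]; exact c
  · intro e f he hf hL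
    obtain ⟨i, rfl⟩ := (mem_zlE E e).1 he
    obtain ⟨j, rfl⟩ := (mem_zlE E f).1 hf
    rw [hinj hL]
  · intro p q h; exact h.symm
  · intro p q h; exact h.symm
  · intro p q h
    obtain ⟨i, hi, ⟨rfl, rfl⟩ | ⟨rfl, rfl⟩⟩ := (S.CL p q).1 h
    · exact ⟨(mem_zlE E _).2 ⟨_, rfl⟩, (mem_zlE E _).2 ⟨_, rfl⟩, by rw [(S.hi_eq hi).1, (S.hi_eq hi).2]⟩
    · exact ⟨(mem_zlE E _).2 ⟨_, rfl⟩, (mem_zlE E _).2 ⟨_, rfl⟩, by rw [(S.hi_eq hi).1, (S.hi_eq hi).2]⟩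
  · intro p q h
    obtain ⟨i, hi, ⟨rfl, rfl⟩ | ⟨rfl, rfl⟩⟩ := (S.CR p q).1 h
    · exact ⟨(mem_zlE E _).2 ⟨_, rfl⟩, (mem_zlE E _).2 ⟨_, rfl⟩, by rw [(S.lo_eq hi).1, (S.lo_eq hi).2]⟩
    · exact ⟨(mem_zlE E _).2 ⟨_, rfl⟩, (mem_zlE E _).2 ⟨_, rfl⟩, by rw [(S.lo_eq hi).1, (S.lo_eq hi).2]⟩
  · intro p q g h hg ha hb
    obtain ⟨e, rfl⟩ := (mem_zlE E g).1 hg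
    obtain ⟨i, hi, ⟨rfl, rfl⟩ | ⟨rfl, rfl⟩⟩ := (S.CL p q).1 h
    · rw [(S.hi_eq hi).1] at ha hb; exact h1' i e ha hb
    · rw [(S.hi_eq hi).2] at ha hb; rw [btw_sym2]; exact h1' i e ha hb
  · intro p q g h hg ha hb
    obtain ⟨e, rfl⟩ := (mem_zlE E g).1 hg
    obtain ⟨i, hi, ⟨rfl, rfl⟩ | ⟨rfl, rfl⟩⟩ := (S.CR p q).1 h
    · rw [(S.lo_eq hi).1] at ha hb; exact h1' i e ha hb
    · rw [(S.lo_eq hi).2] at ha hb; rw [btw_sym2]; exact h1' i e ha hb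
  · intro p q p' q' h h' hh
    obtain ⟨i, hi, hpq⟩ := (S.CL p q).1 h
    obtain ⟨j, hj, hpq'⟩ := (S.CL p' q').1 h'
    have e1 : p.hi = y (i + 1) := by
      rcases hpq with ⟨rfl, rfl⟩ | ⟨rfl, rfl⟩; exacts [(S.hi_eq hi).1, (S.hi_eq hi).2]
    have e2 : p'.hi = y (j + 1) := by
      rcases hpq' with ⟨rfl, rfl⟩ | ⟨rfl, rfl⟩; exacts [(S.hi_eq hj).1, (S.hi_eq hj).2]
    have key := h2' i j (by rw [hi, hj]) (by rw [← e1, ← e2, hh])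
    rcases hpq with ⟨rfl, rfl⟩ | ⟨rfl, rfl⟩ <;> rcases hpq' with ⟨rfl, rfl⟩ | ⟨rfl, rfl⟩
    · exact key
    · rw [btw_sym2, btw_sym2 (E (j+1)).L]; exact key
    · exact key.symm
    · rw [btw_sym2, btw_sym2 (E (j+1)).L]; exact key.symm
  · intro p q p' q' h h' hh
    obtain ⟨i, hi, hpq⟩ := (S.CR p q).1 h
    obtain ⟨j, hj, hpq'⟩ := (S.CR p' q').1 h'
    have e1 : p.lo = y (i + 1) := by
      rcases hpq with ⟨rfl, rfl⟩ | ⟨rfl, rfl⟩; exacts [(S.lo_eq hi).1, (S.lo_eq hi).2]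
    have e2 : p'.lo = y (j + 1) := by
      rcases hpq' with ⟨rfl, rfl⟩ | ⟨rfl, rfl⟩; exacts [(S.lo_eq hj).1, (S.lo_eq hj).2]
    have key := h2' i j (by rw [hi, hj]) (by rw [← e1, ← e2, hh])
    rcases hpq with ⟨rfl, rfl⟩ | ⟨rfl, rfl⟩ <;> rcases hpq' with ⟨rfl, rfl⟩ | ⟨rfl, rfl⟩
    · exact key
    · rw [btw_sym2, btw_sym2 (E (j+1)).L]; exact key
    · exact key.symm
    · rw [btw_sym2, btw_sym2 (E (j+1)).L]; exact key.symm

theorem Set1.valid_of_geo [NeZero n] (S : Set1 n y s θ E) (hE : Function.Injective E)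
    (G : GeoL ((zl n).map E)) : ValidLayering n y fun i => (E i).L := by
  have hm : ∀ i, E i ∈ (zl n).map E := fun i => (mem_zlE E _).2 ⟨i, rfl⟩
  have hinj : Function.Injective fun i => (E i).L := fun i j h => hE (G.inj _ _ (hm i) (hm j) h)
  refine ⟨hinj, ?_, ?_⟩
  · intro i e hx hL
    obtain ⟨k, rfl⟩ : ∃ k, i = k + 1 := ⟨i - 1, by ring⟩
    simp only [add_sub_cancel_right, mem_betw] at hL
    rw [← S.inside] at hx
    rcases S.pm k with h | h
    · exact G.l1 (E k) (E (k+1)) (E e) ((S.CL _ _).2 ⟨k, h, by simp⟩) (hm e)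
        (by rw [(S.hi_eq h).1]; exact hx.1) (by rw [(S.hi_eq h).1]; exact hx.2) hL
    · exact G.r1 (E k) (E (k+1)) (E e) ((S.CR _ _).2 ⟨k, h, by simp⟩) (hm e)
        (by rw [(S.lo_eq h).1]; exact hx.1) (by rw [(S.lo_eq h).1]; exact hx.2) hL
  · intro i j hij hy hs
    obtain ⟨k, rfl⟩ : ∃ k, i = k + 1 := ⟨i - 1, by ring⟩
    obtain ⟨m, rfl⟩ : ∃ k, j = k + 1 := ⟨j - 1, by ring⟩
    have hs' : s k = s m := by
      rw [S.sgn, S.sgn, S.al, S.al] at hs; linarith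
    simp only [add_sub_cancel_right]
    rw [S.nc hinj hs' (fun h => hij (by rw [h]))]
    rcases S.pm k with h | h
    · have h' : s m = 1 := by rw [← hs', h]
      exact G.l2 (E k) (E (k+1)) (E m) (E (m+1)) ((S.CL _ _).2 ⟨k, h, by simp⟩) ((S.CL _ _).2 ⟨m, h', by simp⟩)
        (by rw [(S.hi_eq h).1, (S.hi_eq h').1, hy])
    · have h' : s m = -1 := by rw [← hs', h]
      exact G.r2 (E k) (E (k+1)) (E m) (E (m+1)) ((S.CR _ _).2 ⟨k, h, by simp⟩) ((S.CR _ _).2 ⟨m, h', by simp⟩)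
        (by rw [(S.lo_eq h).1, (S.lo_eq h').1, hy])

theorem Set1.mv [NeZero n] (S : Set1 n y s θ E) (hinj : Function.Injective fun i => (E i).L) :
    MVok ((zl n).map E) ↔
      ∀ i, (E i).m = true ↔ ¬ (s (i - 1) = Real.sign ((E i).L - (E (i - 1)).L)) := by
  have key : ∀ i, ((E i).a < (E i).b ↔ (E i).L < (E (i+1)).L) ↔ s i = Real.sign ((E (i+1)).L - (E i).L) := by
    intro i
    rw [S.right_iff]
    have hne : (E i).L ≠ (E (i+1)).L := by
      intro h
      have h2 := congrArg s (hinj h)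
      rw [S.al] at h2
      rcases S.pm i with h' | h' <;> rw [h'] at h2 <;> norm_num at h2
    rcases lt_or_gt_of_ne hne with h | h
    · rw [Real.sign_of_pos (by linarith)]; simp [h]
    · rw [Real.sign_of_neg (by linarith)]
      simp only [not_lt.2 h.le, iff_false]
      rcases S.pm i with h' | h' <;> rw [h'] <;> norm_num
  constructor
  · intro h i
    obtain ⟨k, rfl⟩ : ∃ k, i = k + 1 := ⟨i - 1, by ring⟩
    have := h (E k, E (k+1)) ((cyc_zlE E _ _).2 ⟨k, rfl, rfl⟩)
    simp only [key] at this
    simpa only [add_sub_cancel_right] using this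
  · rintro h ⟨p, q⟩ hc
    obtain ⟨k, rfl, rfl⟩ := (cyc_zlE E _ _).1 hc
    have := h (k + 1)
    simp only [add_sub_cancel_right] at this
    simp only [key]
    exact this

theorem Set1.J [NeZero n] (S : Set1 n y s θ E) {t : ZMod n} (ht : ∀ j, (E j).L ≤ (E t).L) :
    Jv ((zl n).map E) (E t) = ind (s t = 1) := by
  unfold Jv
  rw [S.right_iff]
  have : NH ((zl n).map E) (E t) = 0 := by
    unfold NH
    apply List.sum_eq_zero
    intro z hz
    obtain ⟨g, hg, rfl⟩ := List.mem_map.1 hz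
    obtain ⟨j, rfl⟩ := (mem_zlE E g).1 hg
    unfold ind
    rw [if_neg]
    intro h; exact absurd h.1 (not_lt.2 (ht j))
  rw [this, zero_add]

end FC

set_option linter.unusedVariables false
set_option linter.unusedSimpArgs false
namespace FC

def eD : Des → ZMod 2
  | Des.interior => 0
  | Des.exterior => 1

theorem ind_eD {d : Des} {r : ℝ} (hr : r = 1 ∨ r = -1) : ind (r = 1) = eD d ↔ r = epsOf d := by
  have h1 : (1 : ℝ) ≠ -1 := by norm_num
  have h2 : (-1 : ℝ) ≠ 1 := by norm_num
  rcases hr with rfl | rfl <;> cases d <;> simp [ind, eD, epsOf, h1, h2]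

noncomputable def wordOf (n : ℕ) (θ : ZMod n → ℝ) (μ : ZMod n → MV) : List (ℝ × Bool) :=
  (zl n).map fun i => (θ i, decide (μ i = MV.mountain))

theorem mv_m (m : MV) (P : Prop) : ((decide (m = MV.mountain) = true) ↔ ¬ P) ↔ (m = MV.valley ↔ P) := by
  cases m <;> simp

theorem prop_sign {n : ℕ} [NeZero n] {s sg : ZMod n → ℝ} (h1 : ∀ i, s i = 1 ∨ s i = -1)
    (h2 : ∀ i, s (i + 1) = - s i) (h3 : ∀ i, sg i = 1 ∨ sg i = -1) (h4 : ∀ i, sg (i + 1) = - sg i) :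
    ∃ σ : ℝ, (σ = 1 ∨ σ = -1) ∧ ∀ i, s i = σ * sg i := by
  have hc := zconst (f := fun i => s i * sg i) (by intro i; simp only [h2, h4]; ring)
  refine ⟨s 0 * sg 0, ?_, ?_⟩
  · rcases h1 0 with h | h <;> rcases h3 0 with h' | h' <;> rw [h, h'] <;> norm_num
  · intro i
    have := hc i
    rw [← this]
    rcases h3 i with h' | h' <;> rw [h'] <;> ring

theorem FF_of_flat {n : ℕ} {θ : ZMod n → ℝ} (hcc : IsClosedCycle n θ) {μ : ZMod n → MV} {d : Des}
    (h : FlatFoldable n θ μ d) : FF (eD d) (wordOf n θ μ) := by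
  obtain ⟨sg, g1, g2, g3⟩ := folded_step hcc
  have : NeZero n := ⟨by have := hcc.2.1; omega⟩
  obtain ⟨L, hV, t, ht, s, pm, al, st, hμ⟩ := h
  obtain ⟨σ, hσ, hs⟩ := prop_sign pm al g1 g2
  obtain ⟨E, hE⟩ : ∃ E : ZMod n → Edge, E = fun i => ⟨0 + σ * foldedX n θ i, 0 + σ * foldedX n θ (i + 1), L i,
    decide (μ i = MV.mountain)⟩ := ⟨_, rfl⟩
  have S : Set1 n (fun i => 0 + σ * foldedX n θ i) s θ E := by
    refine ⟨pm, al, hcc.2.2.1, ?_, ?_, ?_⟩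
    · intro i; rw [hE]
    · intro i; rw [hE]
    · intro i; rw [g3, hs]; ring
  have hEL : (fun i => (E i).L) = L := by rw [hE]
  have hV' := (VL_affine (κ := 0) hσ (foldedX n θ) L).2 hV
  rw [← hEL] at hV'
  refine ⟨(zl n).map E, ?_, ?_, S.chn, S.geo_of_valid hV', ?_, E t, (mem_zlE E _).2 ⟨t, rfl⟩, ?_⟩
  · unfold wordOf
    rw [List.map_map]
    apply List.map_congr_left
    intro i _
    simp only [Function.comp, wd, S.ea, S.eb]
    rw [S.st i]
    have : (E i).m = decide (μ i = MV.mountain) := by rw [hE]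
    rw [this, add_sub_cancel_left, abs_mul, abs_of_pos (S.th i)]
    rcases pm i with h | h <;> rw [h] <;> simp
  · exact (zl_nodup n).map (fun i j hij => hV'.1 (congrArg Edge.L hij))
  · rw [S.mv hV'.1]
    intro i
    have e1 : (E i).m = decide (μ i = MV.mountain) := by rw [hE]
    have e2 : ∀ i, (E i).L = L i := fun i => congrFun hEL i
    rw [e1, e2, e2, mv_m]; exact hμ i
  · have e2 : ∀ i, (E i).L = L i := fun i => congrFun hEL i
    rw [S.J (t := t) (by intro j; rw [e2, e2]; exact ht j), ind_eD (pm t)]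
    exact st

theorem flat_of_FF {n : ℕ} {θ : ZMod n → ℝ} (hcc : IsClosedCycle n θ) {μ : ZMod n → MV} {d : Des}
    (h : FF (eD d) (wordOf n θ μ)) : FlatFoldable n θ μ d := by
  obtain ⟨sg, g1, g2, g3⟩ := folded_step hcc
  have : NeZero n := ⟨by have := hcc.2.1; omega⟩
  obtain ⟨l, hl, hG⟩ := h
  have hlen : l.length = n := by
    have := congrArg List.length hl
    simpa [wordOf, zl] using this
  obtain ⟨E, rfl⟩ : ∃ E : ZMod n → Edge, l = (zl n).map E := by
    refine ⟨fun i => l[i.val]!, ?_⟩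
    apply List.ext_getElem
    · simp [zl, hlen]
    · intro i h1 h2
      simp only [zl, List.getElem_map, List.getElem_range]
      rw [ZMod.val_natCast_of_lt (by omega), getElem!_pos l i h1]
  unfold wordOf at hl
  rw [List.map_map, List.map_inj_left] at hl
  have hw : ∀ i, wd (E i) = (θ i, decide (μ i = MV.mountain)) := fun i => hl i (mem_zl i)
  have hGJ := fun t => hG.J (p := E t) ((mem_zlE E _).2 ⟨t, rfl⟩)
  obtain ⟨nd, hC, G, hM, _⟩ := hG
  have hC' : ∀ i, _ := fun i => hC (E i, E (i + 1)) ((cyc_zlE E _ _).2 ⟨i, rfl, rfl⟩)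
  simp only at hC'
  have hEinj : Function.Injective E := by
    intro i j hij
    exact List.inj_on_of_nodup_map nd (mem_zl i) (mem_zl j) hij
  obtain ⟨s, hs⟩ : ∃ s : ZMod n → ℝ, s = fun i => if (E i).a < (E i).b then 1 else -1 := ⟨_, rfl⟩
  have s1 : ∀ i, (E i).a < (E i).b → s i = 1 := fun i h => by rw [hs]; simp [h]
  have s2 : ∀ i, (E i).b < (E i).a → s i = -1 := fun i h => by rw [hs]; simp [not_lt.2 h.le]
  have S : Set1 n (fun i => (E i).a) s θ E := by
    refine ⟨?_, ?_, hcc.2.2.1, fun _ => rfl, fun i => (hC' i).1, ?_⟩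
    · intro i
      rcases (hC' i).2 with ⟨a, b⟩ | ⟨a, b⟩
      · left; exact s1 i a
      · right; exact s2 i a
    · intro i
      rcases (hC' i).2 with ⟨a, b⟩ | ⟨a, b⟩
      · rw [s1 i a, s2 _ b]
      · rw [s2 i a, s1 _ b, neg_neg]
    · intro i
      have h1 : |(E i).b - (E i).a| = θ i := congrArg Prod.fst (hw i)
      rw [← (hC' i).1, ← h1]
      rcases (hC' i).2 with ⟨a, b⟩ | ⟨a, b⟩
      · rw [s1 i a, abs_of_pos (by linarith)]; ring
      · rw [s2 i a, abs_of_neg (by linarith)]; ring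
  obtain ⟨σ, hσ, hss⟩ := prop_sign S.pm S.al g1 g2
  have hc := zconst (f := fun i => (E i).a - σ * foldedX n θ i) (by
    intro i
    have := S.st i
    rw [this, g3, hss]; ring)
  have hy : (fun i => (E i).a) = fun i => ((E 0).a - σ * foldedX n θ 0) + σ * foldedX n θ i := by
    funext i
    have := hc i
    linarith
  have hV := S.valid_of_geo hEinj G
  rw [hy, VL_affine hσ] at hV
  refine ⟨fun i => (E i).L, hV, ?_⟩
  obtain ⟨t, ht⟩ := Finite.exists_max (fun i => (E i).L)
  refine ⟨t, ht, s, S.pm, S.al, ?_, ?_⟩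
  · rw [← ind_eD (S.pm t), ← S.J ht]; exact hGJ t
  · intro i
    have := (S.mv hV.1).1 hM i
    have e1 : (E i).m = decide (μ i = MV.mountain) := congrArg Prod.snd (hw i)
    rw [e1, mv_m] at this
    exact this

theorem FF_iff {n : ℕ} {θ : ZMod n → ℝ} (hcc : IsClosedCycle n θ) (μ : ZMod n → MV) (d : Des) :
    FlatFoldable n θ μ d ↔ FF (eD d) (wordOf n θ μ) := ⟨FF_of_flat hcc, flat_of_FF hcc⟩

end FC

set_option linter.unusedVariables false
set_option linter.unusedSimpArgs false
namespace FC

theorem alt_range (f : ℕ → ℝ × ℕ) (n : ℕ) :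
    alt ((List.range n).map f) = ∑ j ∈ Finset.range n, (-1 : ℝ) ^ j * (f j).1 := by
  induction n with
  | zero => simp [alt]
  | succ n ih =>
    rw [List.range_succ, List.map_append, alt_append, ih, Finset.sum_range_succ]
    simp [alt]

theorem countP_card {α : Type} (cl : List α) (p : α → Bool) :
    ((Finset.univ : Finset (Fin cl.length)).filter fun j => p (cl.get j) = true).card = cl.countP p := by
  induction cl with
  | nil => simp
  | cons a t ih =>
    rw [List.countP_cons, ← ih]
    rw [Finset.card_filter, Finset.card_filter]
    have := Fin.sum_univ_succ (n := t.length) (fun j => if p ((a :: t).get j) = true then 1 else 0)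
    simp only [List.length_cons] at this ⊢
    rw [this, add_comm]
    rfl

theorem three {α : Type} (cl : List α) (p : α → Bool) (h : cl.countP p ≤ 2) (a b c : Fin cl.length)
    (ha : p (cl.get a) = true) (hb : p (cl.get b) = true) (hc : p (cl.get c) = true) :
    a = b ∨ a = c ∨ b = c := by
  by_contra hcon
  push Not at hcon
  have h3 : ({a, b, c} : Finset (Fin cl.length)).card = 3 :=
    Finset.card_eq_three.2 ⟨a, b, c, hcon.1, hcon.2.1, hcon.2.2, rfl⟩
  have h4 : ({a, b, c} : Finset (Fin cl.length)) ⊆ Finset.univ.filter fun j => p (cl.get j) = true := by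
    intro x hx
    simp only [Finset.mem_insert, Finset.mem_singleton] at hx
    rw [Finset.mem_filter]
    rcases hx with rfl | rfl | rfl
    · exact ⟨Finset.mem_univ _, ha⟩
    · exact ⟨Finset.mem_univ _, hb⟩
    · exact ⟨Finset.mem_univ _, hc⟩
  have := Finset.card_le_card h4
  rw [countP_card, h3] at this
  omega

/-- numbering of the variables -/
def num (n : ℕ) : ZMod n ⊕ Fin n → ℕ := Sum.elim ZMod.val (fun w => n + w.val)

theorem num_inj {n : ℕ} [NeZero n] : Function.Injective (num n) := by
  rintro (i | i) (j | j) h <;> simp only [num, Sum.elim_inl, Sum.elim_inr] at h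
  · rw [ZMod.val_injective n h]
  · have := ZMod.val_lt i; omega
  · have := ZMod.val_lt j; omega
  · congr 1; apply Fin.ext; omega

theorem num_surj {n : ℕ} [NeZero n] {v : ℕ} (h : v < n + n) : ∃ u, num n u = v := by
  rcases Nat.lt_or_ge v n with h1 | h1
  · exact ⟨Sum.inl (v : ZMod n), ZMod.val_natCast_of_lt h1⟩
  · exact ⟨Sum.inr ⟨v - n, by omega⟩, by simp only [num, Sum.elim_inr]; omega⟩

open Classical in
noncomputable def cset (n : ℕ) [NeZero n] (S : Finset ℕ) : Finset (ZMod n ⊕ Fin n) :=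
  S.preimage (num n) num_inj.injOn

theorem mem_cset {n : ℕ} [NeZero n] {S : Finset ℕ} {u : ZMod n ⊕ Fin n} : u ∈ cset n S ↔ num n u ∈ S := by
  unfold cset; rw [Finset.mem_preimage]

theorem card_cset {n : ℕ} [NeZero n] {S : Finset ℕ} (hS : ∀ v ∈ S, v < n + n) (f : ZMod n ⊕ Fin n → Bool)
    (b : ℕ → Bool) (h : ∀ u, b (num n u) = f u) :
    ((cset n S).filter fun u => f u = true).card = (S.filter fun v => b v = true).card := by
  refine Finset.card_bij (fun u _ => num n u) ?_ ?_ ?_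
  · intro u hu
    rw [Finset.mem_filter, mem_cset] at hu
    rw [Finset.mem_filter, h]; exact hu
  · intro u _ u' _ e; exact num_inj e
  · intro v hv
    rw [Finset.mem_filter] at hv
    obtain ⟨u, rfl⟩ := num_surj (hS v hv.1)
    refine ⟨u, ?_, rfl⟩
    rw [Finset.mem_filter, mem_cset, ← h]; exact hv

end FC

open FC
theorem face_constraints_csp (n : ℕ) (θ : ZMod n → ℝ)
    (hcc : IsClosedCycle n θ) (d : Des) :
    ∃ (W : Type) (instW : Fintype W) (N : ℕ)
      (clauses : Fin N → Finset (ZMod n ⊕ W) × ℕ),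
      @Fintype.card W instW ≤ n ∧ N ≤ n ∧
      (∀ v : ZMod n ⊕ W, ∀ j₁ j₂ j₃ : Fin N,
        v ∈ (clauses j₁).1 → v ∈ (clauses j₂).1 → v ∈ (clauses j₃).1 →
          j₁ = j₂ ∨ j₁ = j₃ ∨ j₂ = j₃) ∧
      ∀ μ : ZMod n → MV,
        FlatFoldable n θ μ d ↔
          ∃ b : W → Bool, ∀ j : Fin N,
            ((clauses j).1.filter fun v =>
                Sum.elim (fun i => decide (μ i = MV.mountain)) b v = true).card
              = (clauses j).2 := by
  have hn : NeZero n := ⟨by have := hcc.2.1; omega⟩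
  have hlen : ((List.range n).map fun i : ℕ => (θ (i : ZMod n), i)).length = n := by simp
  have hsnd : ((List.range n).map fun i : ℕ => (θ (i : ZMod n), i)).map Prod.snd = List.range n := by
    rw [List.map_map]; exact List.map_id _
  have hI : Inv n ((List.range n).map fun i : ℕ => (θ (i : ZMod n), i)) := by
    refine ⟨?_, ?_, ?_, ?_, ?_, ?_⟩
    · rw [hsnd]; exact List.nodup_range
    · intro x hx
      obtain ⟨i, hi, rfl⟩ := List.mem_map.1 hx
      exact List.mem_range.1 hi
    · intro x hx
      obtain ⟨i, hi, rfl⟩ := List.mem_map.1 hx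
      exact hcc.2.2.1 _
    · rw [alt_range]; exact hcc.2.2.2
    · rw [hlen]; exact hcc.1
    · rw [hlen]; exact hcc.2.1
  obtain ⟨cl, h1, h2, h3, h4, h5⟩ := csp_all (ε := eD d) n _ n hlen.le hI
  rw [hlen] at h1 h2
  refine ⟨Fin n, inferInstance, cl.length, fun j => (cset n (cl.get j).1, (cl.get j).2), ?_, by omega, ?_, ?_⟩
  · simp
  · intro v j₁ j₂ j₃ k1 k2 k3
    simp only [mem_cset] at k1 k2 k3
    refine three cl (fun c => decide (num n v ∈ c.1)) ?_ j₁ j₂ j₃ (decide_eq_true k1) (decide_eq_true k2)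
      (decide_eq_true k3)
    rcases Nat.lt_or_ge (num n v) n with h | h
    · exact (h3 _ h).trans (by norm_num)
    · exact h4 _ h
  · intro μ
    have hS : ∀ j : Fin cl.length, ∀ v ∈ (cl.get j).1, v < n + n :=
      fun j v hv => (h2 _ (List.get_mem cl j) v hv).2
    have hword : wv (fun v => decide (μ (v : ZMod n) = MV.mountain))
        ((List.range n).map fun i : ℕ => (θ (i : ZMod n), i)) = wordOf n θ μ := by
      unfold wv wordOf zl
      rw [List.map_map, List.map_map]; rfl
    rw [FF_iff hcc, ← hword, h5]
    constructor
    · rintro ⟨b, hb, hs⟩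
      refine ⟨fun w => b (n + w.val), fun j => ?_⟩
      have := hs _ (List.get_mem cl j)
      rw [← this]
      apply card_cset (hS j)
      rintro (i | w)
      · simp only [num, Sum.elim_inl]
        rw [hb _ (ZMod.val_lt i), ZMod.natCast_zmod_val]
      · rfl
    · rintro ⟨b, hs⟩
      refine ⟨fun v => if h : v < n then decide (μ (v : ZMod n) = MV.mountain) else
        if h' : v - n < n then b ⟨v - n, h'⟩ else false, fun v hv => by simp only [hv, dif_pos], ?_⟩
      intro c hc
      obtain ⟨j, rfl⟩ := List.get_of_mem hc
      rw [← hs j]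
      symm
      apply card_cset (hS j)
      rintro (i | w)
      · simp only [num, Sum.elim_inl, ZMod.val_lt i, dif_pos, ZMod.natCast_zmod_val]
      · simp [num]
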